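/- Let N and p be primes with p ≥ 5 and N ≡ −1 (mod p). Then p divides the class number of Q(N^{1/p}). -/

import Mathlib

noncomputable section

namespace ConeWeight

open NumberField NumberField.Units NumberField.Units.dirichletUnitTheorem NumberField.mixedEmbedding

/-- The piecewise linear bump function supported on `[-1, 1]`. -/
def tent (x : ℝ) : ℝ := max 0 (1 - |x|)

lemma tent_nonneg (x : ℝ) : 0 ≤ tent x := le_max_left _ _

lemma tent_le_one (x : ℝ) : tent x ≤ 1 := max_le zero_le_one (by linarith [abs_nonneg x])

lemma abs_lt_one_of_tent_ne_zero {x : ℝ} (h : tent x ≠ 0) : |x| < 1 := by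
  by_contra! h'
  exact h (max_eq_left (by linarith))

lemma abs_tent_sub_tent_le (x y : ℝ) : |tent x - tent y| ≤ |x - y| := by
  have h := abs_max_sub_max_le_max 0 (1 - |x|) 0 (1 - |y|)
  refine h.trans (max_le (by simp) ?_)
  rw [show 1 - |x| - (1 - |y|) = |y| - |x| by ring, abs_sub_comm x y]
  exact abs_abs_sub_abs_le _ _

lemma hasSum_tent (x : ℝ) : HasSum (fun m : ℤ ↦ tent (x + m)) 1 := by
  have hf0 := Int.fract_nonneg x
  have hf1 := Int.fract_lt_one x
  have hx := Int.floor_add_fract x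
  have h : HasSum (fun m : ℤ ↦ tent (x + m)) (∑ m ∈ {-⌊x⌋, -⌊x⌋ - 1}, tent (x + (m : ℤ))) :=
    hasSum_sum_of_ne_finset_zero (fun m hm ↦ by
      by_contra h
      have h1 := abs_lt.mp (abs_lt_one_of_tent_ne_zero h)
      have h2 : -⌊x⌋ - 2 < m := by
        have : ((-⌊x⌋ - 2 : ℤ) : ℝ) < m := by push_cast; linarith
        exact_mod_cast this
      have h3 : m < -⌊x⌋ + 1 := by
        have : (m : ℝ) < ((-⌊x⌋ + 1 : ℤ) : ℝ) := by push_cast; linarith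
        exact_mod_cast this
      simp only [Finset.mem_insert, Finset.mem_singleton] at hm
      omega)
  rw [Finset.sum_pair (by omega)] at h
  convert! h using 1
  have e1 : x + ((-⌊x⌋ : ℤ) : ℝ) = Int.fract x := by push_cast; linarith
  have e2 : x + ((-⌊x⌋ - 1 : ℤ) : ℝ) = Int.fract x - 1 := by push_cast; linarith
  rw [e1, e2, tent, tent, abs_of_nonneg hf0, abs_of_nonpos (by linarith),
    max_eq_right (by linarith), max_eq_right (by linarith)]
  ring

lemma hasSum_mul_of_nonneg {α β : Type*} {f : α → ℝ} {g : β → ℝ} {a b : ℝ} (hf : ∀ x, 0 ≤ f x)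
    (hg : ∀ x, 0 ≤ g x) (ha : HasSum f a) (hb : HasSum g b) :
    HasSum (fun x : α × β ↦ f x.1 * g x.2) (a * b) :=
  ha.mul hb (ha.summable.mul_of_nonneg hb.summable hf hg)

lemma hasSum_pi_prod {r : ℕ} (f : Fin r → ℤ → ℝ) (hf : ∀ i m, 0 ≤ f i m) (a : Fin r → ℝ)
    (h : ∀ i, HasSum (f i) (a i)) :
    HasSum (fun e : Fin r → ℤ ↦ ∏ i, f i (e i)) (∏ i, a i) := by
  induction r with
  | zero => simp
  | succ r ih =>
    have ih' := ih (fun i ↦ f i.succ) (fun i m ↦ hf _ _) (fun i ↦ a i.succ) (fun i ↦ h _)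
    have hm := hasSum_mul_of_nonneg (hf 0) (fun e ↦ Finset.prod_nonneg fun i _ ↦ hf _ _) (h 0) ih'
    let φ : ℤ × (Fin r → ℤ) ≃ (Fin (r + 1) → ℤ) := Fin.consEquiv (fun _ ↦ ℤ)
    rw [Fin.prod_univ_succ]
    rw [← φ.hasSum_iff]
    refine hm.congr_fun fun e ↦ ?_
    simp [φ, Fin.prod_univ_succ, Fin.consEquiv]

lemma abs_prod_sub_prod_le {ι : Type*} (s : Finset ι) (a b : ι → ℝ) (ha : ∀ i, |a i| ≤ 1)
    (hb : ∀ i, |b i| ≤ 1) : |∏ i ∈ s, a i - ∏ i ∈ s, b i| ≤ ∑ i ∈ s, |a i - b i| := by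
  classical
  induction s using Finset.induction_on with
  | empty => simp
  | insert i s hi ih =>
    rw [Finset.prod_insert hi, Finset.prod_insert hi, Finset.sum_insert hi]
    have h1 : |∏ j ∈ s, a j| ≤ 1 := by
      rw [Finset.abs_prod]; exact Finset.prod_le_one (fun _ _ ↦ abs_nonneg _) fun j _ ↦ ha j
    calc |a i * ∏ j ∈ s, a j - b i * ∏ j ∈ s, b j|
        = |(a i - b i) * ∏ j ∈ s, a j + b i * (∏ j ∈ s, a j - ∏ j ∈ s, b j)| := by ring_nf
      _ ≤ |a i - b i| * |∏ j ∈ s, a j| + |b i| * |∏ j ∈ s, a j - ∏ j ∈ s, b j| := by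
          rw [← abs_mul, ← abs_mul]; exact abs_add_le _ _
      _ ≤ |a i - b i| * 1 + 1 * ∑ j ∈ s, |a j - b j| := by
          gcongr; exact hb i
      _ = _ := by ring

variable (K : Type*) [Field K] [NumberField K]

open scoped Classical in
/-- Coordinates of an element of the logarithmic space in a basis of the unit lattice. -/
def coord : logSpace K ≃ₗ[ℝ] (Fin (rank K) → ℝ) :=
  ((basisUnitLattice K).ofZLatticeBasis ℝ (unitLattice K)).equivFun

/-- A weight on the mixed space, invariant under real scaling, with compact support modulo scaling,
whose translates under the units form a partition of unity. -/
def coneWeight (x : mixedSpace K) : ℝ :=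
  open scoped Classical in
  if mixedEmbedding.norm x = 0 then 0 else ∏ i, tent (coord K (logMap x) i)

variable {K}

lemma coneWeight_nonneg (x : mixedSpace K) : 0 ≤ coneWeight K x := by
  unfold coneWeight
  split_ifs
  · exact le_rfl
  · exact Finset.prod_nonneg fun _ _ ↦ tent_nonneg _

lemma coneWeight_le_one (x : mixedSpace K) : coneWeight K x ≤ 1 := by
  unfold coneWeight
  split_ifs
  · exact zero_le_one
  · exact Finset.prod_le_one (fun _ _ ↦ tent_nonneg _) fun _ _ ↦ tent_le_one _

lemma coord_logEmbedding (ζ : torsion K) (e : Fin (rank K) → ℤ) (i : Fin (rank K)) :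
    coord K (logEmbedding K (Additive.ofMul ((ζ : (𝓞 K)ˣ) * ∏ j, fundSystem K j ^ e j))) i
      = e i := by
  rw [ofMul_mul, map_add, ofMul_prod, map_sum]
  have h0 : logEmbedding K (Additive.ofMul (ζ : (𝓞 K)ˣ)) = 0 :=
    logEmbedding_eq_zero_iff.mpr ζ.2
  have hj (j : Fin (rank K)) : coord K (logEmbedding K (Additive.ofMul (fundSystem K j ^ e j)))
      = e j • Pi.single j 1 := by
    rw [ofMul_zpow, map_zsmul, logEmbedding_fundSystem, map_zsmul (coord K)]
    congr 1
    classical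
    have := ((basisUnitLattice K).ofZLatticeBasis ℝ (unitLattice K)).equivFun_self j
    rw [Module.Basis.ofZLatticeBasis_apply] at this
    rw [coord]
    ext l; rw [this]; simp [Pi.single_apply, eq_comm]
  rw [h0, zero_add, map_sum]
  simp_rw [hj]
  simp [Finset.sum_apply, Pi.single_apply]

lemma hasSum_coneWeight {x : mixedSpace K} (hx : mixedEmbedding.norm x ≠ 0) :
    HasSum (fun u : (𝓞 K)ˣ ↦ coneWeight K (u • x)) (torsionOrder K) := by
  let φ : torsion K × (Fin (rank K) → ℤ) ≃ (𝓞 K)ˣ :=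
    Equiv.ofBijective (fun q ↦ (q.1 : (𝓞 K)ˣ) * ∏ j, fundSystem K j ^ q.2 j)
      ⟨fun q q' h ↦ (exist_unique_eq_mul_prod K _).unique rfl h, fun u ↦ by
        obtain ⟨q, hq, -⟩ := exist_unique_eq_mul_prod K u
        exact ⟨q, hq.symm⟩⟩
  refine φ.hasSum_iff.mp ?_
  have hpi := hasSum_pi_prod (fun (i : Fin (rank K)) (m : ℤ) ↦ tent (coord K (logMap x) i + m))
    (fun _ _ ↦ tent_nonneg _) (fun _ ↦ 1) (fun i ↦ hasSum_tent _)
  have hfin : HasSum (fun _ : torsion K ↦ (1 : ℝ)) (torsionOrder K) := by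
    have := Fintype.ofFinite (torsion K)
    convert hasSum_fintype (fun _ : torsion K ↦ (1 : ℝ)) using 1
    simp [torsionOrder, Nat.card_eq_fintype_card]
  have := hasSum_mul_of_nonneg (fun _ ↦ zero_le_one)
      (fun e ↦ Finset.prod_nonneg fun i _ ↦ tent_nonneg _) hfin hpi
  convert! this using 2
  · rename_i q
    rw [Function.comp_apply, coneWeight, if_neg (by rwa [norm_unit_smul]), one_mul]
    refine Finset.prod_congr rfl fun i _ ↦ ?_
    rw [logMap_unit_smul _ hx, map_add, Pi.add_apply, add_comm]
    congr 2
    exact coord_logEmbedding q.1 q.2 i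
  · simp

end ConeWeight

end

noncomputable section

namespace ConeWeight

open NumberField NumberField.InfinitePlace NumberField.Units NumberField.Units.dirichletUnitTheorem NumberField.mixedEmbedding
open scoped Classical

variable {K : Type*} [Field K] [NumberField K]

lemma coneWeight_ne_zero {x : mixedSpace K} (h : coneWeight K x ≠ 0) :
    mixedEmbedding.norm x ≠ 0 ∧ ∀ i, |coord K (logMap x) i| < 1 := by
  unfold coneWeight at h
  split_ifs at h with h0
  · exact absurd rfl h
  · exact ⟨h0, fun i ↦ abs_lt_one_of_tent_ne_zero (Finset.prod_ne_zero_iff.mp h i (Finset.mem_univ i))⟩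

lemma log_norm_eq {x : mixedSpace K} (hx : mixedEmbedding.norm x ≠ 0) :
    Real.log (mixedEmbedding.norm x) = ∑ w, mult w * Real.log (normAtPlace w x) := by
  rw [mixedEmbedding.norm_apply, Real.log_prod
    fun w _ ↦ pow_ne_zero _ (mixedEmbedding.norm_ne_zero_iff.mp hx w)]
  simp

lemma normAtPlace_le_norm (w : InfinitePlace K) (x : mixedSpace K) : normAtPlace w x ≤ ‖x‖ := by
  rw [norm_eq_sup'_normAtPlace]
  exact Finset.le_sup' (fun w ↦ normAtPlace w x) (Finset.mem_univ w)

variable (K) in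
lemma exists_abs_log_le : ∃ B : ℝ, 0 ≤ B ∧ ∀ x : mixedSpace K, coneWeight K x ≠ 0 → ∀ w,
    |Real.log (normAtPlace w x) - Real.log (mixedEmbedding.norm x) *
      (Module.finrank ℚ K : ℝ)⁻¹| ≤ B := by
  classical
  let T : (Fin (rank K) → ℝ) →L[ℝ] logSpace K := LinearMap.toContinuousLinearMap (coord K).symm
  set n : ℝ := (Module.finrank ℚ K : ℝ) with hn
  have hn0 : n ≠ 0 := Nat.cast_ne_zero.mpr Module.finrank_pos.ne'
  let c : ℝ := Fintype.card (InfinitePlace K)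
  have hc : (0 : ℝ) ≤ c := Nat.cast_nonneg _
  refine ⟨‖T‖ + c * ‖T‖, by positivity, fun x hx w ↦ ?_⟩
  obtain ⟨h0, h1⟩ := coneWeight_ne_zero hx
  set ℓ : InfinitePlace K → ℝ := fun w ↦ Real.log (normAtPlace w x) -
    Real.log (mixedEmbedding.norm x) * n⁻¹ with hℓ
  have hT : ‖logMap x‖ ≤ ‖T‖ := by
    have e : logMap x = T (coord K (logMap x)) := ((coord K).symm_apply_apply _).symm
    rw [e]
    refine (T.le_opNorm _).trans (mul_le_of_le_one_right (norm_nonneg _) ?_)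
    exact (pi_norm_le_iff_of_nonneg zero_le_one).mpr fun i ↦ (h1 i).le
  have hw (w : InfinitePlace K) (hw0 : w ≠ w₀) : mult w * |ℓ w| ≤ ‖T‖ := by
    have := (norm_le_pi_norm (logMap x) ⟨w, hw0⟩).trans hT
    rw [logMap_apply, Real.norm_eq_abs, abs_mul, Nat.abs_cast] at this
    exact this
  have hw1 (w : InfinitePlace K) (hw0 : w ≠ w₀) : |ℓ w| ≤ ‖T‖ :=
    (le_mul_of_one_le_left (abs_nonneg _) one_le_mult).trans (hw w hw0)
  change |ℓ w| ≤ _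
  by_cases hw0 : w = w₀
  · have hsum : ∑ w, mult w * ℓ w = 0 := by
      simp only [hℓ, mul_sub, Finset.sum_sub_distrib]
      rw [← log_norm_eq h0, ← Finset.sum_mul, ← Nat.cast_sum, sum_mult_eq, ← hn]
      field_simp
      ring
    rw [← Finset.add_sum_erase _ _ (Finset.mem_univ w₀)] at hsum
    subst hw0
    have : |mult (w₀ : InfinitePlace K) * ℓ w₀| ≤ c * ‖T‖ := by
      rw [eq_neg_of_add_eq_zero_left hsum, abs_neg]
      refine (Finset.abs_sum_le_sum_abs _ _).trans ?_
      refine (Finset.sum_le_card_nsmul _ _ ‖T‖ fun w hw' ↦ ?_).trans ?_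
      · rw [abs_mul, Nat.abs_cast]
        exact hw w (Finset.ne_of_mem_erase hw')
      · rw [nsmul_eq_mul]
        gcongr
        exact Nat.cast_le.mpr (Finset.card_le_univ _)
    rw [abs_mul, Nat.abs_cast] at this
    have := (le_mul_of_one_le_left (abs_nonneg (ℓ w₀)) one_le_mult).trans this
    linarith [norm_nonneg T]
  · have := hw1 w hw0
    have : 0 ≤ c * ‖T‖ := by positivity
    linarith

variable (K) in
lemma exists_mul_norm_le_normAtPlace : ∃ c : ℝ, 0 < c ∧ c ≤ 1 ∧
    ∀ x : mixedSpace K, coneWeight K x ≠ 0 → ∀ w, c * ‖x‖ ≤ normAtPlace w x := by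
  obtain ⟨B, hB0, hB⟩ := exists_abs_log_le K
  refine ⟨Real.exp (-(2 * B)), Real.exp_pos _, Real.exp_le_one_iff.mpr (by linarith),
    fun x hx w ↦ ?_⟩
  obtain ⟨h0, -⟩ := coneWeight_ne_zero hx
  have hpos (w) : 0 < normAtPlace w x :=
    (normAtPlace_nonneg w x).lt_of_ne' (mixedEmbedding.norm_ne_zero_iff.mp h0 w)
  rw [norm_eq_sup'_normAtPlace]
  obtain ⟨w', -, hw'⟩ := Finset.exists_mem_eq_sup' Finset.univ_nonempty (fun w ↦ normAtPlace w x)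
  rw [hw', ← Real.exp_log (hpos w), ← Real.exp_log (hpos w'), ← Real.exp_add]
  have h1 := abs_le.mp (hB x hx w)
  have h2 := abs_le.mp (hB x hx w')
  exact Real.exp_le_exp.mpr (by linarith)

lemma pow_le_norm {x : mixedSpace K} {a : ℝ} (ha : 0 ≤ a) (h : ∀ w, a ≤ normAtPlace w x) :
    a ^ Module.finrank ℚ K ≤ mixedEmbedding.norm x := by
  rw [← sum_mult_eq, ← Finset.prod_pow_eq_pow_sum, mixedEmbedding.norm_apply]
  exact Finset.prod_le_prod (fun _ _ ↦ pow_nonneg ha _) fun w _ ↦ pow_le_pow_left₀ ha (h w) _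

lemma abs_log_sub_log_le {a b m : ℝ} (hm : 0 < m) (ha : m ≤ a) (hb : m ≤ b) :
    |Real.log a - Real.log b| ≤ |a - b| / m := by
  have key (a b : ℝ) (ha : m ≤ a) (hb : m ≤ b) : Real.log a - Real.log b ≤ |a - b| / m := by
    have ha0 := hm.trans_le ha
    have hb0 := hm.trans_le hb
    rw [← Real.log_div ha0.ne' hb0.ne']
    refine (Real.log_le_sub_one_of_pos (div_pos ha0 hb0)).trans ?_
    rw [div_sub_one hb0.ne']
    exact (div_le_div_of_nonneg_right (le_abs_self _) hb0.le).trans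
      (div_le_div_of_nonneg_left (abs_nonneg _) hm hb)
  refine abs_le'.mpr ⟨key a b ha hb, ?_⟩
  rw [neg_sub, abs_sub_comm]
  exact key b a hb ha

lemma abs_normAtPlace_sub_le (w : InfinitePlace K) (x y : mixedSpace K) :
    |normAtPlace w x - normAtPlace w y| ≤ ‖x - y‖ := by
  have key (x y : mixedSpace K) : normAtPlace w x - normAtPlace w y ≤ ‖x - y‖ := by
    have := normAtPlace_add_le w (x - y) y
    rw [sub_add_cancel] at this
    linarith [normAtPlace_le_norm w (x - y)]
  refine abs_le'.mpr ⟨key x y, ?_⟩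
  rw [neg_sub, norm_sub_rev]
  exact key y x

variable (K) in
lemma exists_abs_coneWeight_sub_le : ∃ A : ℝ, 0 ≤ A ∧ ∀ (x y : mixedSpace K) (ε : ℝ),
    mixedEmbedding.norm x ≠ 0 → mixedEmbedding.norm y ≠ 0 →
    (∀ w, |Real.log (normAtPlace w x) - Real.log (normAtPlace w y)| ≤ ε) →
    |Real.log (mixedEmbedding.norm x) - Real.log (mixedEmbedding.norm y)| ≤
      Module.finrank ℚ K * ε ∧ |coneWeight K x - coneWeight K y| ≤ A * ε := by
  classical
  let T : logSpace K →L[ℝ] (Fin (rank K) → ℝ) :=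
    LinearMap.toContinuousLinearMap (coord K : logSpace K →ₗ[ℝ] (Fin (rank K) → ℝ))
  have hn0 : (0 : ℝ) < Module.finrank ℚ K := Nat.cast_pos.mpr Module.finrank_pos
  refine ⟨rank K * (‖T‖ * 4), by positivity, fun x y ε hx hy h ↦ ?_⟩
  have hε : 0 ≤ ε := (abs_nonneg _).trans (h (Classical.arbitrary _))
  have h1 : |Real.log (mixedEmbedding.norm x) - Real.log (mixedEmbedding.norm y)| ≤
      Module.finrank ℚ K * ε := by
    rw [log_norm_eq hx, log_norm_eq hy, ← Finset.sum_sub_distrib, ← sum_mult_eq, Nat.cast_sum,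
      Finset.sum_mul]
    refine (Finset.abs_sum_le_sum_abs _ _).trans (Finset.sum_le_sum fun w _ ↦ ?_)
    rw [← mul_sub, abs_mul, Nat.abs_cast]
    gcongr
    exact h w
  refine ⟨h1, ?_⟩
  rw [coneWeight, coneWeight, if_neg hx, if_neg hy]
  refine (abs_prod_sub_prod_le _ _ _ (fun i ↦ ?_) fun i ↦ ?_).trans ?_
  · rw [abs_of_nonneg (tent_nonneg _)]; exact tent_le_one _
  · rw [abs_of_nonneg (tent_nonneg _)]; exact tent_le_one _
  have hlog : ‖logMap x - logMap y‖ ≤ 4 * ε := by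
    refine (pi_norm_le_iff_of_nonneg (by positivity)).mpr fun w ↦ ?_
    rw [Pi.sub_apply, logMap_apply, logMap_apply, ← mul_sub, Real.norm_eq_abs, abs_mul,
      Nat.abs_cast]
    have hm : (mult w.1 : ℝ) ≤ 2 := by
      rw [mult]; split_ifs <;> norm_num
    have h2 : |(Real.log (mixedEmbedding.norm x) - Real.log (mixedEmbedding.norm y)) *
        (Module.finrank ℚ K : ℝ)⁻¹| ≤ ε := by
      rw [abs_mul, abs_inv, Nat.abs_cast, ← div_eq_mul_inv, div_le_iff₀ hn0, mul_comm]
      exact h1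
    calc _ ≤ 2 * (ε + ε) := by
          refine mul_le_mul hm ?_ (abs_nonneg _) zero_le_two
          refine le_trans (le_of_eq ?_) ((abs_sub _ _).trans (add_le_add (h w.1) h2))
          congr 1; ring
      _ = 4 * ε := by ring
  calc _ ≤ ∑ _i : Fin (rank K), ‖T‖ * (4 * ε) := by
        refine Finset.sum_le_sum fun i _ ↦ (abs_tent_sub_tent_le _ _).trans ?_
        rw [← Pi.sub_apply, ← map_sub, ← Real.norm_eq_abs]
        refine (norm_le_pi_norm _ i).trans ((T.le_opNorm _).trans ?_)
        gcongr
    _ = _ := by simp; ring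

variable {K : Type*} [Field K] [NumberField K]

variable (K) in
/-- The product of `coneWeight` with a power of the norm. -/
def weightedNorm (s : ℝ) (x : mixedSpace K) : ℝ := coneWeight K x * mixedEmbedding.norm x ^ (-s)

lemma weightedNorm_nonneg (s : ℝ) (x : mixedSpace K) : 0 ≤ weightedNorm K s x :=
  mul_nonneg (coneWeight_nonneg x) (Real.rpow_nonneg (mixedEmbedding.norm_nonneg x) _)

lemma weightedNorm_eq_zero {s : ℝ} {x : mixedSpace K} (h : coneWeight K x = 0) :
    weightedNorm K s x = 0 := by rw [weightedNorm, h, zero_mul]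

lemma weightedNorm_le_one {s : ℝ} (hs : 0 ≤ s) {x : mixedSpace K}
    (hx : 1 ≤ mixedEmbedding.norm x) : weightedNorm K s x ≤ 1 :=
  mul_le_one₀ (coneWeight_le_one x) (Real.rpow_nonneg (mixedEmbedding.norm_nonneg x) _)
    (Real.rpow_le_one_of_one_le_of_nonpos hx (by linarith))

variable (K) in
lemma exists_weightedNorm_le : ∃ C : ℝ, 0 ≤ C ∧ ∀ s : ℝ, 1 ≤ s → s ≤ 2 → ∀ x : mixedSpace K,
    x ≠ 0 → weightedNorm K s x ≤ C * ‖x‖ ^ (-(Module.finrank ℚ K * s)) := by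
  obtain ⟨c, hc, hc1, h⟩ := exists_mul_norm_le_normAtPlace K
  refine ⟨c ^ (-(Module.finrank ℚ K * 2 : ℝ)), by positivity, fun s hs hs2 x hx ↦ ?_⟩
  by_cases h0 : coneWeight K x = 0
  · rw [weightedNorm_eq_zero h0]; positivity
  have hx' : 0 < ‖x‖ := norm_pos_iff.mpr hx
  have hN := pow_le_norm (by positivity) (h x h0)
  have hn : (0 : ℝ) ≤ Module.finrank ℚ K := Nat.cast_nonneg _
  calc weightedNorm K s x ≤ 1 * mixedEmbedding.norm x ^ (-s) := by
        unfold weightedNorm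
        gcongr
        · exact Real.rpow_nonneg (mixedEmbedding.norm_nonneg x) _
        · exact coneWeight_le_one x
    _ ≤ ((c * ‖x‖) ^ Module.finrank ℚ K) ^ (-s) := by
        rw [one_mul]
        exact Real.rpow_le_rpow_of_nonpos (by positivity) hN (by linarith)
    _ = c ^ (-(Module.finrank ℚ K * s : ℝ)) * ‖x‖ ^ (-(Module.finrank ℚ K * s)) := by
        rw [← Real.rpow_natCast, ← Real.rpow_mul (by positivity), mul_neg,
          Real.mul_rpow hc.le hx'.le]
    _ ≤ _ := by
        refine mul_le_mul_of_nonneg_right ?_ (by positivity)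
        exact Real.rpow_le_rpow_of_exponent_ge hc hc1 (by nlinarith)

variable (K) in
lemma exists_abs_weightedNorm_sub_le_aux : ∃ C R : ℝ, 0 ≤ C ∧ 2 ≤ R ∧ ∀ s : ℝ, 1 ≤ s → s ≤ 2 →
    ∀ x y : mixedSpace K, coneWeight K x ≠ 0 → R * ‖y - x‖ ≤ ‖x‖ → R ≤ ‖x‖ →
    |weightedNorm K s y - weightedNorm K s x| ≤
      C * ‖y - x‖ * (‖x‖ ^ (Module.finrank ℚ K + 1))⁻¹ := by
  obtain ⟨c, hc, hc1, h⟩ := exists_mul_norm_le_normAtPlace K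
  obtain ⟨A, hA, hAx⟩ := exists_abs_coneWeight_sub_le K
  set n := Module.finrank ℚ K with hn
  have hn0 : 0 < n := Module.finrank_pos
  have hn1 : (1 : ℝ) ≤ n := Nat.one_le_cast.mpr hn0
  refine ⟨(3 * (A * (2 / c)) + 4 * n * (2 / c)) * (c ^ n)⁻¹, (4 * n) / c, by positivity, ?_,
    fun s hs1 hs2 x y hx hyx hRx ↦ ?_⟩
  · rw [le_div_iff₀ hc]; nlinarith
  have hx0 : 0 < ‖x‖ := lt_of_lt_of_le (by positivity) hRx
  obtain ⟨hNx, -⟩ := coneWeight_ne_zero hx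
  have hcx := h x hx
  set ρ := ‖y - x‖ with hρ
  have hρ0 : 0 ≤ ρ := norm_nonneg _
  have hRρ : 4 * n * ρ ≤ c * ‖x‖ := by
    rw [div_mul_eq_mul_div, div_le_iff₀ hc] at hyx; linarith
  have hRx' : 4 * n ≤ c * ‖x‖ := by
    rw [div_le_iff₀ hc] at hRx; linarith
  have hρx : ρ ≤ c * ‖x‖ / 2 := by nlinarith
  have hcy (w) : c * ‖x‖ / 2 ≤ normAtPlace w y := by
    have h1 := abs_le.mp (abs_normAtPlace_sub_le w y x)
    have := hcx w
    linarith
  have hNy : mixedEmbedding.norm y ≠ 0 :=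
    mixedEmbedding.norm_ne_zero_iff.mpr fun w ↦ (lt_of_lt_of_le (by positivity) (hcy w)).ne'
  set ε := 2 / c * (ρ / ‖x‖) with hε
  have hlog (w) : |Real.log (normAtPlace w y) - Real.log (normAtPlace w x)| ≤ ε := by
    refine (abs_log_sub_log_le (m := c * ‖x‖ / 2) (by positivity) (hcy w)
      (by have := hcx w; nlinarith)).trans ?_
    calc _ ≤ ρ / (c * ‖x‖ / 2) := by gcongr; exact abs_normAtPlace_sub_le w y x
      _ = ε := by rw [hε]; field_simp
  obtain ⟨h1, h2⟩ := hAx y x ε hNy hNx hlog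
  have hε0 : 0 ≤ ε := by positivity
  set Lx := Real.log (mixedEmbedding.norm x)
  set Ly := Real.log (mixedEmbedding.norm y)
  have hNx0 : 0 < mixedEmbedding.norm x := (mixedEmbedding.norm_nonneg x).lt_of_ne' hNx
  have hNy0 : 0 < mixedEmbedding.norm y := (mixedEmbedding.norm_nonneg y).lt_of_ne' hNy
  have hyexp : mixedEmbedding.norm y ^ (-s) =
      mixedEmbedding.norm x ^ (-s) * Real.exp (-s * (Ly - Lx)) := by
    rw [Real.rpow_def_of_pos hNx0, Real.rpow_def_of_pos hNy0, ← Real.exp_add]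
    congr 1; ring
  have hnε : n * ε ≤ 1 / 2 := by
    rw [hε, show (n : ℝ) * (2 / c * (ρ / ‖x‖)) = (4 * n * ρ) / (c * ‖x‖) / 2 by field_simp; ring]
    have : 4 * n * ρ / (c * ‖x‖) ≤ 1 := div_le_one_of_le₀ hRρ (by positivity)
    linarith
  have hsarg : |-s * (Ly - Lx)| ≤ 2 * (n * ε) := by
    rw [abs_mul, abs_neg, abs_of_nonneg (by linarith)]
    exact mul_le_mul hs2 h1 (abs_nonneg _) (by norm_num)
  have hexp := Real.abs_exp_sub_one_le (hsarg.trans (by linarith))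
  have hexp2 : |Real.exp (-s * (Ly - Lx)) - 1| ≤ 4 * n * ε := by linarith
  have hNs : mixedEmbedding.norm x ^ (-s) ≤ (c ^ n)⁻¹ * (‖x‖ ^ n)⁻¹ := by
    have hN := pow_le_norm (by positivity) hcx
    have hN1 : 1 ≤ mixedEmbedding.norm x :=
      (one_le_pow₀ (by linarith)).trans hN
    calc _ ≤ mixedEmbedding.norm x ^ (-1 : ℝ) :=
          Real.rpow_le_rpow_of_exponent_le hN1 (by linarith)
      _ = (mixedEmbedding.norm x)⁻¹ := Real.rpow_neg_one _
      _ ≤ ((c * ‖x‖) ^ n)⁻¹ := inv_anti₀ (by positivity) hN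
      _ = _ := by rw [mul_pow, mul_inv]
  have hNs0 : 0 ≤ mixedEmbedding.norm x ^ (-s) := by positivity
  have hexp3 : Real.exp (-s * (Ly - Lx)) ≤ 3 := by
    have := (abs_le.mp hexp2).2
    linarith
  have hwx0 := coneWeight_nonneg x
  have hwx1 := coneWeight_le_one x
  rw [weightedNorm, weightedNorm, hyexp]
  generalize Real.exp (-s * (Ly - Lx)) = E at *
  generalize mixedEmbedding.norm x ^ (-s) = M at *
  generalize coneWeight K x = wx at *
  generalize coneWeight K y = wy at *
  generalize ‖x‖ = a at *
  clear_value ρ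
  have hE0 : |E| ≤ 3 := abs_le.mpr ⟨by linarith [(abs_le.mp hexp2).1], hexp3⟩
  have hb : |(wy - wx) * E + wx * (E - 1)| ≤ A * ε * 3 + 1 * (4 * n * ε) := by
    refine (abs_add_le _ _).trans ?_
    rw [abs_mul, abs_mul, abs_of_nonneg hwx0]
    exact add_le_add (mul_le_mul h2 hE0 (abs_nonneg _) (by positivity))
      (mul_le_mul hwx1 hexp2 (abs_nonneg _) zero_le_one)
  calc |wy * (M * E) - wx * M| = M * |(wy - wx) * E + wx * (E - 1)| := by
        rw [← abs_of_nonneg hNs0, ← abs_mul, abs_of_nonneg hNs0]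
        congr 1; ring
    _ ≤ (c ^ n)⁻¹ * (a ^ n)⁻¹ * (A * ε * 3 + 1 * (4 * n * ε)) :=
        mul_le_mul hNs hb (abs_nonneg _) (by positivity)
    _ = _ := by rw [hε, pow_succ]; field_simp

variable (K) in
lemma exists_abs_weightedNorm_sub_le : ∃ C R : ℝ, 0 ≤ C ∧ 2 ≤ R ∧ ∀ s : ℝ, 1 ≤ s → s ≤ 2 →
    ∀ x y : mixedSpace K, R * (1 + ‖y - x‖) ≤ ‖x‖ →
    |weightedNorm K s y - weightedNorm K s x| ≤
      C * ‖y - x‖ * (‖x‖ ^ (Module.finrank ℚ K + 1))⁻¹ := by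
  obtain ⟨C, R, hC, hR, h⟩ := exists_abs_weightedNorm_sub_le_aux K
  refine ⟨C * 2 ^ (Module.finrank ℚ K + 1), 2 * R, by positivity, by linarith,
    fun s hs1 hs2 x y hxy ↦ ?_⟩
  have hxy' := h s hs1 hs2 x y
  have hyx' := h s hs1 hs2 y x
  rw [norm_sub_rev x y, abs_sub_comm] at hyx'
  have htri : ‖x‖ ≤ ‖y‖ + ‖y - x‖ := norm_le_insert y x
  have hρ0 : 0 ≤ ‖y - x‖ := norm_nonneg _
  have hx := weightedNorm_eq_zero (s := s) (x := x)
  have hy := weightedNorm_eq_zero (s := s) (x := y)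
  generalize ‖y - x‖ = ρ at *
  generalize ‖x‖ = a at *
  generalize ‖y‖ = b at *
  generalize Module.finrank ℚ K + 1 = m at *
  have ha : 0 < a := lt_of_lt_of_le (by positivity) hxy
  have hρR : 0 ≤ R * ρ := by positivity
  by_cases hx0 : coneWeight K x = 0
  · by_cases hy0 : coneWeight K y = 0
    · rw [hx hx0, hy hy0, sub_self, abs_zero]
      positivity
    · have hb : a / 2 ≤ b := by nlinarith
      refine (hyx' hy0 (by nlinarith) (by nlinarith)).trans ?_
      calc C * ρ * (b ^ m)⁻¹ ≤ C * ρ * ((a / 2) ^ m)⁻¹ := by gcongr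
        _ = _ := by rw [div_pow]; field_simp
  · refine (hxy' hx0 (by nlinarith) (by nlinarith)).trans ?_
    gcongr
    exact le_mul_of_one_le_right hC (one_le_pow₀ one_le_two)

variable {K : Type*} [Field K] [NumberField K]

variable (K) in
/-- The weighted norm on algebraic integers. -/
def intWeight (s : ℝ) (y : 𝓞 K) : ℝ := weightedNorm K s (mixedEmbedding K (y : K))

lemma intWeight_nonneg (s : ℝ) (y : 𝓞 K) : 0 ≤ intWeight K s y := weightedNorm_nonneg s _

lemma intWeight_zero (s : ℝ) : intWeight K s 0 = 0 := by
  unfold intWeight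
  refine weightedNorm_eq_zero ?_
  rw [coneWeight, if_pos]
  simp

lemma norm_mixedEmbedding_eq_absNorm (y : 𝓞 K) :
    mixedEmbedding.norm (mixedEmbedding K (y : K)) = Ideal.absNorm (Ideal.span {y}) := by
  rw [norm_eq_norm, ← Algebra.coe_norm_int, Ideal.absNorm_span_singleton, Nat.cast_natAbs]
  norm_cast

lemma one_le_norm_mixedEmbedding {y : 𝓞 K} (hy : y ≠ 0) :
    1 ≤ mixedEmbedding.norm (mixedEmbedding K (y : K)) := by
  rw [norm_mixedEmbedding_eq_absNorm, Nat.one_le_cast, Nat.one_le_iff_ne_zero]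
  simpa [Ideal.absNorm_eq_zero_iff] using hy

lemma intWeight_le_one {s : ℝ} (hs : 0 ≤ s) (y : 𝓞 K) : intWeight K s y ≤ 1 := by
  by_cases hy : y = 0
  · rw [hy, intWeight_zero]; exact zero_le_one
  · exact weightedNorm_le_one hs (one_le_norm_mixedEmbedding hy)

lemma _root_.ZLattice.summable_norm_rpow_comp {E ι : Type*} [NormedAddCommGroup E]
    [NormedSpace ℝ E] [FiniteDimensional ℝ E] (L : Submodule ℤ E) [DiscreteTopology L]
    (φ : ι → E) (hφ : Function.Injective φ) (h : ∀ i, φ i ∈ L) {r : ℝ}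
    (hr : r < -Module.finrank ℤ L) : Summable fun y ↦ ‖φ y‖ ^ r :=
  (ZLattice.summable_norm_rpow L r hr).comp_injective (i := fun i ↦ (⟨φ i, h i⟩ : L))
    fun _ _ h ↦ hφ (congrArg Subtype.val h)

variable (K) in
lemma finrank_integerLattice :
    Module.finrank ℤ (mixedEmbedding.integerLattice K) = Module.finrank ℚ K := by
  rw [ZLattice.rank ℝ, mixedEmbedding.finrank]

lemma summable_norm_mixedEmbedding_rpow {r : ℝ} (hr : r < -(Module.finrank ℚ K : ℝ)) :
    Summable fun y : 𝓞 K ↦ ‖mixedEmbedding K (y : K)‖ ^ r := by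
  rw [← finrank_integerLattice K] at hr
  exact ZLattice.summable_norm_rpow_comp (mixedEmbedding.integerLattice K) _
    (fun _ _ hab ↦ RingOfIntegers.ext (mixedEmbedding_injective K hab)) (fun y ↦ ⟨y, rfl⟩) hr

lemma summable_intWeight {s : ℝ} (hs1 : 1 < s) (hs2 : s ≤ 2) : Summable (intWeight K s) := by
  obtain ⟨C, hC, h⟩ := exists_weightedNorm_le K
  have hn : (0 : ℝ) < Module.finrank ℚ K := Nat.cast_pos.mpr Module.finrank_pos
  refine Summable.of_nonneg_of_le (intWeight_nonneg s) (fun y ↦ ?_)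
    ((summable_norm_mixedEmbedding_rpow (K := K) (r := -(Module.finrank ℚ K * s)) ?_).mul_left C)
  · by_cases hy : y = 0
    · rw [hy, intWeight_zero]; positivity
    · exact h s hs1.le hs2 _ (by simpa using hy)
  · nlinarith

lemma exists_tsum_translate_sub_le (n : Ideal (𝓞 K)) (x : 𝓞 K) :
    ∃ C : ℝ, ∀ s : ℝ, 1 < s → s ≤ 2 →
      |∑' z : n, intWeight K s (z + x) - ∑' z : n, intWeight K s z| ≤ C := by
  obtain ⟨C, R, hC, hR, h⟩ := exists_abs_weightedNorm_sub_le K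
  set d := Module.finrank ℚ K
  set ρ := ‖mixedEmbedding K (x : K)‖ with hρ
  have hρ0 : 0 ≤ ρ := norm_nonneg _
  let b : 𝓞 K → ℝ := fun z ↦ (C * ρ + 2 * (R * (1 + ρ)) ^ (d + 1)) *
    ‖mixedEmbedding K (z : K)‖ ^ (-(d + 1 : ℝ)) + if z = 0 then 2 else 0
  have hb : Summable b := by
    refine ((summable_norm_mixedEmbedding_rpow (by linarith)).mul_left _).add ?_
    exact summable_of_ne_finset_zero (s := {0}) fun z hz ↦ if_neg (by simpa using hz)
  have hbn : Summable fun z : n ↦ b z := hb.comp_injective Subtype.val_injective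
  refine ⟨∑' z : n, b z, fun s hs1 hs2 ↦ ?_⟩
  have hsum := summable_intWeight (K := K) hs1 hs2
  have hs : Summable fun z : n ↦ intWeight K s z := hsum.comp_injective Subtype.val_injective
  have hsx : Summable fun z : n ↦ intWeight K s (z + x) :=
    hsum.comp_injective (i := fun z : n ↦ (z : 𝓞 K) + x)
      ((add_left_injective x).comp Subtype.val_injective)
  have hle (z : 𝓞 K) : ‖intWeight K s (z + x) - intWeight K s z‖ ≤ b z := by
    have h0 := intWeight_nonneg s z
    have h0' := intWeight_nonneg s (z + x)
    have h1 := intWeight_le_one (by linarith : 0 ≤ s) z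
    have h1' := intWeight_le_one (by linarith : 0 ≤ s) (z + x)
    have htriv : ‖intWeight K s (z + x) - intWeight K s z‖ ≤ 2 := by
      rw [Real.norm_eq_abs, abs_le]; constructor <;> linarith
    by_cases hz : z = 0
    · simp only [b, if_pos hz]
      exact htriv.trans (le_add_of_nonneg_left (by positivity))
    · simp only [b, if_neg hz, add_zero]
      have hz0 : 0 < ‖mixedEmbedding K (z : K)‖ := norm_pos_iff.mpr (by simpa using hz)
      have key := h s hs1.le hs2 (mixedEmbedding K (z : K)) (mixedEmbedding K ((z + x : 𝓞 K) : K))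
      have hsub : mixedEmbedding K ((z + x : 𝓞 K) : K) - mixedEmbedding K (z : K) =
          mixedEmbedding K (x : K) := by simp
      rw [hsub, ← hρ] at key
      change _ → ‖intWeight K s (z + x) - intWeight K s z‖ ≤ _ at key
      generalize ‖mixedEmbedding K (z : K)‖ = a at *
      have ha : a ^ (-(d + 1 : ℝ)) = (a ^ (d + 1))⁻¹ := by
        rw [Real.rpow_neg hz0.le, ← Real.rpow_natCast]; norm_cast
      rw [ha, add_mul]
      by_cases hbig : R * (1 + ρ) ≤ a
      · exact (key hbig).trans (le_add_of_nonneg_right (by positivity))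
      · refine (htriv.trans ?_).trans (le_add_of_nonneg_left (by positivity))
        rw [mul_assoc, ← div_eq_mul_inv, ← div_pow]
        refine le_mul_of_one_le_right zero_le_two (one_le_pow₀ ?_)
        rw [one_le_div hz0]
        exact (not_le.mp hbig).le
  rw [← hsx.tsum_sub hs, ← Real.norm_eq_abs]
  exact tsum_of_norm_bounded hbn.hasSum fun z ↦ hle z

variable {K : Type*} [Field K] [NumberField K]

lemma tsum_eq_sum_quotient {R : Type*} [CommRing R] (n : Ideal R) [Fintype (R ⧸ n)] {g : R → ℝ}
    (hg : Summable g) :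
    ∑' y, g y = ∑ q : R ⧸ n, ∑' z : n, g (z + Quotient.out q) := by
  let φ : (R ⧸ n) × n ≃ R := Equiv.ofBijective (fun q ↦ (q.2 : R) + Quotient.out q.1) (by
    have hmk (q : R ⧸ n) (z : n) : Ideal.Quotient.mk n ((z : R) + Quotient.out q) = q := by
      rw [map_add, Ideal.Quotient.eq_zero_iff_mem.mpr z.2, zero_add]
      exact Quotient.out_eq q
    constructor
    · rintro ⟨q, z⟩ ⟨q', z'⟩ h
      have hq : q = q' := by rw [← hmk q z, ← hmk q' z']; exact congrArg _ h
      subst hq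
      simpa using h
    · intro y
      refine ⟨⟨Ideal.Quotient.mk n y, ⟨y - Quotient.out (Ideal.Quotient.mk n y), ?_⟩⟩, by simp⟩
      rw [← Ideal.Quotient.eq]
      exact (Quotient.out_eq (Ideal.Quotient.mk n y)).symm)
  have hs : Summable fun c ↦ g (φ c) := φ.summable_iff.mpr hg
  rw [← φ.tsum_eq, hs.tsum_prod, tsum_fintype]
  rfl

lemma exists_tsum_coset_sub_le {n : Ideal (𝓞 K)} (hn : n ≠ ⊥) (x : 𝓞 K) :
    ∃ C : ℝ, ∀ s : ℝ, 1 < s → s ≤ 2 →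
      |∑' z : n, intWeight K s (z + x) - (Ideal.absNorm n : ℝ)⁻¹ * ∑' y, intWeight K s y| ≤ C := by
  have : Finite (𝓞 K ⧸ n) := Ideal.finiteQuotientOfFreeOfNeBot n hn
  have : Fintype (𝓞 K ⧸ n) := Fintype.ofFinite _
  choose C hC using exists_tsum_translate_sub_le (K := K) n
  refine ⟨∑ q : 𝓞 K ⧸ n, (C x + C (Quotient.out q)), fun s hs1 hs2 ↦ ?_⟩
  rw [tsum_eq_sum_quotient n (summable_intWeight hs1 hs2)]
  have hN : (Ideal.absNorm n : ℝ) = Fintype.card (𝓞 K ⧸ n) := by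
    rw [Ideal.absNorm_apply, Submodule.cardQuot_apply, Nat.card_eq_fintype_card]
  have hN1 : (1 : ℝ) ≤ Ideal.absNorm n := by
    rw [hN, Nat.one_le_cast]; exact Fintype.card_pos
  set N : ℝ := ((Ideal.absNorm n : ℕ) : ℝ)
  set S := ∑' z : n, intWeight K s (z + x)
  set T : 𝓞 K ⧸ n → ℝ := fun q ↦ ∑' z : n, intWeight K s (z + Quotient.out q)
  have e : S - N⁻¹ * ∑ q, T q = N⁻¹ * ∑ q, (S - T q) := by
    rw [Finset.sum_sub_distrib, Finset.sum_const, Finset.card_univ, nsmul_eq_mul, ← hN]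
    field_simp
  rw [e, abs_mul, abs_of_nonneg (by positivity)]
  refine (mul_le_of_le_one_left (abs_nonneg _) (inv_le_one_of_one_le₀ hN1)).trans
    ((Finset.abs_sum_le_sum_abs _ _).trans (Finset.sum_le_sum fun q _ ↦ ?_))
  have h1 := hC x s hs1 hs2
  have h2 := hC (Quotient.out q) s hs1 hs2
  rw [abs_sub_comm] at h2
  exact (abs_sub_le _ _ _).trans (add_le_add h1 h2)

lemma exists_tsum_periodic_sub_le {m : Ideal (𝓞 K)} (hm : m ≠ ⊥) (F : 𝓞 K ⧸ m → ℂ) :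
    ∃ c : ℂ, ∀ b : Ideal (𝓞 K), b ≠ ⊥ → IsCoprime b m → ∃ C : ℝ, ∀ s : ℝ, 1 < s → s ≤ 2 →
      ‖∑' y : 𝓞 K, (if y ∈ b then F (Ideal.Quotient.mk m y) else 0) * intWeight K s y -
        (Ideal.absNorm b : ℂ)⁻¹ * (c * ∑' y : 𝓞 K, (intWeight K s y : ℂ))‖ ≤ C := by
  have : Finite (𝓞 K ⧸ m) := Ideal.finiteQuotientOfFreeOfNeBot m hm
  have : Fintype (𝓞 K ⧸ m) := Fintype.ofFinite _
  refine ⟨(Ideal.absNorm m : ℂ)⁻¹ * ∑ u, F u, fun b hb hbm ↦ ?_⟩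
  have hx (u : 𝓞 K ⧸ m) : ∃ x : 𝓞 K, x ∈ b ∧ Ideal.Quotient.mk m x = u := by
    obtain ⟨u, rfl⟩ := Ideal.Quotient.mk_surjective u
    obtain ⟨i, hi, j, hj, hij⟩ := Ideal.isCoprime_iff_exists.mp hbm
    refine ⟨u * i, b.mul_mem_left _ hi, ?_⟩
    rw [Ideal.Quotient.eq, show u * i - u = -u * j by linear_combination u * hij]
    exact m.mul_mem_left _ hj
  choose x hxb hxm using hx
  choose C hC using fun u ↦ exists_tsum_coset_sub_le (K := K) (mul_ne_zero hb hm) (x u)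
  refine ⟨∑ u, ‖F u‖ * C u, fun s hs1 hs2 ↦ ?_⟩
  have hsum := summable_intWeight (K := K) hs1 hs2
  set g := intWeight K s
  set N := (Ideal.absNorm (b * m) : ℝ)⁻¹ with hN
  have hpart (u : 𝓞 K ⧸ m) :
      ∑' z : (b * m : Ideal (𝓞 K)), g (z + x u) =
        ∑' y, if y ∈ b ∧ Ideal.Quotient.mk m y = u then g y else 0 := by
    have hinj : Function.Injective (fun z : (b * m : Ideal (𝓞 K)) ↦ (z : 𝓞 K) + x u) :=
      (add_left_injective (x u)).comp Subtype.val_injective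
    rw [← hinj.tsum_eq]
    · refine tsum_congr fun z ↦ ?_
      have hz := Ideal.mul_le_inf z.2
      have hzm : Ideal.Quotient.mk m (z + x u) = u := by
        rw [map_add, Ideal.Quotient.eq_zero_iff_mem.mpr hz.2, zero_add, hxm]
      rw [if_pos ⟨b.add_mem hz.1 (hxb u), hzm⟩]
    · intro y hy
      have hy' : y ∈ b ∧ Ideal.Quotient.mk m y = u := by
        by_contra h
        exact hy (if_neg h)
      refine ⟨⟨y - x u, ?_⟩, by simp⟩
      rw [Ideal.mul_eq_inf_of_isCoprime hbm]
      refine ⟨b.sub_mem hy'.1 (hxb u), ?_⟩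
      rw [SetLike.mem_coe, ← Ideal.Quotient.eq, hy'.2, hxm]
  have hs' (u : 𝓞 K ⧸ m) : Summable fun y ↦
      if y ∈ b ∧ Ideal.Quotient.mk m y = u then g y else 0 := by
    refine Summable.of_nonneg_of_le (fun y ↦ ?_) (fun y ↦ ?_) hsum
    · split_ifs; exacts [intWeight_nonneg s y, le_rfl]
    · split_ifs; exacts [le_rfl, intWeight_nonneg s y]
  have e1 : ∑' y : 𝓞 K, (if y ∈ b then F (Ideal.Quotient.mk m y) else 0) * (g y : ℂ) =
      ∑ u, F u * ((∑' z : (b * m : Ideal (𝓞 K)), g (z + x u) : ℝ) : ℂ) := by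
    simp_rw [hpart, Complex.ofReal_tsum, ← tsum_mul_left]
    rw [← Summable.tsum_finsetSum fun u _ ↦ (Complex.hasSum_ofReal.mpr (hs' u).hasSum).summable.mul_left _]
    refine tsum_congr fun y ↦ ?_
    rw [Finset.sum_eq_single (Ideal.Quotient.mk m y)]
    · by_cases hy : y ∈ b <;> simp [hy]
    · intro u _ hu
      rw [if_neg (fun h ↦ hu h.2.symm)]; simp
    · simp
  have e2 : (Ideal.absNorm b : ℂ)⁻¹ * ((Ideal.absNorm m : ℂ)⁻¹ * ∑ u, F u *
      1 * ∑' y : 𝓞 K, (g y : ℂ)) = ∑ u, F u * ((N * ∑' y, g y : ℝ) : ℂ) := by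
    rw [← Complex.ofReal_tsum, hN, map_mul, Finset.mul_sum, Finset.mul_sum]
    refine Finset.sum_congr rfl fun u _ ↦ ?_
    push_cast
    rw [mul_inv]
    ring
  have e3 : (Ideal.absNorm b : ℂ)⁻¹ * ((Ideal.absNorm m : ℂ)⁻¹ * (∑ u, F u) *
      ∑' y : 𝓞 K, (g y : ℂ)) = ∑ u, F u * ((N * ∑' y, g y : ℝ) : ℂ) := by
    rw [← e2]; simp only [mul_one]; rw [← Finset.sum_mul]; ring
  rw [e1, e3, ← Finset.sum_sub_distrib]
  refine (norm_sum_le _ _).trans (Finset.sum_le_sum fun u _ ↦ ?_)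
  rw [← mul_sub, norm_mul, ← Complex.ofReal_sub, Complex.norm_real]
  gcongr
  exact hC u s hs1 hs2

variable {K : Type*} [Field K] [NumberField K]

/-- The term `N(I)^{-s}` of the Dedekind zeta function. -/
def zetaTerm (s : ℝ) (I : Ideal (𝓞 K)) : ℝ := (Ideal.absNorm I : ℝ) ^ (-s)

lemma zetaTerm_nonneg (s : ℝ) (I : Ideal (𝓞 K)) : 0 ≤ zetaTerm s I :=
  Real.rpow_nonneg (Nat.cast_nonneg _) _

lemma zetaTerm_bot {s : ℝ} (hs : 1 < s) : zetaTerm s (⊥ : Ideal (𝓞 K)) = 0 := by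
  rw [zetaTerm, Ideal.absNorm_bot, Nat.cast_zero, Real.zero_rpow (by linarith)]

lemma zetaTerm_mul (s : ℝ) (I J : Ideal (𝓞 K)) :
    zetaTerm s (I * J) = zetaTerm s I * zetaTerm s J := by
  rw [zetaTerm, map_mul, Nat.cast_mul, Real.mul_rpow (Nat.cast_nonneg _) (Nat.cast_nonneg _)]
  rfl

lemma zetaTerm_pos (s : ℝ) {I : Ideal (𝓞 K)} (hI : I ≠ ⊥) : 0 < zetaTerm s I :=
  Real.rpow_pos_of_pos (Nat.cast_pos.mpr (Nat.pos_of_ne_zero (Ideal.absNorm_eq_zero_iff.not.mpr hI))) _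

/-- The units of `𝓞 K` parametrise the generators of a nonzero principal ideal. -/
def unitsEquivGenerators {x : 𝓞 K} (hx : x ≠ 0) :
    (𝓞 K)ˣ ≃ ((fun y : 𝓞 K ↦ Ideal.span {y}) ⁻¹' {Ideal.span {x}} : Set (𝓞 K)) :=
  Equiv.ofBijective (fun u ↦ ⟨u * x, by
    simp only [Set.mem_preimage, Set.mem_singleton_iff]
    rw [Ideal.span_singleton_eq_span_singleton, mul_comm]
    exact (associated_mul_unit_left x _ u.isUnit)⟩) (by
    constructor
    · intro u v h
      exact Units.ext (mul_right_cancel₀ hx (congrArg Subtype.val h))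
    · rintro ⟨y, hy⟩
      obtain ⟨u, hu⟩ := Ideal.span_singleton_eq_span_singleton.mp hy
      refine ⟨u⁻¹, Subtype.ext ?_⟩
      simp only [← hu]
      rw [mul_comm, mul_assoc, Units.mul_inv, mul_one])

lemma hasSum_generators (s : ℝ) {x : 𝓞 K} (hx : x ≠ 0) :
    HasSum (fun y : ((fun y : 𝓞 K ↦ Ideal.span {y}) ⁻¹' {Ideal.span {x}} : Set (𝓞 K)) ↦
      intWeight K s y) (torsionOrder K * zetaTerm s (Ideal.span {x})) := by
  rw [← (unitsEquivGenerators hx).hasSum_iff]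
  have hx' : mixedEmbedding.norm (mixedEmbedding K (x : K)) ≠ 0 := by
    have := one_le_norm_mixedEmbedding hx
    linarith
  have h := (hasSum_coneWeight hx').mul_right (zetaTerm s (Ideal.span {x}))
  refine HasSum.congr_fun h fun u ↦ ?_
  have e : intWeight K s ((u : 𝓞 K) * x) =
      weightedNorm K s (u • mixedEmbedding K (x : K)) := by
    rw [intWeight, RingOfIntegers.coe_eq_algebraMap, map_mul, map_mul]; rfl
  change intWeight K s ((u : 𝓞 K) * x) = _
  rw [e, weightedNorm, norm_unit_smul, norm_mixedEmbedding_eq_absNorm]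
  rfl

lemma hasSum_principal {s : ℝ} (hs1 : 1 < s) (hs2 : s ≤ 2) (H : Ideal (𝓞 K) → ℂ)
    (hH : ∀ I, ‖H I‖ ≤ 1) :
    HasSum (fun I : Ideal (𝓞 K) ↦ if Submodule.IsPrincipal I then H I * zetaTerm s I else 0)
      ((torsionOrder K : ℂ)⁻¹ * ∑' y : 𝓞 K, H (Ideal.span {y}) * intWeight K s y) := by
  have hsum : Summable fun y : 𝓞 K ↦ H (Ideal.span {y}) * (intWeight K s y : ℂ) := by
    refine Summable.of_norm_bounded (summable_intWeight (K := K) hs1 hs2) fun y ↦ ?_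
    rw [norm_mul, Complex.norm_real, Real.norm_of_nonneg (intWeight_nonneg s y)]
    exact mul_le_of_le_one_left (intWeight_nonneg s y) (hH _)
  have h := (hsum.hasSum.tsum_fiberwise fun y : 𝓞 K ↦ Ideal.span {y}).mul_left
    (torsionOrder K : ℂ)⁻¹
  have ht : (torsionOrder K : ℂ) ≠ 0 := Nat.cast_ne_zero.mpr (NeZero.ne _)
  refine HasSum.congr_fun h fun I ↦ ?_
  by_cases hI : Submodule.IsPrincipal I
  · obtain ⟨x, hx⟩ := hI.principal
    replace hx : I = Ideal.span {x} := hx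
    rw [if_pos hI]
    subst hx
    by_cases hx0 : x = 0
    · have hz (y : ((fun y : 𝓞 K ↦ Ideal.span {y}) ⁻¹' {Ideal.span {x}} : Set (𝓞 K))) :
          H (Ideal.span {(y : 𝓞 K)}) * (intWeight K s y : ℂ) = 0 := by
        have := y.2
        simp only [Set.mem_preimage, Set.mem_singleton_iff, hx0] at this
        rw [Ideal.span_singleton_eq_span_singleton, associated_zero_iff_eq_zero] at this
        rw [this, intWeight_zero]
        simp
      rw [tsum_congr hz, tsum_zero, hx0, Ideal.span_singleton_eq_bot.mpr rfl, zetaTerm_bot hs1]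
      simp
    · have hz (y : ((fun y : 𝓞 K ↦ Ideal.span {y}) ⁻¹' {Ideal.span {x}} : Set (𝓞 K))) :
          H (Ideal.span {(y : 𝓞 K)}) * (intWeight K s y : ℂ) =
            H (Ideal.span {x}) * (intWeight K s y : ℂ) := by
        have : Ideal.span {(y : 𝓞 K)} = Ideal.span {x} := y.2
        rw [this]
      rw [tsum_congr hz, tsum_mul_left, ← Complex.ofReal_tsum, (hasSum_generators s hx0).tsum_eq]
      push_cast
      field_simp
  · have : IsEmpty ((fun y : 𝓞 K ↦ Ideal.span {y}) ⁻¹' {I} : Set (𝓞 K)) :=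
      ⟨fun y ↦ hI ⟨y, y.2.symm⟩⟩
    rw [if_neg hI, tsum_empty, mul_zero]

lemma exists_finset_mul_isPrincipal :
    ∃ S : Finset (Ideal (𝓞 K)), (∀ J ∈ S, J ≠ ⊥) ∧
      ∀ I : Ideal (𝓞 K), I ≠ ⊥ → ∃ J ∈ S, Submodule.IsPrincipal (I * J) := by
  choose J hJ using fun C : ClassGroup (𝓞 K) ↦ ClassGroup.mk0_surjective C
  refine ⟨Finset.univ.image fun C ↦ (J C : Ideal (𝓞 K)), ?_, fun I hI ↦ ?_⟩
  · intro I hI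
    obtain ⟨C, -, rfl⟩ := Finset.mem_image.mp hI
    exact mem_nonZeroDivisors_iff_ne_zero.mp (J C).2
  · let I' : nonZeroDivisors (Ideal (𝓞 K)) := ⟨I, mem_nonZeroDivisors_iff_ne_zero.mpr hI⟩
    refine ⟨J (ClassGroup.mk0 I')⁻¹, Finset.mem_image_of_mem _ (Finset.mem_univ _), ?_⟩
    have : ClassGroup.mk0 (I' * J (ClassGroup.mk0 I')⁻¹) = 1 := by
      rw [map_mul, hJ, mul_inv_cancel]
    exact ClassGroup.mk0_eq_one_iff _ |>.mp this

lemma summable_zetaTerm_of_le_two {s : ℝ} (hs1 : 1 < s) (hs2 : s ≤ 2) :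
    Summable fun I : Ideal (𝓞 K) ↦ zetaTerm s I := by
  obtain ⟨S, hS0, hS⟩ := exists_finset_mul_isPrincipal (K := K)
  have hP : Summable fun I : Ideal (𝓞 K) ↦ if Submodule.IsPrincipal I then zetaTerm s I else 0 := by
    have := (hasSum_principal (K := K) hs1 hs2 (fun _ ↦ 1) (by simp)).summable.norm
    refine this.congr fun I ↦ ?_
    split_ifs
    · rw [one_mul, Complex.norm_real, Real.norm_of_nonneg (zetaTerm_nonneg s I)]
    · simp
  have hQ : Summable fun I : Ideal (𝓞 K) ↦ ∑ J ∈ S, (zetaTerm s J)⁻¹ *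
      (if Submodule.IsPrincipal (I * J) then zetaTerm s (I * J) else 0) := by
    refine summable_sum fun J hJ ↦ Summable.mul_left _ ?_
    exact hP.comp_injective (mul_left_injective₀ (hS0 J hJ))
  refine Summable.of_nonneg_of_le (fun I ↦ zetaTerm_nonneg s I) (fun I ↦ ?_) hQ
  have hn (J : Ideal (𝓞 K)) : 0 ≤ (zetaTerm s J)⁻¹ *
      (if Submodule.IsPrincipal (I * J) then zetaTerm s (I * J) else 0) := by
    refine mul_nonneg (inv_nonneg.mpr (zetaTerm_nonneg s J)) ?_
    split_ifs; exacts [zetaTerm_nonneg _ _, le_rfl]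
  by_cases hI : I = ⊥
  · rw [hI, zetaTerm_bot hs1]
    exact Finset.sum_nonneg fun J _ ↦ hI ▸ hn J
  · obtain ⟨J, hJ, hIJ⟩ := hS I hI
    refine le_trans (le_of_eq ?_) (Finset.single_le_sum (fun J _ ↦ hn J) hJ)
    rw [if_pos hIJ, zetaTerm_mul]
    have := (zetaTerm_pos s (hS0 J hJ)).ne'
    field_simp

variable {K : Type*} [Field K] [NumberField K]

lemma exists_principal_multiples_sub_le {m : Ideal (𝓞 K)} (hm : m ≠ ⊥) (f : Ideal (𝓞 K) →* ℂ)
    (hf : ∀ I, ‖f I‖ ≤ 1) (F : 𝓞 K ⧸ m → ℂ)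
    (hF : ∀ y : 𝓞 K, y ≠ 0 → f (Ideal.span {y}) = F (Ideal.Quotient.mk m y)) :
    ∃ c : ℂ, ∀ b : Ideal (𝓞 K), b ≠ ⊥ → IsCoprime b m → ∃ C : ℝ, ∀ s : ℝ, 1 < s → s ≤ 2 →
      ‖(∑' I : Ideal (𝓞 K), if b ∣ I ∧ Submodule.IsPrincipal I then f I * zetaTerm s I else 0) -
        (Ideal.absNorm b : ℂ)⁻¹ * (c * ∑' y : 𝓞 K, (intWeight K s y : ℂ))‖ ≤ C := by
  obtain ⟨c, hc⟩ := exists_tsum_periodic_sub_le hm F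
  refine ⟨(torsionOrder K : ℂ)⁻¹ * c, fun b hb hbm ↦ ?_⟩
  obtain ⟨C, hC⟩ := hc b hb hbm
  refine ⟨(torsionOrder K : ℝ)⁻¹ * C, fun s hs1 hs2 ↦ ?_⟩
  have h1 := (hasSum_principal (K := K) hs1 hs2 (fun I ↦ if b ∣ I then f I else 0) (fun I ↦ by
    split_ifs; exacts [hf I, by simp])).tsum_eq
  have h2 : (∑' I : Ideal (𝓞 K), if b ∣ I ∧ Submodule.IsPrincipal I then f I * zetaTerm s I else 0)
      = (torsionOrder K : ℂ)⁻¹ * ∑' y : 𝓞 K,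
        (if y ∈ b then F (Ideal.Quotient.mk m y) else 0) * intWeight K s y := by
    rw [← tsum_congr fun I ↦ ?_, h1]
    · congr 1
      refine tsum_congr fun y ↦ ?_
      by_cases hy : y = 0
      · rw [hy, intWeight_zero]; simp
      · rw [hF y hy, Ideal.dvd_span_singleton]
    · by_cases h1 : b ∣ I <;> by_cases h2 : Submodule.IsPrincipal I <;> simp [h1, h2]
  have h3 (A B : ℂ) : (torsionOrder K : ℂ)⁻¹ * A - (Ideal.absNorm b : ℂ)⁻¹ *
      ((torsionOrder K : ℂ)⁻¹ * c * B) =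
        (torsionOrder K : ℂ)⁻¹ * (A - (Ideal.absNorm b : ℂ)⁻¹ * (c * B)) := by ring
  rw [h2, h3, norm_mul, norm_inv, Complex.norm_natCast]
  gcongr
  exact hC s hs1 hs2

lemma exists_class_multiples_sub_le {m : Ideal (𝓞 K)} (hm : m ≠ ⊥) (f : Ideal (𝓞 K) →* ℂ)
    (hf : ∀ I, ‖f I‖ ≤ 1) (hfm : ∀ I, f I ≠ 0 → IsCoprime I m) (F : 𝓞 K ⧸ m → ℂ)
    (hF : ∀ y : 𝓞 K, y ≠ 0 → f (Ideal.span {y}) = F (Ideal.Quotient.mk m y))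
    {a J : Ideal (𝓞 K)} (ha : a ≠ ⊥) (hfa : f a ≠ 0) (hJ : J ≠ ⊥) (hfJ : f J ≠ 0) :
    ∃ C : ℝ, ∀ s : ℝ, 1 < s → s ≤ 2 →
      ‖(∑' I : Ideal (𝓞 K), if a ∣ I ∧ Submodule.IsPrincipal (I * J) then f I * zetaTerm s I else 0)
        - (Ideal.absNorm a : ℂ)⁻¹ *
        ∑' I : Ideal (𝓞 K), if Submodule.IsPrincipal (I * J) then f I * zetaTerm s I else 0‖ ≤ C := by
  obtain ⟨c, hc⟩ := exists_principal_multiples_sub_le hm f hf F hF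
  obtain ⟨C₁, hC₁⟩ := hc (a * J) (mul_ne_zero ha hJ) (hfm _ (by rw [map_mul]; exact mul_ne_zero hfa hfJ))
  obtain ⟨C₂, hC₂⟩ := hc J hJ (hfm _ hfJ)
  have hA : (1 : ℝ) ≤ Ideal.absNorm a :=
    Nat.one_le_cast.mpr (Nat.pos_of_ne_zero (Ideal.absNorm_eq_zero_iff.not.mpr ha))
  have hA' : (Ideal.absNorm a : ℂ) ≠ 0 := fun h ↦ by
    rw [Nat.cast_eq_zero] at h; rw [h] at hA; norm_num at hA
  have hJ1 : (1 : ℝ) ≤ Ideal.absNorm J :=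
    Nat.one_le_cast.mpr (Nat.pos_of_ne_zero (Ideal.absNorm_eq_zero_iff.not.mpr hJ))
  refine ⟨‖f J‖⁻¹ * (Ideal.absNorm J : ℝ) ^ (2 : ℝ) * (C₁ + C₂), fun s hs1 hs2 ↦ ?_⟩
  have key (b : Ideal (𝓞 K)) :
      (∑' I : Ideal (𝓞 K), if b * J ∣ I ∧ Submodule.IsPrincipal I then f I * zetaTerm s I else 0) =
      f J * zetaTerm s J * ∑' I : Ideal (𝓞 K),
        if b ∣ I ∧ Submodule.IsPrincipal (I * J) then f I * zetaTerm s I else 0 := by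
    rw [← tsum_mul_left, ← (mul_left_injective₀ (show J ≠ 0 from hJ)).tsum_eq]
    · refine tsum_congr fun I ↦ ?_
      simp only [mul_dvd_mul_iff_right (show J ≠ 0 from hJ)]
      split_ifs
      · rw [map_mul, zetaTerm_mul]; push_cast; ring
      · simp
    · intro I hI
      have h : b * J ∣ I := by
        by_contra h
        exact hI (if_neg fun h' ↦ h h'.1)
      obtain ⟨I', rfl⟩ := h
      exact ⟨b * I', by ring⟩
  have h1 := hC₁ s hs1 hs2
  have h2 := hC₂ s hs1 hs2
  have k2 := key ⊤
  simp only [← Ideal.one_eq_top, one_mul, one_dvd, true_and] at k2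
  rw [key a, map_mul] at h1
  rw [k2] at h2
  set S₁ := ∑' I : Ideal (𝓞 K), if a ∣ I ∧ Submodule.IsPrincipal (I * J) then f I * (zetaTerm s I : ℂ) else 0
  set S₂ := ∑' I : Ideal (𝓞 K), if Submodule.IsPrincipal (I * J) then f I * (zetaTerm s I : ℂ) else 0
  set Z := c * ∑' y : 𝓞 K, (intWeight K s y : ℂ)
  have hzJ := zetaTerm_pos s hJ
  have hzJ' : (zetaTerm s J : ℂ) ≠ 0 := Complex.ofReal_ne_zero.mpr hzJ.ne'
  have hinv : (zetaTerm s J)⁻¹ ≤ (Ideal.absNorm J : ℝ) ^ (2 : ℝ) := by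
    rw [zetaTerm, Real.rpow_neg (by linarith), inv_inv]
    exact Real.rpow_le_rpow_of_exponent_le hJ1 hs2
  have e : S₁ - (Ideal.absNorm a : ℂ)⁻¹ * S₂ = (f J)⁻¹ * (zetaTerm s J : ℂ)⁻¹ *
      ((f J * zetaTerm s J * S₁ - ((Ideal.absNorm a * Ideal.absNorm J : ℕ) : ℂ)⁻¹ * Z) -
      (Ideal.absNorm a : ℂ)⁻¹ * (f J * zetaTerm s J * S₂ - (Ideal.absNorm J : ℂ)⁻¹ * Z)) := by
    push_cast
    rw [mul_inv]
    field_simp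
    ring
  rw [e, norm_mul, norm_mul, norm_inv, norm_inv, Complex.norm_real, Real.norm_of_nonneg hzJ.le]
  refine mul_le_mul (by gcongr) ?_ (norm_nonneg _) (by positivity)
  refine (norm_sub_le _ _).trans (add_le_add h1 ?_)
  rw [norm_mul, norm_inv, Complex.norm_natCast]
  exact (mul_le_of_le_one_left (norm_nonneg _) (inv_le_one_of_one_le₀ hA)).trans h2

theorem exists_norm_tsum_le {m : Ideal (𝓞 K)} (hm : m ≠ ⊥) (f : Ideal (𝓞 K) →* ℂ)
    (hf : ∀ I, ‖f I‖ ≤ 1) (hfm : ∀ I, f I ≠ 0 → IsCoprime I m) (F : 𝓞 K ⧸ m → ℂ)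
    (hF : ∀ y : 𝓞 K, y ≠ 0 → f (Ideal.span {y}) = F (Ideal.Quotient.mk m y))
    {a : Ideal (𝓞 K)} (ha : a ≠ ⊥) (hfa : f a ≠ 0) (hfa1 : f a ≠ 1) :
    ∃ C : ℝ, ∀ s : ℝ, 1 < s → s ≤ 2 →
      ‖∑' I : Ideal (𝓞 K), f I * (zetaTerm s I : ℂ)‖ ≤ C := by
  let cl (C : ClassGroup (𝓞 K)) (I : Ideal (𝓞 K)) : Prop :=
    ∃ h : I ≠ ⊥, ClassGroup.mk0 ⟨I, mem_nonZeroDivisors_iff_ne_zero.mpr h⟩ = C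
  have hcl (C : ClassGroup (𝓞 K)) : ∃ B : ℝ, ∀ s : ℝ, 1 < s → s ≤ 2 →
      ‖(∑' I : Ideal (𝓞 K), if a ∣ I ∧ cl C I then f I * (zetaTerm s I : ℂ) else 0)
        - (Ideal.absNorm a : ℂ)⁻¹ *
        ∑' I : Ideal (𝓞 K), if cl C I then f I * (zetaTerm s I : ℂ) else 0‖ ≤ B := by
    by_cases hC : ∃ I, cl C I ∧ f I ≠ 0
    · obtain ⟨I₀, ⟨hI₀, hI₀C⟩, hfI₀⟩ := hC
      set I₀' : nonZeroDivisors (Ideal (𝓞 K)) := ⟨I₀, mem_nonZeroDivisors_iff_ne_zero.mpr hI₀⟩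
      let J := I₀' ^ (Fintype.card (ClassGroup (𝓞 K)) - 1)
      have hJC : ClassGroup.mk0 J = C⁻¹ := by
        rw [map_pow, hI₀C, eq_inv_iff_mul_eq_one, ← pow_succ,
          Nat.sub_add_cancel Fintype.card_pos, pow_card_eq_one]
      have hJ0 : (J : Ideal (𝓞 K)) ≠ ⊥ := mem_nonZeroDivisors_iff_ne_zero.mp J.2
      have hfJ : f J ≠ 0 := by
        rw [SubmonoidClass.coe_pow, map_pow]; exact pow_ne_zero _ hfI₀
      obtain ⟨B, hB⟩ := exists_class_multiples_sub_le hm f hf hfm F hF ha hfa hJ0 hfJ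
      refine ⟨B, fun s hs1 hs2 ↦ ?_⟩
      have hiff {I : Ideal (𝓞 K)} (hI : I ≠ ⊥) : cl C I ↔ Submodule.IsPrincipal (I * (J : Ideal (𝓞 K))) := by
        have : Submodule.IsPrincipal (I * (J : Ideal (𝓞 K))) ↔ ClassGroup.mk0
            (⟨I, mem_nonZeroDivisors_iff_ne_zero.mpr hI⟩ * J) = 1 := (ClassGroup.mk0_eq_one_iff _).symm
        rw [this, map_mul, hJC, mul_inv_eq_one]
        exact ⟨fun h ↦ h.2, fun h ↦ ⟨hI, h⟩⟩
      convert hB s hs1 hs2 using 2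
      have hz : (zetaTerm s (⊥ : Ideal (𝓞 K)) : ℂ) = 0 := by rw [zetaTerm_bot hs1]; simp
      congr 1
      · refine tsum_congr fun I ↦ ?_
        by_cases hI : I = ⊥
        · subst hI; simp [hz]
        · simp only [hiff hI]
      · congr 1
        refine tsum_congr fun I ↦ ?_
        by_cases hI : I = ⊥
        · subst hI; simp [hz]
        · simp only [hiff hI]
    · push Not at hC
      refine ⟨0, fun s _ _ ↦ le_of_eq ?_⟩
      have h1 (I : Ideal (𝓞 K)) : (if a ∣ I ∧ cl C I then f I * (zetaTerm s I : ℂ) else 0) = 0 := by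
        split_ifs with h
        · rw [hC I h.2, zero_mul]
        · rfl
      have h2 (I : Ideal (𝓞 K)) : (if cl C I then f I * (zetaTerm s I : ℂ) else 0) = 0 := by
        split_ifs with h
        · rw [hC I h, zero_mul]
        · rfl
      rw [tsum_congr h1, tsum_congr h2]; simp
  choose B hB using hcl
  have hA : (1 : ℝ) ≤ Ideal.absNorm a :=
    Nat.one_le_cast.mpr (Nat.pos_of_ne_zero (Ideal.absNorm_eq_zero_iff.not.mpr ha))
  set A : ℝ := ((Ideal.absNorm a : ℕ) : ℝ) with hAdef
  have hre : (f a).re < 1 := by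
    by_contra! h
    have h1 := hf a
    have h2 : Complex.normSq (f a) ≤ 1 := by
      rw [Complex.normSq_eq_norm_sq]; nlinarith [norm_nonneg (f a)]
    rw [Complex.normSq_apply] at h2
    have h3 : (f a).re = 1 := by nlinarith [mul_self_nonneg (f a).im]
    have h4 : (f a).im = 0 := by nlinarith [mul_self_nonneg (f a).im]
    exact hfa1 (Complex.ext (by simpa using h3) (by simpa using h4))
  refine ⟨A ^ (2 : ℝ) * (∑ C, B C) / (1 - (f a).re), fun s hs1 hs2 ↦ ?_⟩
  have hsum : Summable fun I : Ideal (𝓞 K) ↦ f I * (zetaTerm s I : ℂ) := by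
    refine Summable.of_norm_bounded (summable_zetaTerm_of_le_two (K := K) hs1 hs2) fun I ↦ ?_
    rw [norm_mul, Complex.norm_real, Real.norm_of_nonneg (zetaTerm_nonneg s I)]
    exact mul_le_of_le_one_left (zetaTerm_nonneg s I) (hf _)
  have hz : (zetaTerm s (⊥ : Ideal (𝓞 K)) : ℂ) = 0 := by rw [zetaTerm_bot hs1]; simp
  have hsplit (P : Ideal (𝓞 K) → Prop) :
      ∑ C, ∑' I : Ideal (𝓞 K), (if P I ∧ cl C I then f I * (zetaTerm s I : ℂ) else 0) =
        ∑' I : Ideal (𝓞 K), if P I then f I * (zetaTerm s I : ℂ) else 0 := by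
    rw [← Summable.tsum_finsetSum]
    · refine tsum_congr fun I ↦ ?_
      by_cases hI : I = ⊥
      · subst hI; simp [hz]
      · rw [Finset.sum_eq_single (ClassGroup.mk0 ⟨I, mem_nonZeroDivisors_iff_ne_zero.mpr hI⟩)]
        · have : cl (ClassGroup.mk0 ⟨I, mem_nonZeroDivisors_iff_ne_zero.mpr hI⟩) I := ⟨hI, rfl⟩
          simp only [this, and_true]
        · intro C _ hC
          rw [if_neg]
          rintro ⟨-, h, h'⟩
          exact hC h'.symm
        · simp
    · intro C _
      refine Summable.of_norm_bounded hsum.norm fun I ↦ ?_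
      split_ifs
      · rfl
      · rw [norm_zero]; exact norm_nonneg _
  set L := ∑' I : Ideal (𝓞 K), f I * (zetaTerm s I : ℂ) with hL
  have hd : (∑' I : Ideal (𝓞 K), if a ∣ I then f I * (zetaTerm s I : ℂ) else 0) =
      f a * (zetaTerm s a : ℂ) * L := by
    rw [hL, ← tsum_mul_left, ← (mul_right_injective₀ (show a ≠ 0 from ha)).tsum_eq]
    · refine tsum_congr fun I ↦ ?_
      rw [if_pos (dvd_mul_right a I), map_mul, zetaTerm_mul]; push_cast; ring
    · intro I hI
      have h : a ∣ I := by
        by_contra h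
        exact hI (if_neg h)
      obtain ⟨I', rfl⟩ := h
      exact ⟨I', rfl⟩
  have h1 := hsplit (fun I ↦ a ∣ I)
  have h2 := hsplit (fun _ ↦ True)
  simp only [true_and, if_true] at h2
  have h3 : ‖f a * (zetaTerm s a : ℂ) * L - (Ideal.absNorm a : ℂ)⁻¹ * L‖ ≤ ∑ C, B C := by
    rw [← hd, hL, ← h1, ← h2, Finset.mul_sum, ← Finset.sum_sub_distrib]
    exact (norm_sum_le _ _).trans (Finset.sum_le_sum fun C _ ↦ hB C s hs1 hs2)
  have hA0 : 0 < A := by linarith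
  have h4 : f a * (zetaTerm s a : ℂ) - (Ideal.absNorm a : ℂ)⁻¹ =
      ((A ^ (-s) : ℝ) : ℂ) * (f a - ((A ^ (s - 1) : ℝ) : ℂ)) := by
    have h5 : (Ideal.absNorm a : ℂ)⁻¹ = ((A ^ (-s) * A ^ (s - 1) : ℝ) : ℂ) := by
      rw [← Real.rpow_add hA0, show -s + (s - 1) = -1 by ring, Real.rpow_neg_one, hAdef]
      push_cast; rfl
    rw [h5, zetaTerm]; push_cast; ring
  rw [← sub_mul, h4, norm_mul, norm_mul, Complex.norm_real,
    Real.norm_of_nonneg (Real.rpow_nonneg hA0.le _)] at h3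
  have h6 : 1 - (f a).re ≤ ‖f a - ((A ^ (s - 1) : ℝ) : ℂ)‖ := by
    have h7 := Complex.abs_re_le_norm (f a - ((A ^ (s - 1) : ℝ) : ℂ))
    rw [Complex.sub_re, Complex.ofReal_re] at h7
    have h8 : 1 ≤ A ^ (s - 1) := Real.one_le_rpow hA (by linarith)
    have := neg_abs_le ((f a).re - A ^ (s - 1))
    linarith
  have h9 : (A ^ (2 : ℝ))⁻¹ ≤ A ^ (-s) := by
    rw [← Real.rpow_neg hA0.le]
    exact Real.rpow_le_rpow_of_exponent_le hA (by linarith)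
  have hA2 : 0 < A ^ (2 : ℝ) := Real.rpow_pos_of_pos hA0 _
  have hre' : 0 < 1 - (f a).re := by linarith
  have h10 : (A ^ (2 : ℝ))⁻¹ * (1 - (f a).re) * ‖L‖ ≤ ∑ C, B C :=
    le_trans (by gcongr) h3
  rw [le_div_iff₀ hre']
  calc ‖L‖ * (1 - (f a).re) = A ^ (2 : ℝ) * ((A ^ (2 : ℝ))⁻¹ * (1 - (f a).re) * ‖L‖) := by
        field_simp
    _ ≤ _ := by gcongr

end ConeWeight

end

noncomputable section

namespace ConeWeight

open IsDedekindDomain NumberField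
open scoped Classical

variable {K : Type*} [Field K] [NumberField K]

lemma exists_heightOneSpectrum_dvd {I : Ideal (𝓞 K)} (hI : I ≠ ⊤) (hI0 : I ≠ ⊥) :
    ∃ v : HeightOneSpectrum (𝓞 K), v.asIdeal ∣ I := by
  obtain ⟨M, hM, hIM⟩ := Ideal.exists_le_maximal I hI
  exact ⟨⟨M, hM.isPrime, fun h ↦ hI0 (le_bot_iff.mp (h ▸ hIM))⟩, Ideal.dvd_iff_le.mpr hIM⟩

lemma finite_heightOneSpectrum_dvd {I : Ideal (𝓞 K)} (hI0 : I ≠ ⊥) :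
    {v : HeightOneSpectrum (𝓞 K) | v.asIdeal ∣ I}.Finite :=
  Ideal.finite_factors hI0

/-- An ideal is supported on a set of primes if all its prime factors belong to it. -/
def IsSupportedOn (S : Finset (HeightOneSpectrum (𝓞 K))) (I : Ideal (𝓞 K)) : Prop :=
  ∀ v : HeightOneSpectrum (𝓞 K), v.asIdeal ∣ I → v ∈ S

lemma prod_one_sub_mul_tsum_supported (g : Ideal (𝓞 K) →* ℂ) (hg : Summable fun I ↦ ‖g I‖)
    (S : Finset (HeightOneSpectrum (𝓞 K))) :
    (∏ v ∈ S, (1 - g v.asIdeal)) *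
      ∑' I, (if I ≠ ⊥ ∧ IsSupportedOn S I then g I else 0) = 1 := by
  have hs (P : Ideal (𝓞 K) → Prop) [DecidablePred P] : Summable fun I ↦ if P I then g I else 0 := by
    refine Summable.of_norm_bounded hg fun I ↦ ?_
    split_ifs
    · rfl
    · rw [norm_zero]; exact norm_nonneg _
  induction S using Finset.induction_on with
  | empty =>
    rw [Finset.prod_empty, one_mul, tsum_eq_single ⊤, if_pos, ← Ideal.one_eq_top, map_one]
    · refine ⟨top_ne_bot, fun v hv ↦ absurd (top_le_iff.mp (Ideal.dvd_iff_le.mp hv)) v.isPrime.ne_top⟩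
    · intro I hI
      refine if_neg fun ⟨h0, h⟩ ↦ ?_
      obtain ⟨v, hv⟩ := exists_heightOneSpectrum_dvd hI h0
      exact absurd (h v hv) (Finset.notMem_empty v)
  | insert v S hv ih =>
    rw [Finset.prod_insert hv, mul_comm (1 - _), mul_assoc]
    set A := ∑' I, (if I ≠ ⊥ ∧ IsSupportedOn (insert v S) I then g I else 0) with hA
    have hv0 : v.asIdeal ≠ 0 := v.ne_bot
    have h1 : ∑' I, (if I ≠ ⊥ ∧ IsSupportedOn (insert v S) I ∧ v.asIdeal ∣ I then g I else 0) =
        g v.asIdeal * A := by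
      rw [hA, ← tsum_mul_left, ← (mul_right_injective₀ hv0).tsum_eq]
      · refine tsum_congr fun I ↦ ?_
        have hiff : (v.asIdeal * I ≠ ⊥ ∧ IsSupportedOn (insert v S) (v.asIdeal * I) ∧
            v.asIdeal ∣ v.asIdeal * I) ↔ (I ≠ ⊥ ∧ IsSupportedOn (insert v S) I) := by
          constructor
          · rintro ⟨h1, h2, -⟩
            exact ⟨right_ne_zero_of_mul h1, fun w hw ↦ h2 w (hw.mul_left _)⟩
          · rintro ⟨h1, h2⟩
            refine ⟨mul_ne_zero hv0 h1, fun w hw ↦ ?_, dvd_mul_right _ _⟩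
            rcases w.prime.dvd_or_dvd hw with h | h
            · have : w = v := HeightOneSpectrum.ext
                ((v.isMaximal.eq_of_le w.isPrime.ne_top (Ideal.dvd_iff_le.mp h)).symm)
              exact this ▸ Finset.mem_insert_self _ _
            · exact h2 w h
        simp only [hiff, map_mul, mul_ite, mul_zero]
      · intro I hI
        have h : v.asIdeal ∣ I := by
          by_contra h
          exact hI (if_neg fun h' ↦ h h'.2.2)
        obtain ⟨I', rfl⟩ := h
        exact ⟨I', rfl⟩
    have h2 : A = (∑' I, (if I ≠ ⊥ ∧ IsSupportedOn S I then g I else 0)) +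
        ∑' I, (if I ≠ ⊥ ∧ IsSupportedOn (insert v S) I ∧ v.asIdeal ∣ I then g I else 0) := by
      rw [hA, ← Summable.tsum_add (hs _) (hs _)]
      refine tsum_congr fun I ↦ ?_
      by_cases h0 : I = ⊥
      · simp [h0]
      by_cases hd : v.asIdeal ∣ I
      · have : ¬ IsSupportedOn S I := fun h ↦ hv (h v hd)
        simp [h0, hd, this]
      · have : IsSupportedOn (insert v S) I ↔ IsSupportedOn S I := by
          refine ⟨fun h w hw ↦ ?_, fun h w hw ↦ Finset.mem_insert_of_mem (h w hw)⟩
          rcases Finset.mem_insert.mp (h w hw) with rfl | h'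
          · exact absurd hw hd
          · exact h'
        simp [h0, hd, this]
    have h3 : (1 - g v.asIdeal) * A =
        ∑' I, (if I ≠ ⊥ ∧ IsSupportedOn S I then g I else 0) := by
      rw [sub_mul, one_mul, ← h1]
      nth_rewrite 1 [h2]
      ring
    rw [h3, ih]

lemma tendsto_prod_one_sub_inv (g : Ideal (𝓞 K) →* ℂ) (hg : Summable fun I ↦ ‖g I‖) (hg0 : g ⊥ = 0) :
    Filter.Tendsto (fun S : Finset (HeightOneSpectrum (𝓞 K)) ↦ ∏ v ∈ S, (1 - g v.asIdeal)⁻¹)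
      Filter.atTop (nhds (∑' I, g I)) := by
  have h : Filter.Tendsto (fun S : Finset (HeightOneSpectrum (𝓞 K)) ↦
      ∑' I, (if I ≠ ⊥ ∧ IsSupportedOn S I then g I else 0)) Filter.atTop (nhds (∑' I, g I)) := by
    refine tendsto_tsum_of_dominated_convergence hg (fun I ↦ ?_) (Filter.Eventually.of_forall ?_)
    · by_cases hI : I = ⊥
      · subst hI; simp [hg0]
      · refine tendsto_const_nhds.congr' ?_
        filter_upwards [Filter.eventually_ge_atTop (finite_heightOneSpectrum_dvd hI).toFinset] with S hS
        exact (if_pos ⟨hI, fun v hv ↦ hS ((finite_heightOneSpectrum_dvd hI).mem_toFinset.mpr hv)⟩).symm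
    · intro S I
      split_ifs
      · rfl
      · rw [norm_zero]; exact norm_nonneg _
  refine h.congr fun S ↦ ?_
  rw [Finset.prod_inv_distrib]
  exact eq_inv_of_mul_eq_one_right (prod_one_sub_mul_tsum_supported g hg S)

variable {K : Type*} [Field K] [NumberField K]

lemma dedekindZeta_eq_tsum {s : ℝ} (hs1 : 1 < s) (hs2 : s ≤ 2) :
    dedekindZeta K s = ((∑' I : Ideal (𝓞 K), zetaTerm s I : ℝ) : ℂ) := by
  have h := ((summable_zetaTerm_of_le_two (K := K) hs1 hs2).hasSum.tsum_fiberwise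
    fun I ↦ Ideal.absNorm I).tsum_eq
  rw [← h, Complex.ofReal_tsum, dedekindZeta, LSeries]
  refine tsum_congr fun n ↦ ?_
  have h1 : ∑' I : ((fun I : Ideal (𝓞 K) ↦ Ideal.absNorm I) ⁻¹' {n} : Set (Ideal (𝓞 K))),
      zetaTerm s (I : Ideal (𝓞 K)) =
      Nat.card {I : Ideal (𝓞 K) // Ideal.absNorm I = n} * (n : ℝ) ^ (-s) := by
    have : ∀ I : ((fun I : Ideal (𝓞 K) ↦ Ideal.absNorm I) ⁻¹' {n} : Set (Ideal (𝓞 K))),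
      zetaTerm s (I : Ideal (𝓞 K)) = (n : ℝ) ^ (-s) := fun I ↦ by
        rw [zetaTerm, show Ideal.absNorm (I : Ideal (𝓞 K)) = n from I.2]
    rw [tsum_congr this, tsum_const, nsmul_eq_mul]
    rfl
  rw [h1]
  by_cases hn : n = 0
  · subst hn
    rw [LSeries.term_zero, Nat.cast_zero, Real.zero_rpow (by linarith)]
    simp
  · rw [LSeries.term_of_ne_zero hn]
    push_cast
    rw [Complex.ofReal_cpow (Nat.cast_nonneg n)]
    push_cast
    rw [Complex.cpow_neg, div_eq_mul_inv]

lemma tendsto_sub_one_mul_tsum_zetaTerm :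
    Filter.Tendsto (fun s : ℝ ↦ (s - 1) * ∑' I : Ideal (𝓞 K), zetaTerm s I)
      (nhdsWithin 1 (Set.Ioi 1)) (nhds (dedekindZeta_residue K)) := by
  have h := tendsto_sub_one_mul_dedekindZeta_nhdsGT K
  have h' := (Complex.continuous_re.tendsto _).comp h
  refine h'.congr' ?_
  filter_upwards [Ioo_mem_nhdsGT (show (1 : ℝ) < 2 by norm_num)] with s hs
  rw [Function.comp_apply, dedekindZeta_eq_tsum hs.1 hs.2.le, ← Complex.ofReal_one,
    ← Complex.ofReal_sub, ← Complex.ofReal_mul, Complex.ofReal_re]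

section Fibers
variable {k L : Type*} [Field k] [NumberField k] [Field L] [NumberField L] [Algebra k L]

lemma card_filter_under_le (S : Finset (HeightOneSpectrum (𝓞 L))) (q : HeightOneSpectrum (𝓞 k)) :
    (S.filter fun Q ↦ Q.under (𝓞 k) = q).card ≤ Module.finrank k L := by
  have hq : q.asIdeal ≠ ⊥ := q.ne_bot
  have := q.isMaximal
  have : NoZeroSMulDivisors (𝓞 k) (𝓞 L) := ⟨fun h ↦ smul_eq_zero.mp h⟩
  refine le_trans ?_ (Ideal.card_primesOverFinset_le_finrank (𝓞 L) k L hq)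
  refine Finset.card_le_card_of_injOn (fun Q ↦ Q.asIdeal) (fun Q hQ ↦ ?_)
    fun Q _ Q' _ h ↦ HeightOneSpectrum.ext h
  refine Finset.mem_coe.mpr ((IsDedekindDomain.mem_primesOverFinset_iff hq (𝓞 L)).mpr ⟨Q.isPrime, ⟨?_⟩⟩)
  rw [Finset.mem_coe, Finset.mem_filter] at hQ
  rw [← hQ.2]; rfl

lemma sum_under_le (S : Finset (HeightOneSpectrum (𝓞 L))) {g : HeightOneSpectrum (𝓞 k) → ℝ}
    (hg0 : ∀ q, 0 ≤ g q) (hg : Summable g) :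
    ∑ Q ∈ S, g (Q.under (𝓞 k)) ≤ Module.finrank k L * ∑' q, g q := by
  refine (Finset.sum_comp g fun Q : HeightOneSpectrum (𝓞 L) ↦ Q.under (𝓞 k)).trans_le ?_
  refine le_trans (b := ∑ q ∈ S.image (fun Q ↦ Q.under (𝓞 k)), (Module.finrank k L : ℝ) * g q) ?_ ?_
  · refine Finset.sum_le_sum fun q _ ↦ ?_
    rw [nsmul_eq_mul]
    exact mul_le_mul_of_nonneg_right (Nat.cast_le.mpr (card_filter_under_le S q)) (hg0 q)
  · rw [← Finset.mul_sum]
    exact mul_le_mul_of_nonneg_left (hg.sum_le_tsum _ fun q _ ↦ hg0 q) (Nat.cast_nonneg _)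

lemma absNorm_under_le (Q : HeightOneSpectrum (𝓞 L)) :
    Ideal.absNorm (Q.under (𝓞 k)).asIdeal ≤ Ideal.absNorm Q.asIdeal := by
  have : Q.asIdeal.LiesOver (Q.under (𝓞 k)).asIdeal := ⟨rfl⟩
  have := Q.isPrime
  rw [Ideal.absNorm_eq_pow_inertiaDeg'_of_liesOver Q.asIdeal (Q.under (𝓞 k)).asIdeal
    (Q.under (𝓞 k)).isPrime (Q.under (𝓞 k)).ne_bot]
  have := (Q.under (𝓞 k)).isMaximal
  exact Nat.le_self_pow (Ideal.inertiaDeg'_ne_zero _ _) _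

end Fibers

variable {L : Type*} [Field L] [NumberField L]

lemma two_le_absNorm (Q : HeightOneSpectrum (𝓞 L)) : 2 ≤ Ideal.absNorm Q.asIdeal := by
  have h0 : Ideal.absNorm Q.asIdeal ≠ 0 := Ideal.absNorm_eq_zero_iff.not.mpr Q.ne_bot
  have h1 : Ideal.absNorm Q.asIdeal ≠ 1 := fun h ↦ Q.isPrime.ne_top (Ideal.absNorm_eq_one_iff.mp h)
  omega

lemma zetaTerm_le_half {s : ℝ} (hs : 1 < s) (Q : HeightOneSpectrum (𝓞 L)) :
    zetaTerm s Q.asIdeal ≤ 1 / 2 := by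
  have h : (2 : ℝ) ≤ Ideal.absNorm Q.asIdeal := by exact_mod_cast two_le_absNorm Q
  rw [zetaTerm]
  calc (Ideal.absNorm Q.asIdeal : ℝ) ^ (-s) ≤ (Ideal.absNorm Q.asIdeal : ℝ) ^ (-1 : ℝ) :=
        Real.rpow_le_rpow_of_exponent_le (by linarith) (by linarith)
    _ ≤ 1 / 2 := by
        rw [Real.rpow_neg_one, one_div]
        exact inv_anti₀ (by norm_num) h

lemma summable_heightOneSpectrum {s : ℝ} (hs1 : 1 < s) (hs2 : s ≤ 2) :
    Summable fun Q : HeightOneSpectrum (𝓞 L) ↦ zetaTerm s Q.asIdeal :=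
  (summable_zetaTerm_of_le_two hs1 hs2).comp_injective fun _ _ h ↦ HeightOneSpectrum.ext h

lemma zetaTerm_le_of_not_prime {s : ℝ} (hs1 : 1 < s) (Q : HeightOneSpectrum (𝓞 L))
    (hQ : ¬ (Ideal.absNorm Q.asIdeal).Prime) :
    zetaTerm s Q.asIdeal ≤ zetaTerm 2 (Q.under (𝓞 ℚ)).asIdeal := by
  have := Q.isPrime
  have : NeZero Q.asIdeal := ⟨Q.ne_bot⟩
  have hl := Nat.absNorm_under_prime Q.asIdeal
  set l := Ideal.absNorm (Ideal.under ℤ Q.asIdeal) with hldef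
  have hN := Ideal.absNorm_eq_pow_inertiaDeg' Q.asIdeal hl
  set f := (Ideal.span {(l : ℤ)}).inertiaDeg' Q.asIdeal
  have h2 := two_le_absNorm Q
  have hf : 2 ≤ f := by
    by_contra! hf
    interval_cases f
    · rw [hN] at h2; norm_num at h2
    · rw [hN, pow_one] at hQ; exact hQ hl
  have h1 : Ideal.absNorm (Q.under (𝓞 ℚ)).asIdeal ≤ l := by
    have hmem : (l : 𝓞 ℚ) ∈ (Q.under (𝓞 ℚ)).asIdeal := by
      change algebraMap (𝓞 ℚ) (𝓞 L) (l : 𝓞 ℚ) ∈ Q.asIdeal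
      rw [map_natCast]
      exact Int.absNorm_under_mem Q.asIdeal
    have hd := Ideal.absNorm_dvd_absNorm_of_le ((Ideal.span_singleton_le_iff_mem _).mpr hmem)
    have he : Ideal.absNorm (Ideal.span {(l : 𝓞 ℚ)}) = l := by
      rw [Ideal.absNorm_span_natCast, RingOfIntegers.rank, Module.finrank_self, pow_one]
    rw [he] at hd
    exact Nat.le_of_dvd hl.pos hd
  have hv := two_le_absNorm (Q.under (𝓞 ℚ))
  have h3 : (Ideal.absNorm (Q.under (𝓞 ℚ)).asIdeal : ℝ) ^ 2 ≤ Ideal.absNorm Q.asIdeal := by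
    have : Ideal.absNorm (Q.under (𝓞 ℚ)).asIdeal ^ 2 ≤ Ideal.absNorm Q.asIdeal := by
      rw [hN]
      exact (Nat.pow_le_pow_left h1 2).trans (Nat.pow_le_pow_right hl.pos hf)
    exact_mod_cast this
  have h4 : (0 : ℝ) < Ideal.absNorm (Q.under (𝓞 ℚ)).asIdeal := by
    have : (2 : ℝ) ≤ Ideal.absNorm (Q.under (𝓞 ℚ)).asIdeal := by exact_mod_cast hv
    linarith
  have h5 : (1 : ℝ) ≤ Ideal.absNorm Q.asIdeal := by
    have : (2 : ℝ) ≤ Ideal.absNorm Q.asIdeal := by exact_mod_cast h2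
    linarith
  rw [zetaTerm, zetaTerm]
  calc (Ideal.absNorm Q.asIdeal : ℝ) ^ (-s) ≤ (Ideal.absNorm Q.asIdeal : ℝ) ^ (-1 : ℝ) :=
        Real.rpow_le_rpow_of_exponent_le h5 (by linarith)
    _ ≤ _ := by
        rw [Real.rpow_neg_one, Real.rpow_neg h4.le, Real.rpow_two]
        exact inv_anti₀ (by positivity) h3

lemma inv_one_sub_le_exp {x : ℝ} (h0 : 0 ≤ x) (h1 : x ≤ 1 / 2) :
    (1 - x)⁻¹ ≤ Real.exp (x + 2 * x ^ 2) := by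
  have h := Real.abs_log_sub_add_sum_range_le (x := x) (by rw [abs_of_nonneg h0]; linarith) 1
  rw [abs_of_nonneg h0] at h
  simp only [Finset.sum_range_one, zero_add, pow_one, Nat.cast_zero, div_one] at h
  have h2 : x ^ (1 + 1) / (1 - x) ≤ 2 * x ^ 2 := by
    rw [div_le_iff₀ (by linarith)]
    have := mul_nonneg (sq_nonneg x) (show 0 ≤ 1 - 2 * x by linarith)
    calc x ^ (1 + 1) = 2 * x ^ 2 * (1 - x) - x ^ 2 * (1 - 2 * x) := by ring
      _ ≤ _ := by linarith
  have h3 := (abs_le.mp (h.trans h2)).1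
  rw [inv_le_comm₀ (by linarith) (Real.exp_pos _), ← Real.exp_neg]
  calc Real.exp (-(x + 2 * x ^ 2)) ≤ Real.exp (Real.log (1 - x)) :=
        Real.exp_le_exp.mpr (by linarith)
    _ = 1 - x := Real.exp_log (by linarith)

/-- `ζ`-terms as a completely multiplicative function. -/
def zetaHom (s : ℝ) : Ideal (𝓞 L) →* ℂ where
  toFun I := (zetaTerm s I : ℂ)
  map_one' := by simp [zetaTerm]
  map_mul' I J := by rw [zetaTerm_mul]; push_cast; rfl

lemma tendsto_prod_zeta {s : ℝ} (hs1 : 1 < s) (hs2 : s ≤ 2) :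
    Filter.Tendsto (fun S : Finset (HeightOneSpectrum (𝓞 L)) ↦
      ∏ v ∈ S, (1 - zetaTerm s v.asIdeal)⁻¹) Filter.atTop (nhds (∑' I : Ideal (𝓞 L), zetaTerm s I)) := by
  have h := tendsto_prod_one_sub_inv (K := L) (zetaHom s) (by
    refine (summable_zetaTerm_of_le_two (K := L) hs1 hs2).congr fun I ↦ ?_
    change _ = ‖(zetaTerm s I : ℂ)‖
    rw [Complex.norm_real, Real.norm_of_nonneg (zetaTerm_nonneg s I)]) (by
    change (zetaTerm s ⊥ : ℂ) = 0
    rw [zetaTerm_bot hs1, Complex.ofReal_zero])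
  have h' := (Complex.continuous_re.tendsto _).comp h
  have e : (∑' I : Ideal (𝓞 L), zetaHom s I).re = ∑' I : Ideal (𝓞 L), zetaTerm s I := by
    change (∑' I : Ideal (𝓞 L), (zetaTerm s I : ℂ)).re = _
    rw [← Complex.ofReal_tsum, Complex.ofReal_re]
  rw [e] at h'
  refine h'.congr fun S ↦ ?_
  change (∏ v ∈ S, (1 - (zetaTerm s v.asIdeal : ℂ))⁻¹).re = _
  have : (∏ v ∈ S, (1 - (zetaTerm s v.asIdeal : ℂ))⁻¹) =
      ((∏ v ∈ S, (1 - zetaTerm s v.asIdeal)⁻¹ : ℝ) : ℂ) := by push_cast; rfl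
  rw [this, Complex.ofReal_re]

lemma exists_zeta_le_exp {k : Type*} [Field k] [NumberField k] [Algebra k L]
    (T : Set (HeightOneSpectrum (𝓞 k)))
    (hT : {Q : HeightOneSpectrum (𝓞 L) | (Ideal.absNorm Q.asIdeal).Prime ∧
      Q.under (𝓞 k) ∉ T}.Finite) :
    ∃ C : ℝ, ∀ s : ℝ, 1 < s → s ≤ 2 → ∑' I : Ideal (𝓞 L), zetaTerm s I ≤
      Real.exp (Module.finrank k L * (∑' q : HeightOneSpectrum (𝓞 k),
        if q ∈ T then zetaTerm s q.asIdeal else 0) + C) := by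
  refine ⟨Module.finrank ℚ L * (∑' v : HeightOneSpectrum (𝓞 ℚ), zetaTerm 2 v.asIdeal) +
    hT.toFinset.card + 2 * ∑' Q : HeightOneSpectrum (𝓞 L), zetaTerm 2 Q.asIdeal, fun s hs1 hs2 ↦ ?_⟩
  refine le_of_tendsto (tendsto_prod_zeta hs1 hs2) (Filter.Eventually.of_forall fun S ↦ ?_)
  have h1 : ∏ v ∈ S, (1 - zetaTerm s v.asIdeal)⁻¹ ≤
      ∏ v ∈ S, Real.exp (zetaTerm s v.asIdeal + 2 * zetaTerm s v.asIdeal ^ 2) := by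
    refine Finset.prod_le_prod (fun v _ ↦ ?_) fun v _ ↦
      inv_one_sub_le_exp (zetaTerm_nonneg s _) (zetaTerm_le_half hs1 v)
    have := zetaTerm_le_half hs1 v
    exact inv_nonneg.mpr (by linarith)
  refine h1.trans ?_
  rw [← Real.exp_sum, Real.exp_le_exp, Finset.sum_add_distrib]
  have h2 (Q : HeightOneSpectrum (𝓞 L)) : zetaTerm s Q.asIdeal ≤
      (if Q.under (𝓞 k) ∈ T then zetaTerm s (Q.under (𝓞 k)).asIdeal else 0) +
      zetaTerm 2 (Q.under (𝓞 ℚ)).asIdeal + (if Q ∈ hT.toFinset then 1 else 0) := by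
    have n1 : 0 ≤ (if Q.under (𝓞 k) ∈ T then zetaTerm s (Q.under (𝓞 k)).asIdeal else 0) := by
      split_ifs; exacts [zetaTerm_nonneg _ _, le_rfl]
    have n2 := zetaTerm_nonneg 2 (Q.under (𝓞 ℚ)).asIdeal
    have n3 : (0 : ℝ) ≤ (if Q ∈ hT.toFinset then 1 else 0) := by positivity
    by_cases hp : (Ideal.absNorm Q.asIdeal).Prime
    · by_cases hQ : Q.under (𝓞 k) ∈ T
      · have : zetaTerm s Q.asIdeal ≤ zetaTerm s (Q.under (𝓞 k)).asIdeal := by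
          have := two_le_absNorm (Q.under (𝓞 k))
          refine Real.rpow_le_rpow_of_nonpos (by exact_mod_cast (by omega))
            (Nat.cast_le.mpr (absNorm_under_le Q)) (by linarith)
        rw [if_pos hQ] at n1 ⊢
        linarith
      · have hQ' : Q ∈ hT.toFinset := hT.mem_toFinset.mpr ⟨hp, hQ⟩
        have := zetaTerm_le_half hs1 Q
        rw [if_pos hQ'] at n3 ⊢
        linarith
    · have := zetaTerm_le_of_not_prime hs1 Q hp
      linarith
  have h3 : ∑ Q ∈ S, zetaTerm s Q.asIdeal ≤ Module.finrank k L *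
      (∑' q : HeightOneSpectrum (𝓞 k), if q ∈ T then zetaTerm s q.asIdeal else 0) +
      Module.finrank ℚ L * (∑' v : HeightOneSpectrum (𝓞 ℚ), zetaTerm 2 v.asIdeal) +
      hT.toFinset.card := by
    refine (Finset.sum_le_sum fun Q _ ↦ h2 Q).trans ?_
    rw [Finset.sum_add_distrib, Finset.sum_add_distrib]
    refine add_le_add (add_le_add ?_ ?_) ?_
    · refine sum_under_le S (g := fun q : HeightOneSpectrum (𝓞 k) ↦
        if q ∈ T then zetaTerm s q.asIdeal else 0) (fun q ↦ ?_) ?_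
      · split_ifs; exacts [zetaTerm_nonneg _ _, le_rfl]
      · refine Summable.of_nonneg_of_le (fun q ↦ ?_) (fun q ↦ ?_)
          (summable_heightOneSpectrum (L := k) hs1 hs2)
        · split_ifs; exacts [zetaTerm_nonneg _ _, le_rfl]
        · split_ifs; exacts [le_rfl, zetaTerm_nonneg _ _]
    · exact sum_under_le S (g := fun v : HeightOneSpectrum (𝓞 ℚ) ↦ zetaTerm 2 v.asIdeal)
        (fun v ↦ zetaTerm_nonneg _ _) (summable_heightOneSpectrum one_lt_two le_rfl)
    · rw [Finset.sum_ite_mem, Finset.sum_const, nsmul_eq_mul, mul_one]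
      exact_mod_cast Finset.card_le_card Finset.inter_subset_right
  have h4 : ∑ Q ∈ S, 2 * zetaTerm s Q.asIdeal ^ 2 ≤
      2 * ∑' Q : HeightOneSpectrum (𝓞 L), zetaTerm 2 Q.asIdeal := by
    rw [← Finset.mul_sum]
    refine mul_le_mul_of_nonneg_left ?_ (by norm_num)
    refine le_trans (Finset.sum_le_sum fun Q _ ↦ ?_)
      ((summable_heightOneSpectrum one_lt_two le_rfl).sum_le_tsum S fun Q _ ↦ zetaTerm_nonneg _ _)
    have h2 : (1 : ℝ) ≤ Ideal.absNorm Q.asIdeal := by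
      exact_mod_cast (le_trans (by norm_num) (two_le_absNorm Q))
    rw [zetaTerm, zetaTerm, ← Real.rpow_natCast, ← Real.rpow_mul (by linarith)]
    refine Real.rpow_le_rpow_of_exponent_le h2 ?_
    push_cast
    linarith
  linarith

section RayChar
set_option linter.unusedSectionVars false
variable {k : Type*} [Field k] [NumberField k] {p : ℕ}

/-- An additive function on the ideals coprime to `m` with values in `ℤ/p`, whose value on a
principal ideal depends only on the generator modulo `m`. -/
structure IsRayChar (m : Ideal (𝓞 k)) (a : Ideal (𝓞 k) → ZMod p) : Prop where
  map_mul : ∀ I J, IsCoprime I m → IsCoprime J m → a (I * J) = a I + a J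
  map_span : ∀ x y, IsCoprime (Ideal.span {x}) m → x - y ∈ m →
    a (Ideal.span {x}) = a (Ideal.span {y})

lemma isCoprime_of_le {R : Type*} [CommRing R] {m m' I : Ideal R} (hm : m' ≤ m)
    (h : IsCoprime I m') : IsCoprime I m := by
  rw [Ideal.isCoprime_iff_exists] at h ⊢
  obtain ⟨i, hi, j, hj, h⟩ := h
  exact ⟨i, hi, j, hm hj, h⟩

namespace IsRayChar
variable {m m' : Ideal (𝓞 k)} {a b : Ideal (𝓞 k) → ZMod p}

lemma mono (h : IsRayChar m a) (hm : m' ≤ m) : IsRayChar m' a where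
  map_mul I J hI hJ := h.map_mul I J (isCoprime_of_le hm hI) (isCoprime_of_le hm hJ)
  map_span x y hx hxy := h.map_span x y (isCoprime_of_le hm hx) (hm hxy)

lemma map_one (h : IsRayChar m a) : a 1 = 0 := by
  have := h.map_mul 1 1 isCoprime_one_left isCoprime_one_left
  rwa [mul_one, left_eq_add] at this

lemma linear (ha : IsRayChar m a) (hb : IsRayChar m b) (i j : ZMod p) :
    IsRayChar m fun I ↦ i * a I + j * b I where
  map_mul I J hI hJ := by rw [ha.map_mul I J hI hJ, hb.map_mul I J hI hJ]; ring
  map_span x y hx hxy := by rw [ha.map_span x y hx hxy, hb.map_span x y hx hxy]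

end IsRayChar

lemma isCoprime_span_of_sub_mem {m : Ideal (𝓞 k)} {x y : 𝓞 k} (hxy : x - y ∈ m)
    (hx : IsCoprime (Ideal.span {x}) m) : IsCoprime (Ideal.span {y}) m := by
  rw [Ideal.isCoprime_iff_exists] at hx ⊢
  obtain ⟨i, hi, j, hj, h⟩ := hx
  obtain ⟨c, rfl⟩ := Ideal.mem_span_singleton'.mp hi
  refine ⟨c * y, Ideal.mem_span_singleton'.mpr ⟨c, rfl⟩, c * (x - y) + j,
    m.add_mem (m.mul_mem_left _ hxy) hj, ?_⟩
  rw [← h]; ring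

variable [Fact p.Prime]

/-- The complex character attached to a ray character, extended by zero. -/
def charHom {m : Ideal (𝓞 k)} {a : Ideal (𝓞 k) → ZMod p} (h : IsRayChar m a) :
    Ideal (𝓞 k) →* ℂ where
  toFun I := if IsCoprime I m then ZMod.stdAddChar (a I) else 0
  map_one' := by rw [if_pos isCoprime_one_left, h.map_one, AddChar.map_zero_eq_one]
  map_mul' I J := by
    rw [IsCoprime.mul_left_iff]
    by_cases hI : IsCoprime I m <;> by_cases hJ : IsCoprime J m <;>
      simp [hI, hJ, h.map_mul, AddChar.map_add_eq_mul]

lemma norm_stdAddChar (x : ZMod p) : ‖(ZMod.stdAddChar x : ℂ)‖ = 1 := by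
  rw [ZMod.stdAddChar_apply]; exact Circle.norm_coe _

lemma charHom_apply {m : Ideal (𝓞 k)} {a : Ideal (𝓞 k) → ZMod p} (h : IsRayChar m a)
    (I : Ideal (𝓞 k)) : charHom h I = if IsCoprime I m then ZMod.stdAddChar (a I) else 0 := rfl

lemma norm_charHom_le {m : Ideal (𝓞 k)} {a : Ideal (𝓞 k) → ZMod p} (h : IsRayChar m a)
    (I : Ideal (𝓞 k)) : ‖charHom h I‖ ≤ 1 := by
  rw [charHom_apply]
  split_ifs
  · exact (norm_stdAddChar _).le
  · simp

lemma exists_norm_charHom_tsum_le {m : Ideal (𝓞 k)} (hm : m ≠ ⊥) (hm1 : m ≠ ⊤)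
    {a : Ideal (𝓞 k) → ZMod p}
    (h : IsRayChar m a) {I : Ideal (𝓞 k)} (hI : IsCoprime I m) (hI0 : a I ≠ 0) :
    ∃ C, ∀ s, 1 < s → s ≤ 2 → ‖∑' I, charHom h I * (zetaTerm s I : ℂ)‖ ≤ C := by
  refine exists_norm_tsum_le hm (charHom h) (norm_charHom_le h) (fun I hI ↦ ?_)
    (fun c ↦ charHom h (Ideal.span {Quotient.out c})) (fun y _ ↦ ?_) (a := I) ?_ ?_ ?_
  · by_contra hc
    rw [charHom_apply, if_neg hc] at hI
    exact hI rfl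
  · set z := Quotient.out (Ideal.Quotient.mk m y)
    have hz : y - z ∈ m := by
      rw [← Ideal.Quotient.eq]; exact (Ideal.Quotient.mk_out _).symm
    have hz' : z - y ∈ m := by simpa using m.neg_mem hz
    rw [charHom_apply, charHom_apply]
    by_cases hy : IsCoprime (Ideal.span {y}) m
    · rw [if_pos hy, if_pos (isCoprime_span_of_sub_mem hz hy), h.map_span y z hy hz]
    · rw [if_neg hy, if_neg fun hc ↦ hy (isCoprime_span_of_sub_mem hz' hc)]
  · rintro rfl
    rw [Ideal.isCoprime_iff_sup_eq, bot_sup_eq] at hI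
    exact hm1 hI
  · rw [charHom_apply, if_pos hI, ← norm_ne_zero_iff, norm_stdAddChar]
    exact one_ne_zero
  · rw [charHom_apply, if_pos hI]
    intro hc
    rw [← AddChar.map_zero_eq_one (ZMod.stdAddChar (N := p))] at hc
    exact hI0 (ZMod.injective_stdAddChar hc)

lemma prod_one_sub_stdAddChar (x : ℂ) :
    ∏ i : ZMod p, (1 - ZMod.stdAddChar i * x) = 1 - x ^ p := by
  have hp : 0 < p := (Fact.out : p.Prime).pos
  have hprim := Complex.isPrimitiveRoot_exp p hp.ne'
  have h := hprim.pow_sub_pow_eq_prod_sub_mul 1 x hp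
  rw [one_pow] at h
  rw [h]
  refine Finset.prod_bij (fun i _ ↦ ZMod.stdAddChar i) (fun i _ ↦ ?_) (fun i _ j _ hij ↦
    ZMod.injective_stdAddChar hij) (fun z hz ↦ ?_) fun i _ ↦ rfl
  · rw [Polynomial.mem_nthRootsFinset hp, ← AddChar.map_nsmul_eq_pow]
    simp
  · have hs : Finset.univ.image (fun i : ZMod p ↦ (ZMod.stdAddChar i : ℂ)) =
        Polynomial.nthRootsFinset p (1 : ℂ) := by
      refine Finset.eq_of_subset_of_card_le (fun w hw ↦ ?_) ?_
      · obtain ⟨i, _, rfl⟩ := Finset.mem_image.mp hw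
        rw [Polynomial.mem_nthRootsFinset hp, ← AddChar.map_nsmul_eq_pow]
        simp
      · rw [Finset.card_image_of_injective _ ZMod.injective_stdAddChar, Finset.card_univ,
          ZMod.card, hprim.card_nthRootsFinset]
    rw [← hs] at hz
    obtain ⟨i, hi, h⟩ := Finset.mem_image.mp hz
    exact ⟨i, hi, h⟩

lemma prod_one_sub_stdAddChar_affine {α : ZMod p} (hα : α ≠ 0) (β : ZMod p) (x : ℂ) :
    ∏ i : ZMod p, (1 - ZMod.stdAddChar (i * α + β) * x) = 1 - x ^ p := by
  rw [← prod_one_sub_stdAddChar x]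
  exact Fintype.prod_equiv ((Equiv.mulRight₀ α hα).trans (Equiv.addRight β)) _ _ fun i ↦ rfl

lemma norm_prod_one_sub_le {α β : ZMod p} (h : ¬ (α = 0 ∧ β = 0)) {x : ℝ} (h0 : 0 ≤ x)
    (h1 : x ≤ 1) :
    ‖∏ c : ZMod p × ZMod p, (1 - ZMod.stdAddChar (c.1 * α + c.2 * β) * (x : ℂ))‖ ≤ 1 := by
  have key : ∏ c : ZMod p × ZMod p, (1 - ZMod.stdAddChar (c.1 * α + c.2 * β) * (x : ℂ)) =
      (1 - (x : ℂ) ^ p) ^ p := by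
    by_cases hα : α = 0
    · have hβ : β ≠ 0 := fun hβ ↦ h ⟨hα, hβ⟩
      rw [Fintype.prod_prod_type]
      simp_rw [add_comm (_ * α), prod_one_sub_stdAddChar_affine hβ]
      simp
    · rw [Fintype.prod_prod_type_right]
      simp_rw [prod_one_sub_stdAddChar_affine hα]
      simp
  have hx := pow_le_one₀ (n := p) h0 h1
  have hx' := pow_nonneg h0 p
  rw [key, norm_pow]
  refine pow_le_one₀ (norm_nonneg _) ?_
  rw [show (1 - (x : ℂ) ^ p) = ((1 - x ^ p : ℝ) : ℂ) by push_cast; rfl, Complex.norm_real,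
    Real.norm_of_nonneg (by linarith)]
  linarith

variable {m : Ideal (𝓞 k)} {ψ χ : Ideal (𝓞 k) → ZMod p}

/-- Primes at which two ray characters both vanish. -/
def vanishingSet (m : Ideal (𝓞 k)) (ψ χ : Ideal (𝓞 k) → ZMod p) : Set (HeightOneSpectrum (𝓞 k)) :=
  {q | IsCoprime q.asIdeal m ∧ ψ q.asIdeal = 0 ∧ χ q.asIdeal = 0}

lemma exp_le_prod_inv (hψ : IsRayChar m ψ) (hχ : IsRayChar m χ) {s : ℝ} (hs : 1 < s)
    (q : HeightOneSpectrum (𝓞 k)) :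
    Real.exp (p ^ 2 * if q ∈ vanishingSet m ψ χ then zetaTerm s q.asIdeal else 0) ≤
    ∏ c : ZMod p × ZMod p,
      ‖(1 - charHom (hψ.linear hχ c.1 c.2) q.asIdeal * (zetaTerm s q.asIdeal : ℂ))⁻¹‖ := by
  have hx0 := zetaTerm_nonneg s q.asIdeal
  have hx1 := zetaTerm_le_half hs q
  set x := zetaTerm s q.asIdeal with hx
  rw [← norm_prod, Finset.prod_inv_distrib, norm_inv]
  by_cases hq : IsCoprime q.asIdeal m
  · simp_rw [charHom_apply, if_pos hq]
    by_cases h : ψ q.asIdeal = 0 ∧ χ q.asIdeal = 0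
    · rw [if_pos (show q ∈ vanishingSet m ψ χ from ⟨hq, h⟩)]
      simp_rw [h.1, h.2, mul_zero, add_zero, AddChar.map_zero_eq_one, one_mul]
      rw [Finset.prod_const, Finset.card_univ, Fintype.card_prod, ZMod.card,
        show (1 - (x : ℂ)) = ((1 - x : ℝ) : ℂ) by push_cast; rfl, norm_pow, Complex.norm_real,
        Real.norm_of_nonneg (by linarith), ← inv_pow,
        show (p : ℝ) ^ 2 * x = ((p * p : ℕ) : ℝ) * x by push_cast; ring, Real.exp_nat_mul]
      refine pow_le_pow_left₀ (Real.exp_pos _).le ?_ _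
      rw [le_inv_comm₀ (Real.exp_pos _) (by linarith), ← Real.exp_neg]
      have := Real.add_one_le_exp (-x)
      linarith
    · rw [if_neg fun hc ↦ h hc.2, mul_zero, Real.exp_zero]
      refine (one_le_inv₀ (norm_pos_iff.mpr ?_)).mpr (norm_prod_one_sub_le h hx0 (by linarith))
      refine Finset.prod_ne_zero_iff.mpr fun c _ hc ↦ ?_
      have := congrArg norm (sub_eq_zero.mp hc)
      rw [norm_one, norm_mul, norm_stdAddChar, one_mul, Complex.norm_real,
        Real.norm_of_nonneg hx0] at this
      linarith
  · simp_rw [charHom_apply, if_neg hq]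
    rw [if_neg fun hc ↦ hq hc.1]
    simp

lemma exp_le_prod_tsum (hψ : IsRayChar m ψ) (hχ : IsRayChar m χ) {s : ℝ}
    (hs : 1 < s) (hs2 : s ≤ 2) :
    Real.exp (p ^ 2 * ∑' q : HeightOneSpectrum (𝓞 k),
      if q ∈ vanishingSet m ψ χ then zetaTerm s q.asIdeal else 0) ≤
    ∏ c : ZMod p × ZMod p,
      ‖∑' I, charHom (hψ.linear hχ c.1 c.2) I * (zetaTerm s I : ℂ)‖ := by
  have hsum := summable_heightOneSpectrum (L := k) hs hs2
  have hT : Summable fun q : HeightOneSpectrum (𝓞 k) ↦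
      if q ∈ vanishingSet m ψ χ then zetaTerm s q.asIdeal else 0 := by
    refine Summable.of_nonneg_of_le (fun q ↦ ?_) (fun q ↦ ?_) hsum
    · split_ifs; exacts [zetaTerm_nonneg _ _, le_rfl]
    · split_ifs; exacts [le_rfl, zetaTerm_nonneg _ _]
  have h1 := (Real.continuous_exp.tendsto _).comp (hT.hasSum.mul_left ((p : ℝ) ^ 2))
  rw [← tsum_mul_left]
  have h2 (c : ZMod p × ZMod p) := tendsto_prod_one_sub_inv (K := k)
    (charHom (hψ.linear hχ c.1 c.2) * zetaHom s) (by
      refine Summable.of_nonneg_of_le (fun I ↦ norm_nonneg _) (fun I ↦ ?_)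
        (summable_zetaTerm_of_le_two (K := k) hs hs2)
      change ‖_ * (zetaTerm s I : ℂ)‖ ≤ _
      rw [norm_mul, Complex.norm_real, Real.norm_of_nonneg (zetaTerm_nonneg s I)]
      exact mul_le_of_le_one_left (zetaTerm_nonneg s I) (norm_charHom_le _ I)) (by
      change _ * (zetaTerm s ⊥ : ℂ) = 0
      rw [zetaTerm_bot hs, Complex.ofReal_zero, mul_zero])
  have h3 := tendsto_finsetProd Finset.univ fun c _ ↦ (h2 c).norm
  rw [tsum_mul_left]
  refine le_of_tendsto_of_tendsto h1 h3 (Filter.Eventually.of_forall fun S ↦ ?_)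
  change Real.exp (∑ q ∈ S, _) ≤ ∏ c, ‖∏ v ∈ S, _‖
  simp_rw [norm_prod]
  rw [Finset.prod_comm, Real.exp_sum]
  exact Finset.prod_le_prod (fun _ _ ↦ (Real.exp_pos _).le) fun q _ ↦ exp_le_prod_inv hψ hχ hs q

/-- Two linearly independent ray characters of order `p` cannot both vanish below almost all
degree one primes of an extension of degree at most `p`. -/
theorem false_of_independent_rayChar {L : Type*} [Field L] [NumberField L] [Algebra k L]
    (hm : m ≠ ⊥) (hm1 : m ≠ ⊤) (hψ : IsRayChar m ψ) (hχ : IsRayChar m χ)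
    (hind : ∀ i j : ZMod p, (∀ I, IsCoprime I m → i * ψ I + j * χ I = 0) → i = 0 ∧ j = 0)
    (hdeg : Module.finrank k L ≤ p)
    (hfin : {Q : HeightOneSpectrum (𝓞 L) | (Ideal.absNorm Q.asIdeal).Prime ∧
      Q.under (𝓞 k) ∉ vanishingSet m ψ χ}.Finite) : False := by
  obtain ⟨C, hC⟩ := exists_zeta_le_exp _ hfin
  have hbd (c : ZMod p × ZMod p) (hc : c ≠ 0) : ∃ C, ∀ s, 1 < s → s ≤ 2 →
      ‖∑' I, charHom (hψ.linear hχ c.1 c.2) I * (zetaTerm s I : ℂ)‖ ≤ C := by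
    have : ¬ ∀ I, IsCoprime I m → c.1 * ψ I + c.2 * χ I = 0 := fun h ↦
      hc (Prod.ext (hind _ _ h).1 (hind _ _ h).2)
    push Not at this
    obtain ⟨I, hI, hI0⟩ := this
    exact exists_norm_charHom_tsum_le hm hm1 _ hI hI0
  choose! D hD using hbd
  have hp2 : 2 ≤ p := (Fact.out : p.Prime).two_le
  have hζ0 (s : ℝ) : 0 ≤ ∑' I : Ideal (𝓞 L), zetaTerm s I := tsum_nonneg fun I ↦ zetaTerm_nonneg s I
  have key : ∀ s : ℝ, 1 < s → s ≤ 2 → (∑' I : Ideal (𝓞 L), zetaTerm s I) ^ p ≤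
      Real.exp (p * C) * (∏ c ∈ Finset.univ.erase (0 : ZMod p × ZMod p), D c) *
        ∑' I : Ideal (𝓞 k), zetaTerm s I := by
    intro s hs hs2
    set t := ∑' q : HeightOneSpectrum (𝓞 k),
      if q ∈ vanishingSet m ψ χ then zetaTerm s q.asIdeal else 0 with ht
    have ht0 : 0 ≤ t := tsum_nonneg fun q ↦ by
      split_ifs; exacts [zetaTerm_nonneg _ _, le_rfl]
    have h1 : (∑' I : Ideal (𝓞 L), zetaTerm s I) ^ p ≤ Real.exp (p * C) * Real.exp (p ^ 2 * t) := by
      refine (pow_le_pow_left₀ (hζ0 s) (hC s hs hs2) p).trans ?_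
      rw [← Real.exp_nat_mul, ← Real.exp_add, Real.exp_le_exp, ← ht]
      have : (Module.finrank k L : ℝ) ≤ p := Nat.cast_le.mpr hdeg
      have h2 := mul_le_mul_of_nonneg_left (mul_le_mul_of_nonneg_right this ht0)
        (Nat.cast_nonneg (α := ℝ) p)
      linarith
    refine h1.trans ?_
    rw [mul_assoc]
    refine mul_le_mul_of_nonneg_left ?_ (Real.exp_pos _).le
    refine (exp_le_prod_tsum hψ hχ hs hs2).trans ?_
    rw [← Finset.prod_erase_mul _ _ (Finset.mem_univ (0 : ZMod p × ZMod p))]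
    refine mul_le_mul (Finset.prod_le_prod (fun _ _ ↦ norm_nonneg _) fun c hc ↦
      hD c (Finset.ne_of_mem_erase hc) s hs hs2) ?_ (norm_nonneg _)
      (Finset.prod_nonneg fun c hc ↦
        (norm_nonneg _).trans (hD c (Finset.ne_of_mem_erase hc) s hs hs2))
    refine tsum_of_norm_bounded (summable_zetaTerm_of_le_two (K := k) hs hs2).hasSum fun I ↦ ?_
    rw [norm_mul, Complex.norm_real, Real.norm_of_nonneg (zetaTerm_nonneg s I)]
    exact mul_le_of_le_one_left (zetaTerm_nonneg s I) (norm_charHom_le _ I)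
  set E := Real.exp (p * C) * (∏ c ∈ Finset.univ.erase (0 : ZMod p × ZMod p), D c)
  have hL := (tendsto_sub_one_mul_tsum_zetaTerm (K := L)).pow p
  have hk := tendsto_sub_one_mul_tsum_zetaTerm (K := k)
  have hs1 : Filter.Tendsto (fun s : ℝ ↦ (s - 1) ^ (p - 1)) (nhdsWithin 1 (Set.Ioi 1)) (nhds 0) := by
    have : Filter.Tendsto (fun s : ℝ ↦ (s - 1) ^ (p - 1)) (nhds 1) (nhds ((1 - 1) ^ (p - 1))) :=
      Continuous.tendsto (by fun_prop) 1
    rw [sub_self, zero_pow (by omega)] at this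
    exact this.mono_left nhdsWithin_le_nhds
  have hR := (hs1.mul hk).const_mul E
  have hle : dedekindZeta_residue L ^ p ≤ E * (0 * dedekindZeta_residue k) := by
    refine le_of_tendsto_of_tendsto hL hR ?_
    filter_upwards [Ioc_mem_nhdsGT (show (1 : ℝ) < 2 by norm_num)] with s hs
    have h0 : 0 ≤ (s - 1) ^ p := pow_nonneg (by linarith [hs.1]) p
    calc ((s - 1) * ∑' I : Ideal (𝓞 L), zetaTerm s I) ^ p
        = (s - 1) ^ p * (∑' I : Ideal (𝓞 L), zetaTerm s I) ^ p := mul_pow _ _ _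
      _ ≤ (s - 1) ^ p * (E * ∑' I : Ideal (𝓞 k), zetaTerm s I) :=
          mul_le_mul_of_nonneg_left (key s hs.1 hs.2) h0
      _ = E * ((s - 1) ^ (p - 1) * ((s - 1) * ∑' I : Ideal (𝓞 k), zetaTerm s I)) := by
          rw [show p = p - 1 + 1 by omega, pow_succ, Nat.add_sub_cancel]; ring
  have := pow_pos (dedekindZeta_residue_pos L) p
  rw [zero_mul, mul_zero] at hle
  linarith

end RayChar

end ConeWeight

end

noncomputable section

namespace ConeWeight

open IsDedekindDomain NumberField
open scoped Classical Pointwise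

section Existence
set_option linter.unusedSectionVars false
variable {k : Type*} [Field k] [NumberField k] {p : ℕ} {m : Ideal (𝓞 k)}

/-- Ideals coprime to `m`. -/
def coprimeTo (m : Ideal (𝓞 k)) : Submonoid (Ideal (𝓞 k)) where
  carrier := {I | IsCoprime I m}
  one_mem' := isCoprime_one_left
  mul_mem' hI hJ := by
    rw [Set.mem_ofPred_eq] at hI hJ ⊢
    exact IsCoprime.mul_left hI hJ

lemma isCoprime_span_of_sub_one_mem {a : 𝓞 k} (ha : a - 1 ∈ m) :
    IsCoprime (Ideal.span {a}) m := by
  have h : (1 : 𝓞 k) - a ∈ m := by rw [← neg_sub]; exact m.neg_mem ha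
  refine isCoprime_span_of_sub_mem h ?_
  rw [Ideal.span_singleton_one, ← Ideal.one_eq_top]
  exact isCoprime_one_left

lemma mul_sub_one_mem {a b : 𝓞 k} (ha : a - 1 ∈ m) (hb : b - 1 ∈ m) : a * b - 1 ∈ m := by
  have := m.add_mem (m.mul_mem_left a hb) ha
  convert this using 1; ring

lemma pow_sub_one_mem {a : 𝓞 k} (ha : a - 1 ∈ m) (n : ℕ) : a ^ n - 1 ∈ m := by
  induction n with
  | zero => simp
  | succ n ih => rw [pow_succ]; exact mul_sub_one_mem ih ha

/-- Equality of ideals up to `p`-th powers and principal ideals generated by elements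
congruent to `1`. -/
def rayRel (p : ℕ) (m I J : Ideal (𝓞 k)) : Prop :=
  ∃ A B : Ideal (𝓞 k), IsCoprime A m ∧ IsCoprime B m ∧ ∃ a b : 𝓞 k, a - 1 ∈ m ∧ b - 1 ∈ m ∧
    Ideal.span {a} * I * A ^ p = Ideal.span {b} * J * B ^ p

lemma rayRel_mul {I J I' J' : Ideal (𝓞 k)} (h : rayRel p m I J) (h' : rayRel p m I' J') :
    rayRel p m (I * I') (J * J') := by
  obtain ⟨A, B, hA, hB, a, b, ha, hb, h⟩ := h
  obtain ⟨A', B', hA', hB', a', b', ha', hb', h'⟩ := h'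
  refine ⟨A * A', B * B', hA.mul_left hA', hB.mul_left hB', a * a', b * b',
    mul_sub_one_mem ha ha', mul_sub_one_mem hb hb', ?_⟩
  rw [← Ideal.span_singleton_mul_span_singleton, ← Ideal.span_singleton_mul_span_singleton]
  calc _ = (Ideal.span {a} * I * A ^ p) * (Ideal.span {a'} * I' * A' ^ p) := by ring
    _ = _ := by rw [h, h']; ring

/-- The congruence relation attached to `rayRel`. -/
def rayCon (p : ℕ) (m : Ideal (𝓞 k)) : Con (coprimeTo m) where
  r I J := rayRel p m I J
  iseqv :=
    { refl := fun I ↦ ⟨1, 1, isCoprime_one_left, isCoprime_one_left, 1, 1, by simp, by simp, rfl⟩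
      symm := fun {I J} ⟨A, B, hA, hB, a, b, ha, hb, h⟩ ↦ ⟨B, A, hB, hA, b, a, hb, ha, h.symm⟩
      trans := fun {I J K} ⟨A, B, hA, hB, a, b, ha, hb, h⟩ ⟨C, D, hC, hD, c, d, hc, hd, h'⟩ ↦ by
        refine ⟨A * C, B * D, hA.mul_left hC, hB.mul_left hD, a * c, b * d,
          mul_sub_one_mem ha hc, mul_sub_one_mem hb hd, ?_⟩
        rw [← Ideal.span_singleton_mul_span_singleton, ← Ideal.span_singleton_mul_span_singleton]
        calc _ = (Ideal.span {a} * (I : Ideal (𝓞 k)) * A ^ p) * (Ideal.span {c} * C ^ p) := by ring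
          _ = (Ideal.span {b} * B ^ p) * (Ideal.span {c} * (J : Ideal (𝓞 k)) * C ^ p) := by
            rw [h]; ring
          _ = _ := by rw [h']; ring }
  mul' h h' := rayRel_mul h h'

lemma rayCon_pow (x : (rayCon p m).Quotient) : x ^ p = 1 := by
  induction x using Con.induction_on with
  | H I =>
    change ((I ^ p : coprimeTo m) : (rayCon p m).Quotient) = ((1 : coprimeTo m) : _)
    rw [Con.eq]
    refine ⟨1, I, isCoprime_one_left, I.2, 1, 1, by simp, by simp, ?_⟩
    simp only [SubmonoidClass.coe_pow, Submonoid.coe_one, one_pow, mul_one]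

variable [Fact p.Prime]

omit [Fact p.Prime] in
lemma exists_linearMap_ne_zero (F : Type*) [Field F] {V : Type*} [AddCommGroup V] [Module F V]
    {x : V} (hx : x ≠ 0) : ∃ η : V → F, (∀ y z, η (y + z) = η y + η z) ∧ η x ≠ 0 := by
  by_contra! hc
  exact hx ((Module.forall_dual_apply_eq_zero_iff F x).mp fun φ ↦ hc φ (map_add φ))

lemma exists_hom_ne_zero {V : Type*} [AddCommGroup V] (hV : ∀ x : V, p • x = 0) {x : V}
    (hx : x ≠ 0) : ∃ η : V → ZMod p, (∀ y z, η (y + z) = η y + η z) ∧ η x ≠ 0 := by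
  let _ : Module (ZMod p) V := AddCommGroup.zmodModule hV
  exact exists_linearMap_ne_zero (ZMod p) hx

/-- The quotient by `rayCon` is a group. -/
@[reducible] def rayGroup : CommGroup (rayCon p m).Quotient :=
  { (inferInstance : CommMonoid (rayCon p m).Quotient) with
    inv := fun x ↦ x ^ (p - 1)
    inv_mul_cancel := fun x ↦ by
      change x ^ (p - 1) * x = 1
      rw [← pow_succ, Nat.sub_add_cancel (Fact.out : p.Prime).one_le, rayCon_pow] }

/-- If an ideal is nontrivial modulo `rayRel`, some ray character is nonzero on it. -/
lemma exists_isRayChar_ne_zero {I : Ideal (𝓞 k)} (hI : IsCoprime I m) (h : ¬ rayRel p m I 1) :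
    ∃ b : Ideal (𝓞 k) → ZMod p, IsRayChar m b ∧ b I ≠ 0 := by
  let cls (I : coprimeTo m) : Additive (rayCon p m).Quotient :=
    Additive.ofMul (I : (rayCon p m).Quotient)
  obtain ⟨η, hη, hne⟩ := @exists_hom_ne_zero p _ (Additive _)
    (@Additive.addCommGroup _ rayGroup) rayCon_pow (cls ⟨I, hI⟩) fun hc ↦ h <| by
    change ((⟨I, hI⟩ : coprimeTo m) : (rayCon p m).Quotient) = ((1 : coprimeTo m) : _) at hc
    rw [Con.eq] at hc
    exact hc
  refine ⟨fun J ↦ if hJ : J ∈ coprimeTo m then η (cls ⟨J, hJ⟩) else 0, ⟨fun J J' hJ hJ' ↦ ?_,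
    fun x y hx hxy ↦ ?_⟩, (dif_pos (show I ∈ coprimeTo m from hI)).trans_ne hne⟩
  · rw [dif_pos (show J ∈ coprimeTo m from hJ), dif_pos (show J' ∈ coprimeTo m from hJ'),
      dif_pos (show J * J' ∈ coprimeTo m from hJ.mul_left hJ')]
    exact hη (cls ⟨J, hJ⟩) (cls ⟨J', hJ'⟩)
  · have hy := isCoprime_span_of_sub_mem hxy hx
    rw [dif_pos (show _ ∈ coprimeTo m from hx), dif_pos (show _ ∈ coprimeTo m from hy)]
    refine congrArg η ?_
    change ((⟨_, hx⟩ : coprimeTo m) : (rayCon p m).Quotient) = ((⟨_, hy⟩ : coprimeTo m) : _)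
    rw [Con.eq]
    obtain ⟨i, hi, j, hj, hij⟩ := (Ideal.isCoprime_iff_exists).mp hx
    obtain ⟨c, rfl⟩ := Ideal.mem_span_singleton'.mp hi
    refine ⟨1, 1, isCoprime_one_left, isCoprime_one_left, c * y, c * x, ?_, ?_, ?_⟩
    · have := m.neg_mem (m.add_mem (m.mul_mem_left c hxy) hj)
      convert this using 1; rw [← hij]; ring
    · have := m.neg_mem hj
      convert this using 1; rw [← hij]; ring
    · rw [Ideal.span_singleton_mul_span_singleton, Ideal.span_singleton_mul_span_singleton,
        mul_right_comm]

variable {G : Type*} [Group G] [Fintype G] [MulSemiringAction G (𝓞 k)]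

lemma isCoprime_smul (hm : ∀ g : G, g • m = m) (g : G) {I : Ideal (𝓞 k)} (hI : IsCoprime I m) :
    IsCoprime (g • I) m := by
  obtain ⟨a, b, h⟩ := hI
  refine ⟨g • a, g • b, ?_⟩
  have := congrArg (g • ·) h
  simp only [smul_add, smul_mul', smul_one, hm] at this
  exact this

lemma smul_span_singleton (g : G) (x : 𝓞 k) : g • Ideal.span {x} = Ideal.span {g • x} := by
  rw [Ideal.smul_closure, Set.smul_set_singleton]

/-- A group ring element acting on ideals. -/
def twist (w : G → ℕ) (I : Ideal (𝓞 k)) : Ideal (𝓞 k) := ∏ g, (g • I) ^ w g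

/-- A group ring element acting on integers. -/
def twistElem (w : G → ℕ) (x : 𝓞 k) : 𝓞 k := ∏ g, (g • x) ^ w g

lemma twist_mul (w : G → ℕ) (I J : Ideal (𝓞 k)) : twist w (I * J) = twist w I * twist w J := by
  simp_rw [twist, smul_mul', mul_pow, Finset.prod_mul_distrib]

lemma twist_pow (w : G → ℕ) (I : Ideal (𝓞 k)) (n : ℕ) : twist w (I ^ n) = twist w I ^ n := by
  rw [twist, twist, ← Finset.prod_pow]
  exact Finset.prod_congr rfl fun g _ ↦ by rw [smul_pow']; ring

lemma twist_span (w : G → ℕ) (x : 𝓞 k) :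
    twist w (Ideal.span {x}) = Ideal.span {twistElem w x} := by
  simp_rw [twist, twistElem, smul_span_singleton, Ideal.span_singleton_pow,
    Ideal.prod_span_singleton]

lemma isCoprime_twist (hm : ∀ g : G, g • m = m) (w : G → ℕ) {I : Ideal (𝓞 k)}
    (hI : IsCoprime I m) : IsCoprime (twist w I) m :=
  IsCoprime.prod_left fun g _ ↦ (isCoprime_smul hm g hI).pow_left

lemma twistElem_sub_one_mem (hm : ∀ g : G, g • m = m) (w : G → ℕ) {a : 𝓞 k} (ha : a - 1 ∈ m) :
    twistElem w a - 1 ∈ m := by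
  refine Finset.prod_induction _ (fun x ↦ x - 1 ∈ m) (fun _ _ ↦ mul_sub_one_mem) (by simp)
    fun g _ ↦ pow_sub_one_mem ?_ _
  have := Ideal.smul_mem_pointwise_smul g _ _ ha
  rwa [hm, smul_sub, smul_one] at this

/-- If the twist of every ideal is trivial, then iterated twists are trivial up to higher
powers. -/
lemma exists_iterate_twist (hm : ∀ g : G, g • m = m) (w : G → ℕ)
    (h : ∀ I, IsCoprime I m → rayRel p m (twist w I) 1) (j : ℕ) (I : Ideal (𝓞 k))
    (hI : IsCoprime I m) : rayRel (p ^ j) m ((twist w)^[j] I) 1 := by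
  induction j with
  | zero => exact ⟨1, I, isCoprime_one_left, hI, 1, 1, by simp, by simp, by simp⟩
  | succ j ih =>
    obtain ⟨A, B, hA, hB, a, b, ha, hb, e⟩ := ih
    obtain ⟨C, D, hC, hD, c, d, hc, hd, e1⟩ := h A hA
    obtain ⟨E, F, hE, hF, u, v, hu, hv, e2⟩ := h B hB
    have e0 := congrArg (twist w) e
    rw [mul_one, twist_mul, twist_mul, twist_mul, twist_pow, twist_pow, twist_span, twist_span,
      ← Function.iterate_succ_apply' (twist w)] at e0
    set X := (twist w)^[j + 1] I
    set P := p ^ j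
    refine ⟨D * E, F * C, hD.mul_left hE, hF.mul_left hC,
      twistElem w a * (u ^ P * d ^ P), twistElem w b * (c ^ P * v ^ P),
      mul_sub_one_mem (twistElem_sub_one_mem hm w ha)
        (mul_sub_one_mem (pow_sub_one_mem hu _) (pow_sub_one_mem hd _)),
      mul_sub_one_mem (twistElem_sub_one_mem hm w hb)
        (mul_sub_one_mem (pow_sub_one_mem hc _) (pow_sub_one_mem hv _)), ?_⟩
    simp_rw [← Ideal.span_singleton_mul_span_singleton, ← Ideal.span_singleton_pow]
    rw [mul_one] at e1 e2
    have hP : p ^ (j + 1) = p * P := by rw [pow_succ, mul_comm]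
    rw [hP]
    calc Ideal.span {twistElem w a} * (Ideal.span {u} ^ P * Ideal.span {d} ^ P) * X *
          (D * E) ^ (p * P)
        = Ideal.span {twistElem w a} * X * (Ideal.span {d} * D ^ p) ^ P *
            (Ideal.span {u} * E ^ p) ^ P := by rw [pow_mul]; ring
      _ = Ideal.span {twistElem w a} * X * (Ideal.span {c} * twist w A * C ^ p) ^ P *
            (Ideal.span {u} * E ^ p) ^ P := by rw [e1]
      _ = (Ideal.span {twistElem w a} * X * twist w A ^ P) * (Ideal.span {c} * C ^ p) ^ P *
            (Ideal.span {u} * E ^ p) ^ P := by ring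
      _ = (Ideal.span {twistElem w b} * twist w B ^ P) * (Ideal.span {c} * C ^ p) ^ P *
            (Ideal.span {u} * E ^ p) ^ P := by rw [e0]
      _ = Ideal.span {twistElem w b} * (Ideal.span {u} * twist w B * E ^ p) ^ P *
            (Ideal.span {c} * C ^ p) ^ P := by ring
      _ = Ideal.span {twistElem w b} * (Ideal.span {v} * F ^ p) ^ P *
            (Ideal.span {c} * C ^ p) ^ P := by rw [e2]
      _ = _ := by rw [mul_one, pow_mul]; ring

/-- Some power of an ideal coprime to `m` is generated by an element congruent to `1`. -/
lemma exists_pow_eq_span (hm0 : m ≠ ⊥) : ∃ n : ℕ, n ≠ 0 ∧ ∀ I, IsCoprime I m → I ≠ ⊥ →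
    ∃ a : 𝓞 k, a - 1 ∈ m ∧ I ^ n = Ideal.span {a} := by
  have := Ideal.finiteQuotientOfFreeOfNeBot m hm0
  refine ⟨classNumber k * Nat.card (𝓞 k ⧸ m)ˣ, mul_ne_zero (classNumber_pos k).ne'
    Nat.card_pos.ne', fun I hI hI0 ↦ ?_⟩
  have h1 : (I ^ classNumber k).IsPrincipal := by
    have hI' : I ∈ nonZeroDivisors (Ideal (𝓞 k)) := mem_nonZeroDivisors_of_ne_zero hI0
    rw [← ClassGroup.mk0_eq_one_iff (pow_mem hI' _), ← SubmonoidClass.mk_pow I hI', map_pow]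
    exact pow_card_eq_one
  obtain ⟨a, ha⟩ := h1
  change I ^ classNumber k = Ideal.span {a} at ha
  refine ⟨a ^ Nat.card (𝓞 k ⧸ m)ˣ, ?_, by rw [pow_mul, ha, Ideal.span_singleton_pow]⟩
  have hc : IsCoprime (Ideal.span {a}) m := ha ▸ hI.pow_left
  have hu : IsUnit (Ideal.Quotient.mk m a) := by
    obtain ⟨i, hi, j, hj, hij⟩ := Ideal.isCoprime_iff_exists.mp hc
    obtain ⟨c, rfl⟩ := Ideal.mem_span_singleton'.mp hi
    refine IsUnit.of_mul_eq_one (Ideal.Quotient.mk m c) ?_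
    rw [← map_mul, ← map_one (Ideal.Quotient.mk m), Ideal.Quotient.eq, ← hij]
    have := m.neg_mem hj
    convert this using 1; ring
  obtain ⟨u, hu⟩ := hu
  rw [← Ideal.Quotient.eq, map_pow, map_one, ← hu, ← Units.val_pow_eq_pow_val, pow_card_eq_one',
    Units.val_one]

end Existence

section Existence
set_option linter.unusedSectionVars false
variable {k : Type*} [Field k] [NumberField k] {p : ℕ} {m : Ideal (𝓞 k)}

namespace IsRayChar
variable {a : Ideal (𝓞 k) → ZMod p}

lemma map_pow (h : IsRayChar m a) {I : Ideal (𝓞 k)} (hI : IsCoprime I m) (n : ℕ) :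
    a (I ^ n) = n * a I := by
  induction n with
  | zero => rw [pow_zero, h.map_one, Nat.cast_zero, zero_mul]
  | succ n ih => rw [pow_succ, h.map_mul _ _ hI.pow_left hI, ih]; push_cast; ring

lemma map_prod (h : IsRayChar m a) {ι : Type*} (s : Finset ι) (f : ι → Ideal (𝓞 k))
    (hf : ∀ i ∈ s, IsCoprime (f i) m) : a (∏ i ∈ s, f i) = ∑ i ∈ s, a (f i) := by
  induction s using Finset.induction_on with
  | empty => rw [Finset.prod_empty, Finset.sum_empty, h.map_one]
  | insert i s hi ih =>
    rw [Finset.prod_insert hi, Finset.sum_insert hi, h.map_mul _ _ (hf i (Finset.mem_insert_self _ _))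
      (IsCoprime.prod_left fun j hj ↦ hf j (Finset.mem_insert_of_mem hj)),
      ih fun j hj ↦ hf j (Finset.mem_insert_of_mem hj)]

end IsRayChar

/-- A homomorphism on elements coprime to `m`, depending only on the class modulo `m`. -/
structure IsModChar (m : Ideal (𝓞 k)) (f : 𝓞 k → ZMod p) : Prop where
  map_mul : ∀ x y, IsCoprime (Ideal.span {x}) m → IsCoprime (Ideal.span {y}) m →
    f (x * y) = f x + f y
  map_congr : ∀ x y, IsCoprime (Ideal.span {x}) m → x - y ∈ m → f x = f y

lemma isCoprime_span_mul {x y : 𝓞 k} (hx : IsCoprime (Ideal.span {x}) m)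
    (hy : IsCoprime (Ideal.span {y}) m) : IsCoprime (Ideal.span {x * y}) m := by
  rw [← Ideal.span_singleton_mul_span_singleton]; exact hx.mul_left hy

lemma isCoprime_span_pow {x : 𝓞 k} (hx : IsCoprime (Ideal.span {x}) m) (n : ℕ) :
    IsCoprime (Ideal.span {x ^ n}) m := by
  rw [← Ideal.span_singleton_pow]; exact hx.pow_left

lemma isCoprime_span_one : IsCoprime (Ideal.span {(1 : 𝓞 k)}) m := by
  rw [Ideal.span_singleton_one, ← Ideal.one_eq_top]
  exact isCoprime_one_left

lemma isCoprime_span_unit (u : (𝓞 k)ˣ) : IsCoprime (Ideal.span {(u : 𝓞 k)}) m := by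
  rw [Ideal.span_singleton_eq_top.mpr u.isUnit, ← Ideal.one_eq_top]
  exact isCoprime_one_left

lemma isCoprime_span_prod {ι : Type*} (s : Finset ι) (f : ι → 𝓞 k)
    (hf : ∀ i ∈ s, IsCoprime (Ideal.span {f i}) m) : IsCoprime (Ideal.span {∏ i ∈ s, f i}) m := by
  rw [← Ideal.prod_span_singleton]; exact IsCoprime.prod_left hf

namespace IsModChar
variable {f : 𝓞 k → ZMod p}

lemma map_one (h : IsModChar m f) : f 1 = 0 := by
  have := h.map_mul 1 1 isCoprime_span_one isCoprime_span_one
  rwa [mul_one, left_eq_add] at this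

lemma map_pow (h : IsModChar m f) {x : 𝓞 k} (hx : IsCoprime (Ideal.span {x}) m) (n : ℕ) :
    f (x ^ n) = n * f x := by
  induction n with
  | zero => rw [pow_zero, h.map_one, Nat.cast_zero, zero_mul]
  | succ n ih => rw [pow_succ, h.map_mul _ _ (isCoprime_span_pow hx n) hx, ih]; push_cast; ring

lemma map_prod (h : IsModChar m f) {ι : Type*} (s : Finset ι) (x : ι → 𝓞 k)
    (hf : ∀ i ∈ s, IsCoprime (Ideal.span {x i}) m) : f (∏ i ∈ s, x i) = ∑ i ∈ s, f (x i) := by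
  induction s using Finset.induction_on with
  | empty => rw [Finset.prod_empty, Finset.sum_empty, h.map_one]
  | insert i s hi ih =>
    rw [Finset.prod_insert hi, Finset.sum_insert hi, h.map_mul _ _ (hf i (Finset.mem_insert_self _ _))
      (isCoprime_span_prod _ _ fun j hj ↦ hf j (Finset.mem_insert_of_mem hj)),
      ih fun j hj ↦ hf j (Finset.mem_insert_of_mem hj)]

end IsModChar

variable [Fact p.Prime] {G : Type*} [Group G] [Fintype G] [MulSemiringAction G (𝓞 k)]

lemma isCoprime_span_smul (hm : ∀ g : G, g • m = m) (g : G) {x : 𝓞 k}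
    (hx : IsCoprime (Ideal.span {x}) m) : IsCoprime (Ideal.span {g • x}) m := by
  rw [← smul_span_singleton]; exact isCoprime_smul hm g hx

/-- An equivariant character of `(𝓞 k / m)ˣ` killing the units gives rise to an equivariant
ray character. -/
theorem exists_equivariant_rayChar (hm0 : m ≠ ⊥) (hm1 : m ≠ ⊤) (hm : ∀ g : G, g • m = m)
    (ω : G →* (ZMod p)ˣ) (hG : (Fintype.card G : ZMod p) ≠ 0) {f : 𝓞 k → ZMod p}
    (hf : IsModChar m f) (hunit : ∀ u : (𝓞 k)ˣ, f u = 0)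
    (hfω : ∀ g x, IsCoprime (Ideal.span {x}) m → f (g • x) = ω g * f x)
    {y : 𝓞 k} (hy : IsCoprime (Ideal.span {y}) m) (hy0 : f y ≠ 0) :
    ∃ a : Ideal (𝓞 k) → ZMod p, IsRayChar m a ∧
      (∀ g I, IsCoprime I m → a (g • I) = ω g * a I) ∧ ∃ I, IsCoprime I m ∧ a I ≠ 0 := by
  let w : G → ℕ := fun g ↦ (ω g⁻¹ : ZMod p).val
  have hw (g : G) : (w g : ZMod p) = ω g⁻¹ := ZMod.natCast_zmod_val _
  have hcop (j : ℕ) : IsCoprime (Ideal.span {(twistElem w)^[j] y}) m := by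
    induction j with
    | zero => exact hy
    | succ j ih =>
      rw [Function.iterate_succ_apply', ← twist_span]
      exact isCoprime_twist hm w ih
  have htw {x : 𝓞 k} (hx : IsCoprime (Ideal.span {x}) m) :
      f (twistElem w x) = Fintype.card G * f x := by
    rw [twistElem, hf.map_prod _ _ fun g _ ↦ isCoprime_span_pow (isCoprime_span_smul hm g hx) _]
    rw [Finset.sum_congr rfl (g := fun _ ↦ f x), Finset.sum_const, nsmul_eq_mul, Finset.card_univ]
    intro g _
    rw [hf.map_pow (isCoprime_span_smul hm g hx), hw, hfω g x hx, ← mul_assoc, map_inv,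
      Units.inv_mul, one_mul]
  have hiter (j : ℕ) : f ((twistElem w)^[j] y) = (Fintype.card G : ZMod p) ^ j * f y := by
    induction j with
    | zero => simp
    | succ j ih => rw [Function.iterate_succ_apply', htw (hcop j), ih, pow_succ]; ring
  have hspan (j : ℕ) : (twist w)^[j] (Ideal.span {y}) = Ideal.span {(twistElem w)^[j] y} := by
    induction j with
    | zero => rfl
    | succ j ih => rw [Function.iterate_succ_apply', Function.iterate_succ_apply', ih, twist_span]
  obtain ⟨r, hr, hr1⟩ : ∃ r, IsCoprime r m ∧ ¬ rayRel p m (twist w r) 1 := by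
    by_contra! hall
    obtain ⟨n, hn0, hn⟩ := exists_pow_eq_span hm0
    obtain ⟨j, n', hpn', hnn'⟩ := Nat.exists_eq_pow_mul_and_not_dvd hn0 p
      (Fact.out : p.Prime).ne_one
    obtain ⟨A, B, hA, hB, a, b, ha, hb, e⟩ := exists_iterate_twist hm w hall j _ hy
    rw [hspan, mul_one] at e
    have hne {I : Ideal (𝓞 k)} (hI : IsCoprime I m) : I ≠ ⊥ := by
      rintro rfl
      rw [Ideal.isCoprime_iff_sup_eq, bot_sup_eq] at hI
      exact hm1 hI
    obtain ⟨α, hα, hAα⟩ := hn A hA (hne hA)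
    obtain ⟨β, hβ, hBβ⟩ := hn B hB (hne hB)
    have e' := congrArg (· ^ n') e
    simp only [mul_pow, ← pow_mul, ← hnn', hAα, hBβ, Ideal.span_singleton_pow,
      Ideal.span_singleton_mul_span_singleton] at e'
    rw [Ideal.span_singleton_eq_span_singleton] at e'
    obtain ⟨u, hu⟩ := e'
    have hone {c : 𝓞 k} (hc : c - 1 ∈ m) : f c = 0 := by
      rw [hf.map_congr c 1 (isCoprime_span_of_sub_one_mem hc) hc, hf.map_one]
    have c1 := isCoprime_span_pow (isCoprime_span_of_sub_one_mem ha) n'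
    have c2 := isCoprime_span_pow (hcop j) n'
    have c3 := isCoprime_span_of_sub_one_mem hα
    have e2 := congrArg f hu
    rw [hf.map_mul _ _ (isCoprime_span_mul (isCoprime_span_mul c1 c2) c3) (isCoprime_span_unit u),
      hf.map_mul _ _ (isCoprime_span_mul c1 c2) c3, hf.map_mul _ _ c1 c2,
      hf.map_mul _ _ (isCoprime_span_pow (isCoprime_span_of_sub_one_mem hb) n')
        (isCoprime_span_of_sub_one_mem hβ), hunit, hone hα, hone hβ,
      hone (pow_sub_one_mem ha n'), hone (pow_sub_one_mem hb n'), hf.map_pow (hcop j), hiter] at e2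
    simp only [zero_add, add_zero, mul_eq_zero] at e2
    rcases e2 with e2 | e2 | e2
    · exact hpn' ((ZMod.natCast_eq_zero_iff _ _).mp e2)
    · exact hG (eq_zero_of_pow_eq_zero e2)
    · exact hy0 e2
  obtain ⟨b, hb, hb0⟩ := exists_isRayChar_ne_zero (isCoprime_twist hm w hr) hr1
  refine ⟨fun I ↦ ∑ g : G, (ω g⁻¹ : ZMod p) * b (g • I), ⟨fun I J hI hJ ↦ ?_, fun x z hx hxz ↦ ?_⟩,
    fun g I hI ↦ ?_, r, hr, ?_⟩
  · rw [← Finset.sum_add_distrib]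
    refine Finset.sum_congr rfl fun g _ ↦ ?_
    rw [smul_mul', hb.map_mul _ _ (isCoprime_smul hm g hI) (isCoprime_smul hm g hJ), mul_add]
  · refine Finset.sum_congr rfl fun g _ ↦ ?_
    rw [smul_span_singleton, smul_span_singleton,
      hb.map_span (g • x) (g • z) (isCoprime_span_smul hm g hx)]
    have := Ideal.smul_mem_pointwise_smul g _ _ hxz
    rwa [hm, smul_sub] at this
  · rw [Finset.mul_sum]
    refine Fintype.sum_equiv (Equiv.mulRight g) _ _ fun h ↦ ?_
    rw [Equiv.coe_mulRight, mul_smul, mul_inv_rev, map_mul, Units.val_mul, ← mul_assoc, ← mul_assoc,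
      map_inv ω g, Units.mul_inv, one_mul]
  · rw [twist, hb.map_prod _ _ fun g _ ↦ (isCoprime_smul hm g hr).pow_left] at hb0
    convert hb0 using 2 with g
    rw [hb.map_pow (isCoprime_smul hm g hr), hw]

end Existence

section Cyclotomic
set_option linter.unusedSectionVars false
variable {p : ℕ} [Fact p.Prime] {k : Type*} [Field k] [NumberField k]
  [IsCyclotomicExtension {p} ℚ k] {z : 𝓞 k} (hz : IsPrimitiveRoot z p)

include hz in
lemma isPrimitiveRoot_coe : IsPrimitiveRoot (z : k) p :=
  hz.map_of_injective RingOfIntegers.coe_injective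

include hz in
lemma ringHom_ext_of_root {R : Type*} [Ring R] {f g : 𝓞 k →+* R} (h : f z = g z) : f = g := by
  have h1 : f.toIntAlgHom = g.toIntAlgHom := by
    refine (isPrimitiveRoot_coe hz).integralPowerBasis.algHom_ext ?_
    rw [IsPrimitiveRoot.integralPowerBasis_gen, IsPrimitiveRoot.toInteger_coe]
    exact h
  ext x
  exact DFunLike.congr_fun h1 x

include hz in
lemma exists_ringHom_of_sum_eq_zero {R : Type*} [CommRing R] (x : R)
    (hx : ∑ i ∈ Finset.range p, x ^ i = 0) : ∃ f : 𝓞 k →+* R, f z = x := by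
  have hz' := isPrimitiveRoot_coe hz
  have hmin : minpoly ℤ hz'.integralPowerBasis.gen = Polynomial.cyclotomic p ℤ := by
    rw [IsPrimitiveRoot.integralPowerBasis_gen, IsPrimitiveRoot.toInteger_coe,
      Polynomial.cyclotomic_eq_minpoly hz' (Fact.out : p.Prime).pos, RingOfIntegers.minpoly_coe]
  have h0 : Polynomial.aeval x (minpoly ℤ hz'.integralPowerBasis.gen) = 0 := by
    rw [hmin, Polynomial.cyclotomic_prime]
    simpa using hx
  refine ⟨(hz'.integralPowerBasis.lift x h0).toRingHom, ?_⟩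
  have := hz'.integralPowerBasis.lift_gen x h0
  rwa [IsPrimitiveRoot.integralPowerBasis_gen, IsPrimitiveRoot.toInteger_coe] at this

/-- The cyclotomic character. -/
def cyc (p : ℕ) [Fact p.Prime] (k : Type*) [Field k] [NumberField k]
    [IsCyclotomicExtension {p} ℚ k] : (k ≃ₐ[ℚ] k) ≃* (ZMod p)ˣ :=
  IsCyclotomicExtension.Rat.galEquivZMod p k

include hz in
lemma smul_root (g : k ≃ₐ[ℚ] k) : g • z = z ^ (cyc p k g : ZMod p).val :=
  IsCyclotomicExtension.Rat.galEquivZMod_smul_of_pow_eq p k g hz.pow_eq_one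

include hz in
lemma smul_root_eq (g : k ≃ₐ[ℚ] k) {t : ℕ} (ht : (cyc p k g : ZMod p) = t) : g • z = z ^ t := by
  rw [smul_root hz, ht, ZMod.val_natCast, ← pow_mod_orderOf z t, ← hz.eq_orderOf]

/-- Complex conjugation. -/
def conj (p : ℕ) [Fact p.Prime] (k : Type*) [Field k] [NumberField k]
    [IsCyclotomicExtension {p} ℚ k] : k ≃ₐ[ℚ] k := (cyc p k).symm (-1)

@[simp] lemma cyc_conj : cyc p k (conj p k) = -1 := (cyc p k).apply_symm_apply _

lemma conj_mul_conj : conj p k * conj p k = 1 := by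
  rw [conj, ← map_mul, neg_mul_neg, one_mul, map_one]

lemma conj_smul_conj_smul (x : 𝓞 k) : conj p k • conj p k • x = x := by
  rw [smul_smul, conj_mul_conj, one_smul]

include hz in
lemma conj_root_mul : conj p k • z * z = 1 := by
  have hp : 1 ≤ p := (Fact.out : p.Prime).one_le
  rw [smul_root_eq hz (conj p k) (t := p - 1) (by rw [cyc_conj, Nat.cast_sub hp]; simp), ← pow_succ,
    Nat.sub_add_cancel hp, hz.pow_eq_one]

include hz in
lemma conj_compl (φ : k →+* ℂ) (x : 𝓞 k) :
    φ ((conj p k • x : 𝓞 k) : k) = starRingEnd ℂ (φ (x : k)) := by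
  have : (φ.comp (algebraMap (𝓞 k) k)).comp (MulSemiringAction.toRingHom _ (𝓞 k) (conj p k)) =
      (starRingEnd ℂ).comp (φ.comp (algebraMap (𝓞 k) k)) := by
    apply ringHom_ext_of_root hz
    change φ ((conj p k • z : 𝓞 k) : k) = starRingEnd ℂ (φ (z : k))
    have h1 : φ ((conj p k • z : 𝓞 k) : k) * φ (z : k) = 1 := by
      rw [← map_mul, ← map_mul, conj_root_mul hz, map_one, map_one]
    rw [eq_inv_of_mul_eq_one_left h1, Complex.inv_eq_conj]
    exact (((isPrimitiveRoot_coe hz).map_of_injective φ.injective).norm'_eq_one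
      (Fact.out : p.Prime).ne_zero)
  exact DFunLike.congr_fun this x

include hz in
/-- A unit is a root of unity times its complex conjugate. -/
lemma unit_eq_root_mul_conj (hp2 : p ≠ 2) (u : (𝓞 k)ˣ) : ∃ r : ℕ,
    (u : 𝓞 k) = z ^ r * conj p k • (u : 𝓞 k) ∨ (u : 𝓞 k) = -z ^ r * conj p k • (u : 𝓞 k) := by
  obtain ⟨w, hw⟩ : ∃ w : (𝓞 k)ˣ, (u : 𝓞 k) = w * conj p k • (u : 𝓞 k) := by
    set v : (𝓞 k)ˣ := Units.map (MulSemiringAction.toRingHom _ (𝓞 k) (conj p k)) u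
    exact ⟨u * v⁻¹, (congrArg Units.val (inv_mul_cancel_right u v)).symm⟩
  have hu0 (φ : k →+* ℂ) : φ ((u : 𝓞 k) : k) ≠ 0 := by
    simp
  have hfin : ∃ (n : ℕ) (_ : 0 < n), ((w : 𝓞 k) : k) ^ n = 1 := by
    refine NumberField.Embeddings.pow_eq_one_of_norm_eq_one k ℂ (w : 𝓞 k).2 fun φ ↦ ?_
    have h := congrArg (fun x : 𝓞 k ↦ ‖φ (x : k)‖) hw
    simp only [map_mul, norm_mul, conj_compl hz, RCLike.norm_conj] at h
    exact (mul_eq_right₀ (norm_ne_zero_iff.mpr (hu0 φ))).mp h.symm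
  obtain ⟨n, hn, hn1⟩ := hfin
  obtain ⟨r, -, hr⟩ := (isPrimitiveRoot_coe hz).exists_pow_or_neg_mul_pow_of_isOfFinOrder
    ((Fact.out : p.Prime).odd_of_ne_two hp2) (isOfFinOrder_iff_pow_eq_one.2 ⟨n, hn, hn1⟩)
  refine ⟨r, hr.imp (fun h ↦ ?_) fun h ↦ ?_⟩
  · have : (w : 𝓞 k) = z ^ r := by ext; simpa using h
    rwa [this] at hw
  · have : (w : 𝓞 k) = -z ^ r := by ext; simpa using h
    rwa [this] at hw

end Cyclotomic

section ModChar
set_option linter.unusedSectionVars false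
variable {p : ℕ} [Fact p.Prime] {k : Type*} [Field k] [NumberField k] {m m' : Ideal (𝓞 k)}

/-- A finite abelian group of order divisible by `p` has a nontrivial additive character
with values in `ZMod p`. -/
lemma exists_log {A : Type*} [CommGroup A] [Finite A] (h : p ∣ Nat.card A) :
    ∃ η : A → ZMod p, (∀ x y, η (x * y) = η x + η y) ∧ ∃ x, η x ≠ 0 := by
  obtain ⟨a, ha⟩ := exists_prime_orderOf_dvd_card' p h
  set R := (powMonoidHom p : A →* A).range
  obtain ⟨x, hx⟩ : ∃ x : A, x ∉ R := by
    by_contra! hc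
    have hinj := Finite.injective_iff_surjective.mpr (fun x ↦ hc x : Function.Surjective
      (powMonoidHom p : A →* A))
    have : a = 1 := hinj (by simp [powMonoidHom_apply, ← ha, pow_orderOf_eq_one])
    rw [this, orderOf_one] at ha
    exact (Fact.out : p.Prime).ne_one ha.symm
  obtain ⟨η, hη, hη0⟩ := exists_hom_ne_zero (p := p) (V := Additive (A ⧸ R))
    (x := Additive.ofMul (x : A ⧸ R)) (fun y ↦ by
      obtain ⟨y, rfl⟩ := Additive.ofMul.surjective y
      obtain ⟨y, rfl⟩ := QuotientGroup.mk_surjective y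
      exact (QuotientGroup.eq_one_iff _).mpr (show y ^ p ∈ R from ⟨y, rfl⟩))
    (fun h0 ↦ hx ((QuotientGroup.eq_one_iff x).mp h0))
  exact ⟨fun y ↦ η (Additive.ofMul (y : A ⧸ R)), fun y y' ↦
    hη (Additive.ofMul (y : A ⧸ R)) (Additive.ofMul (y' : A ⧸ R)), x, hη0⟩

lemma isCoprime_span_iff_isUnit {x : 𝓞 k} :
    IsCoprime (Ideal.span {x}) m ↔ IsUnit (Ideal.Quotient.mk m x) := by
  refine ⟨fun hc ↦ ?_, fun h ↦ ?_⟩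
  · obtain ⟨i, hi, j, hj, hij⟩ := Ideal.isCoprime_iff_exists.mp hc
    obtain ⟨c, rfl⟩ := Ideal.mem_span_singleton'.mp hi
    refine IsUnit.of_mul_eq_one (Ideal.Quotient.mk m c) ?_
    rw [← map_mul, ← map_one (Ideal.Quotient.mk m), Ideal.Quotient.eq, ← hij]
    have := m.neg_mem hj
    convert this using 1; ring
  · obtain ⟨b, hb⟩ := h.exists_right_inv
    obtain ⟨b, rfl⟩ := Ideal.Quotient.mk_surjective b
    rw [← map_mul, ← map_one (Ideal.Quotient.mk m), Ideal.Quotient.eq] at hb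
    have := isCoprime_span_of_sub_one_mem hb
    rw [← Ideal.span_singleton_mul_span_singleton] at this
    exact this.of_mul_left_left

lemma exists_isModChar (hm : m ≠ ⊥) (h : p ∣ Nat.card (𝓞 k ⧸ m)ˣ) :
    ∃ f : 𝓞 k → ZMod p, IsModChar m f ∧ ∃ x, IsCoprime (Ideal.span {x}) m ∧ f x ≠ 0 := by
  have := Ideal.finiteQuotientOfFreeOfNeBot m hm
  obtain ⟨η, hη, u, hu⟩ := exists_log h
  refine ⟨fun x ↦ if h : IsUnit (Ideal.Quotient.mk m x) then η h.unit else 0,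
    ⟨fun x y hx hy ↦ ?_, fun x y hx hxy ↦ ?_⟩, ?_⟩
  · have hxy := isCoprime_span_mul hx hy
    rw [isCoprime_span_iff_isUnit] at hx hy hxy
    rw [dif_pos hx, dif_pos hy, dif_pos hxy, ← hη]
    congr 1
    ext
    simp
  · have : Ideal.Quotient.mk m x = Ideal.Quotient.mk m y := Ideal.Quotient.eq.mpr hxy
    simp only [this]
  · obtain ⟨x, hx⟩ := Ideal.Quotient.mk_surjective (u : 𝓞 k ⧸ m)
    have hxu : IsUnit (Ideal.Quotient.mk m x) := hx ▸ u.isUnit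
    refine ⟨x, isCoprime_span_iff_isUnit.mpr hxu, ?_⟩
    refine (dif_pos hxu).trans_ne ?_
    convert hu
    ext
    simpa

namespace IsModChar
variable {f f' : 𝓞 k → ZMod p}

lemma mono (h : IsModChar m f) (hm : m' ≤ m) : IsModChar m' f :=
  ⟨fun x y hx hy ↦ h.map_mul x y (isCoprime_of_le hm hx) (isCoprime_of_le hm hy),
    fun x y hx hxy ↦ h.map_congr x y (isCoprime_of_le hm hx) (hm hxy)⟩

lemma linear (h : IsModChar m f) (h' : IsModChar m f') (i : ZMod p) :
    IsModChar m fun x ↦ f x - i * f' x :=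
  ⟨fun x y hx hy ↦ by rw [h.map_mul x y hx hy, h'.map_mul x y hx hy]; ring,
    fun x y hx hxy ↦ by rw [h.map_congr x y hx hxy, h'.map_congr x y hx hxy]⟩

lemma eq_zero_of_sub_one_mem (h : IsModChar m f) {x : 𝓞 k} (hx : x - 1 ∈ m) : f x = 0 := by
  rw [h.map_congr x 1 (isCoprime_span_of_sub_one_mem hx) hx, h.map_one]

end IsModChar

variable {G : Type*} [Group G] [Fintype G] [MulSemiringAction G (𝓞 k)]

/-- Averaging over `G` against a character of `G`. -/
def equiAverage (χ : G →* (ZMod p)ˣ) (f : 𝓞 k → ZMod p) (x : 𝓞 k) : ZMod p :=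
  ∑ g : G, (χ g⁻¹ : ZMod p) * f (g • x)

lemma isModChar_equiAverage (χ : G →* (ZMod p)ˣ) {f : 𝓞 k → ZMod p} (hf : IsModChar m f)
    (hm' : ∀ g : G, g • m' = m') (hm : m' ≤ m) : IsModChar m' (equiAverage χ f) := by
  refine ⟨fun x y hx hy ↦ ?_, fun x y hx hxy ↦ ?_⟩
  · rw [equiAverage, equiAverage, equiAverage, ← Finset.sum_add_distrib]
    refine Finset.sum_congr rfl fun g _ ↦ ?_
    rw [smul_mul', (hf.mono hm).map_mul _ _ (isCoprime_span_smul hm' g hx)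
      (isCoprime_span_smul hm' g hy), mul_add]
  · refine Finset.sum_congr rfl fun g _ ↦ ?_
    rw [(hf.mono hm).map_congr _ (g • y) (isCoprime_span_smul hm' g hx)]
    have := Ideal.smul_mem_pointwise_smul g _ _ hxy
    rwa [hm', smul_sub] at this

lemma equiAverage_smul (χ : G →* (ZMod p)ˣ) (f : 𝓞 k → ZMod p) (g : G) (x : 𝓞 k) :
    equiAverage χ f (g • x) = χ g * equiAverage χ f x := by
  rw [equiAverage, equiAverage, Finset.mul_sum]
  refine Fintype.sum_equiv (Equiv.mulRight g) _ _ fun h ↦ ?_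
  rw [Equiv.coe_mulRight, mul_smul, mul_inv_rev, map_mul, Units.val_mul, ← mul_assoc,
    ← mul_assoc, map_inv χ g,
    Units.mul_inv, one_mul]

/-- The largest `G`-stable ideal contained in `v`. -/
def core (G : Type*) [Group G] [MulSemiringAction G (𝓞 k)] (v : Ideal (𝓞 k)) : Ideal (𝓞 k) :=
  ⨅ g : G, g • v

variable {v : Ideal (𝓞 k)}

lemma mem_core {x : 𝓞 k} : x ∈ core G v ↔ ∀ g : G, x ∈ g • v := by
  simp [core]

lemma core_le : core G v ≤ v := fun x hx ↦ by simpa using mem_core.mp hx (1 : G)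

lemma smul_core (g : G) : g • core G v = core G v := by
  ext x
  rw [Ideal.mem_pointwise_smul_iff_inv_smul_mem, mem_core, mem_core]
  refine ⟨fun h h' ↦ ?_, fun h h' ↦ ?_⟩
  · have := h (g⁻¹ * h')
    rwa [mul_smul, Ideal.smul_mem_pointwise_smul_iff] at this
  · have := h (g * h')
    rwa [← Ideal.smul_mem_pointwise_smul_iff (a := g⁻¹), ← mul_smul, inv_mul_cancel_left] at this

lemma isCoprime_core {I : Ideal (𝓞 k)} (h : ∀ g : G, IsCoprime I (g • v)) :
    IsCoprime I (core G v) := by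
  have := Ideal.isCoprime_biInf (I := I) (J := fun g : G ↦ g • v) (s := Finset.univ)
    fun g _ ↦ h g
  simpa [core] using this

lemma core_ne_bot (hv : v ≠ ⊥) : core G v ≠ ⊥ := by
  have h : ∏ g : G, g • v ≤ core G v := le_iInf fun g ↦ (Ideal.prod_le_inf).trans
    (Finset.inf_le (Finset.mem_univ g))
  refine fun h0 ↦ ?_
  rw [h0, le_bot_iff, ← Ideal.zero_eq_bot, Finset.prod_eq_zero_iff] at h
  obtain ⟨g, -, hg⟩ := h
  rw [← smul_zero g, smul_left_cancel_iff] at hg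
  exact hv hg

lemma isMaximal_smul (hv : v.IsMaximal) (g : G) : (g • v).IsMaximal := by
  rw [Ideal.pointwise_smul_eq_comap]
  exact Ideal.comap_isMaximal_of_equiv (MulSemiringAction.toRingEquiv G (𝓞 k) g).symm

end ModChar

section AboveN
set_option linter.unusedSectionVars false
variable {p : ℕ} [Fact p.Prime] {k : Type*} [Field k] [NumberField k]
  [IsCyclotomicExtension {p} ℚ k] {z : 𝓞 k} (hz : IsPrimitiveRoot z p)
  {N : ℕ} (hN : N.Prime) (hcong : (N : ZMod p) = -1) {v : Ideal (𝓞 k)}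

lemma charP_quotient (hN : N.Prime) [v.IsPrime] (hv : (N : 𝓞 k) ∈ v) : CharP (𝓞 k ⧸ v) N := by
  rw [CharP.charP_iff_prime_eq_zero hN, ← map_natCast (Ideal.Quotient.mk v),
    Ideal.Quotient.eq_zero_iff_mem]
  exact hv

include hz hN hcong in
/-- Complex conjugation is the Frobenius at `N`. -/
lemma conj_smul_sub_pow_mem [v.IsPrime] (hv : (N : 𝓞 k) ∈ v) (x : 𝓞 k) :
    conj p k • x - x ^ N ∈ v := by
  have := charP_quotient hN hv
  have : Fact N.Prime := ⟨hN⟩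
  have h : (Ideal.Quotient.mk v).comp (MulSemiringAction.toRingHom _ (𝓞 k) (conj p k)) =
      (frobenius _ N).comp (Ideal.Quotient.mk v) := by
    apply ringHom_ext_of_root hz
    change Ideal.Quotient.mk v (conj p k • z) = (Ideal.Quotient.mk v z) ^ N
    rw [smul_root_eq hz (conj p k) (t := N) (by rw [cyc_conj, hcong]; simp), map_pow]
  rw [← Ideal.Quotient.eq, map_pow]
  exact DFunLike.congr_fun h x

include hz hN hcong in
lemma conj_smul_eq [v.IsPrime] (hv : (N : 𝓞 k) ∈ v) : conj p k • v = v := by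
  have h (x : 𝓞 k) (hx : x ∈ v) : conj p k • x ∈ v := by
    have := v.add_mem (conj_smul_sub_pow_mem hz hN hcong hv x) (v.pow_mem_of_mem hx N hN.pos)
    rwa [sub_add_cancel] at this
  have hinv : (conj p k)⁻¹ = conj p k := inv_eq_of_mul_eq_one_left conj_mul_conj
  ext x
  rw [Ideal.mem_pointwise_smul_iff_inv_smul_mem, hinv]
  exact ⟨fun hx ↦ by simpa [conj_smul_conj_smul] using h _ hx, h x⟩

lemma coprime_of_cong (hN : N.Prime) (hcong : (N : ZMod p) = -1) : N.Coprime p := by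
  have hp := (Fact.out : p.Prime)
  refine (Nat.coprime_primes hN hp).mpr ?_
  rintro rfl
  rw [CharP.cast_eq_zero, eq_comm, neg_eq_zero] at hcong
  exact one_ne_zero hcong

lemma liesOver_of_natCast_mem {K : Type*} [Field K] [NumberField K] {v : Ideal (𝓞 K)}
    (hN : N.Prime) [v.IsPrime] (hv : (N : 𝓞 K) ∈ v) :
    v.LiesOver (Ideal.span {(N : ℤ)}) := by
  have : Fact N.Prime := ⟨hN⟩
  have hmax : (Ideal.span {(N : ℤ)}).IsMaximal := Int.ideal_span_isMaximal_of_prime N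
  refine ⟨hmax.eq_of_le (Ideal.comap_ne_top _ (Ideal.IsPrime.ne_top ‹_›)) ?_⟩
  rw [Ideal.span_singleton_le_iff_mem, Ideal.mem_comap]
  simpa using hv

include hN hcong in
lemma eq_one_or_conj_of_smul_eq [v.IsMaximal] (hv : (N : 𝓞 k) ∈ v) {g : k ≃ₐ[ℚ] k}
    (hg : g • v = v) : g = 1 ∨ g = conj p k := by
  have : Fact N.Prime := ⟨hN⟩
  have := liesOver_of_natCast_mem hN hv
  have h := IsCyclotomicExtension.Rat.mem_zpowers_galEquivZMod_of_mem_stabilizer p k N v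
    (coprime_of_cong hN hcong) (σ := g) hg
  have h1 : ZMod.unitOfCoprime N (coprime_of_cong hN hcong) = (-1 : (ZMod p)ˣ) := by
    ext
    simpa using hcong
  rw [h1] at h
  obtain ⟨i, hi⟩ := h
  change (-1) ^ i = cyc p k g at hi
  rcases Int.even_or_odd i with hi' | hi'
  · rw [hi'.neg_one_zpow] at hi
    exact Or.inl ((cyc p k).injective (by rw [← hi, map_one]))
  · rw [hi'.neg_one_zpow] at hi
    exact Or.inr ((cyc p k).injective (by rw [← hi, cyc_conj]))

include hz in
lemma natCast_mem_of_sub_one_mem {m : Ideal (𝓞 k)} (h : z - 1 ∈ m) : (p : 𝓞 k) ∈ m := by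
  have h1 : ∑ i ∈ Finset.range p, z ^ i = 0 := hz.geom_sum_eq_zero (Fact.out : p.Prime).one_lt
  have h2 : ∑ i ∈ Finset.range p, (z ^ i - 1) = -(p : 𝓞 k) := by
    rw [Finset.sum_sub_distrib, h1]; simp
  rw [← neg_neg (p : 𝓞 k), ← h2]
  exact m.neg_mem (m.sum_mem fun i _ ↦ pow_sub_one_mem h i)

include hN hcong in
lemma isCoprime_span_natCast (hv : (N : 𝓞 k) ∈ v) :
    IsCoprime v (Ideal.span {(p : 𝓞 k)}) := by
  have h := Nat.isCoprime_iff_coprime.mpr (coprime_of_cong hN hcong)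
  have h := (Ideal.isCoprime_span_singleton_iff _ _).mpr (h.map (algebraMap ℤ (𝓞 k)))
  simp only [eq_intCast, Int.cast_natCast] at h
  exact isCoprime_of_le (Ideal.span_singleton_le_iff_mem _ |>.mpr hv) h.symm |>.symm

include hz hN hcong in
lemma exists_isModChar_at [v.IsMaximal] (hv : (N : 𝓞 k) ∈ v) :
    ∃ f : 𝓞 k → ZMod p, IsModChar v f ∧ ∃ x, IsCoprime (Ideal.span {x}) v ∧ f x ≠ 0 := by
  have hv0 : v ≠ ⊥ := by
    rintro rfl
    exact hN.ne_zero (by simpa using hv)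
  have hpv : (p : 𝓞 k) ∉ v := fun h ↦ by
    have := (isCoprime_span_natCast (k := k) hN hcong hv).sup_eq
    rw [sup_eq_left.mpr (Ideal.span_singleton_le_iff_mem _ |>.mpr h)] at this
    exact Ideal.IsPrime.ne_top inferInstance this
  have hcard : p ∣ Nat.card (𝓞 k ⧸ v)ˣ := by
    have := Ideal.finiteQuotientOfFreeOfNeBot v hv0
    set u : (𝓞 k ⧸ v)ˣ := Units.map (Ideal.Quotient.mk v) (hz.isUnit (NeZero.ne p)).unit
    have hu : (u : 𝓞 k ⧸ v) = Ideal.Quotient.mk v z := rfl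
    have : orderOf u = p := by
      refine orderOf_eq_prime ?_ fun h ↦ hpv (natCast_mem_of_sub_one_mem hz ?_)
      · ext; rw [Units.val_pow_eq_pow_val, hu, ← map_pow, hz.pow_eq_one, map_one, Units.val_one]
      · rw [← Ideal.Quotient.eq, ← hu, h, Units.val_one, map_one]
    rw [← this]
    exact orderOf_dvd_natCard u
  exact exists_isModChar hv0 hcard

lemma mem_of_mem_mul_prod {R ι : Type*} [CommRing R] {I : Ideal R} {S : Finset ι} (f : ι → Ideal R)
    {y : R} (hy : y ∈ I * ∏ i ∈ S, f i) {i : ι} (hi : i ∈ S) : y ∈ f i := by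
  have h1 : ∏ i ∈ S, f i ≤ f i := Ideal.le_of_dvd (Finset.dvd_prod_of_mem f hi)
  have h2 : I * ∏ i ∈ S, f i ≤ ∏ i ∈ S, f i := Ideal.mul_le_right
  exact h1 (h2 hy)

include hN hcong in
lemma exists_congruent [v.IsMaximal] (hv : (N : 𝓞 k) ∈ v) {x : 𝓞 k}
    (hx : IsCoprime (Ideal.span {x}) v) :
    ∃ y, y - x ∈ v ∧ y - 1 ∈ Ideal.span {(p : 𝓞 k)} ∧ (∀ g : k ≃ₐ[ℚ] k, g • v ≠ v → y - 1 ∈ g • v) ∧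
      IsCoprime (Ideal.span {y}) (core (k ≃ₐ[ℚ] k) v) := by
  obtain ⟨S, hS⟩ : ∃ S : Finset (k ≃ₐ[ℚ] k), ∀ g, g ∈ S ↔ g • v ≠ v :=
    ⟨Finset.univ.filter fun g ↦ g • v ≠ v, by simp⟩
  have hcop : IsCoprime v (Ideal.span {(p : 𝓞 k)} * ∏ g ∈ S, g • v) := by
    refine (isCoprime_span_natCast hN hcong hv).mul_right (IsCoprime.prod_right fun g hg ↦ ?_)
    have := isMaximal_smul (v := v) inferInstance g
    exact Ideal.isCoprime_of_isMaximal ((hS g).mp hg).symm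
  obtain ⟨i, hi, j, hj, hij⟩ := Ideal.isCoprime_iff_exists.mp hcop
  obtain ⟨y, hy⟩ : ∃ y, y = x * j + i := ⟨_, rfl⟩
  have hyx : y - x ∈ v := by
    have : y - x = i * (1 - x) := by linear_combination hy + x * hij
    rw [this]
    exact v.mul_mem_right _ hi
  have hy1 : y - 1 ∈ Ideal.span {(p : 𝓞 k)} * ∏ g ∈ S, g • v := by
    have : y - 1 = j * (x - 1) := by linear_combination hy + hij
    rw [this]
    exact Ideal.mul_mem_right _ _ hj
  have hyS (g : k ≃ₐ[ℚ] k) (hg : g ∈ S) : y - 1 ∈ g • v := by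
    exact mem_of_mem_mul_prod (fun g : k ≃ₐ[ℚ] k ↦ g • v) hy1 hg
  have hyv : IsCoprime (Ideal.span {y}) v :=
    isCoprime_span_of_sub_mem (by rw [← neg_sub]; exact v.neg_mem hyx) hx
  refine ⟨y, hyx, Ideal.mul_le_left hy1, fun g hg ↦ hyS g ((hS g).mpr hg),
    isCoprime_core fun g ↦ ?_⟩
  by_cases hg : g ∈ S
  · exact isCoprime_span_of_sub_one_mem (hyS _ hg)
  · have : g • v = v := not_not.mp fun h ↦ hg ((hS g).mpr h)
    rwa [this]

include hz hN hcong in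
lemma exists_isModChar_above [v.IsMaximal] (hv : (N : 𝓞 k) ∈ v) (hp2 : p ≠ 2)
    (χ : (k ≃ₐ[ℚ] k) →* (ZMod p)ˣ) (hχ : χ (conj p k) = -1) :
    ∃ F : 𝓞 k → ZMod p, IsModChar (core (k ≃ₐ[ℚ] k) v) F ∧ (∀ g x, F (g • x) = χ g * F x) ∧
      ∃ y, y - 1 ∈ Ideal.span {(p : 𝓞 k)} ∧ IsCoprime (Ideal.span {y}) (core (k ≃ₐ[ℚ] k) v) ∧
        F y ≠ 0 := by
  obtain ⟨f, hf, x, hx, hfx⟩ := exists_isModChar_at hz hN hcong hv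
  obtain ⟨y, hyx, hyp, hyg, hyc⟩ := exists_congruent (p := p) hN hcong hv hx
  have hyv : IsCoprime (Ideal.span {y}) v := isCoprime_of_le core_le hyc
  refine ⟨equiAverage χ f, isModChar_equiAverage χ hf smul_core core_le,
    equiAverage_smul χ f, y, hyp, hyc, ?_⟩
  have hc1 : (1 : k ≃ₐ[ℚ] k) ≠ conj p k := fun h ↦ by
    have := cyc_conj (p := p) (k := k)
    rw [← h, map_one, Units.ext_iff, Units.val_neg, Units.val_one] at this
    have hF : Fact (2 < p) := ⟨lt_of_le_of_ne (Fact.out : p.Prime).two_le hp2.symm⟩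
    exact ZMod.neg_one_ne_one (n := p) this.symm
  have hsupp : ∀ g ∈ Finset.univ, g ∉ ({1, conj p k} : Finset (k ≃ₐ[ℚ] k)) →
      (χ g⁻¹ : ZMod p) * f (g • y) = 0 := by
    intro g _ hg
    have := hyg g⁻¹ fun h ↦ hg ?_
    swap
    · have h' : g • v = v := by rw [← h, smul_inv_smul, h]
      simpa using eq_one_or_conj_of_smul_eq hN hcong hv h'
    rw [← Ideal.smul_mem_pointwise_smul_iff (a := g), smul_inv_smul, smul_sub, smul_one] at this
    rw [hf.eq_zero_of_sub_one_mem this, mul_zero]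
  have hcv : f (conj p k • y) = - f y := by
    have h1 := conj_smul_sub_pow_mem hz hN hcong hv y
    have h3 : IsCoprime (Ideal.span {conj p k • y}) v := by
      refine isCoprime_span_of_sub_mem (x := y ^ N) ?_ (isCoprime_span_pow hyv N)
      rw [← neg_sub]
      exact v.neg_mem h1
    rw [hf.map_congr _ _ h3 h1, hf.map_pow hyv, hcong, neg_one_mul]
  rw [equiAverage, ← Finset.sum_subset (Finset.subset_univ _) hsupp, Finset.sum_pair hc1,
    inv_one, map_one, one_smul, hcv, map_inv, hχ, hf.map_congr y x hyv hyx]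
  have h2 : (2 : ZMod p) ≠ 0 := by
    intro h
    have : p ∣ 2 := (ZMod.natCast_eq_zero_iff 2 p).mp (by exact_mod_cast h)
    exact hp2 ((Nat.prime_dvd_prime_iff_eq Fact.out Nat.prime_two).mp this)
  simp only [inv_neg, inv_one, Units.val_neg, Units.val_one]
  convert mul_ne_zero h2 hfx using 1
  ring

end AboveN

section Characters
set_option linter.unusedSectionVars false
variable {p : ℕ} [Fact p.Prime] {k : Type*} [Field k] [NumberField k]

/-- A ray character which is nonzero remains nonzero on ideals coprime to a further ideal. -/
lemma IsRayChar.exists_ne_zero {m E : Ideal (𝓞 k)} {a : Ideal (𝓞 k) → ZMod p}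
    (h : IsRayChar m a) (hm : m ≠ ⊥) (hm1 : m ≠ ⊤) (hE : E ≠ ⊥) (hmE : IsCoprime m E)
    {I : Ideal (𝓞 k)} (hI : IsCoprime I m) (hI0 : a I ≠ 0) :
    ∃ J, IsCoprime J (m ⊓ E) ∧ a J ≠ 0 := by
  by_contra! hc
  have hIb : I ≠ ⊥ := by
    rintro rfl
    rw [Ideal.isCoprime_iff_sup_eq, bot_sup_eq] at hI
    exact hm1 hI
  have hb : I * (m * E) ≠ ⊥ := by
    simp only [← Ideal.zero_eq_bot, ne_eq, mul_eq_zero, not_or] at hIb hm hE ⊢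
    exact ⟨hIb, hm, hE⟩
  obtain ⟨x, hx⟩ := IsDedekindDomain.exists_sup_span_eq (Ideal.mul_le_left : I * (m * E) ≤ I) hb
  have hxI : Ideal.span {x} ≤ I := by
    rw [← hx]
    exact le_sup_right
  obtain ⟨J, hJ⟩ := Ideal.dvd_iff_le.mpr hxI
  have hJc : IsCoprime J (m * E) := by
    rw [Ideal.isCoprime_iff_sup_eq, sup_comm, ← Ideal.one_eq_top]
    refine mul_left_cancel₀ hIb ?_
    rw [Ideal.mul_sup, ← hJ, hx, mul_one]
  have hJm : IsCoprime J m := hJc.of_mul_right_left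
  have hxm : IsCoprime (Ideal.span {x}) m := hJ ▸ hI.mul_left hJm
  rw [← Ideal.mul_eq_inf_of_isCoprime hmE] at hc
  have h1 := h.map_mul I J hI hJm
  rw [← hJ, hc J hJc, add_zero] at h1
  obtain ⟨i, hi, j, hj, hij⟩ := Ideal.isCoprime_iff_exists.mp hmE
  have hxy : x - (x * j + i) ∈ m := by
    have : x - (x * j + i) = i * (x - 1) := by linear_combination -x * hij
    rw [this]
    exact m.mul_mem_right _ hi
  have hy : x * j + i - 1 ∈ E := by
    have : x * j + i - 1 = j * (x - 1) := by linear_combination hij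
    rw [this]
    exact E.mul_mem_right _ hj
  rw [h.map_span x _ hxm hxy, hc _ ((isCoprime_span_of_sub_mem hxy hxm).mul_right
    (isCoprime_span_of_sub_one_mem hy))] at h1
  exact hI0 h1.symm

lemma two_ne_zero_zmod (hp2 : p ≠ 2) : (2 : ZMod p) ≠ 0 := by
  intro h
  have : p ∣ 2 := (ZMod.natCast_eq_zero_iff 2 p).mp (by exact_mod_cast h)
  exact hp2 ((Nat.prime_dvd_prime_iff_eq Fact.out Nat.prime_two).mp this)

variable [IsCyclotomicExtension {p} ℚ k] {z : 𝓞 k} (hz : IsPrimitiveRoot z p)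

include hz in
lemma IsModChar.map_unit {m : Ideal (𝓞 k)} {f : 𝓞 k → ZMod p} (hf : IsModChar m f) (hp2 : p ≠ 2)
    (hm : ∀ g : k ≃ₐ[ℚ] k, g • m = m)
    (hodd : ∀ x, IsCoprime (Ideal.span {x}) m → f (conj p k • x) = - f x) (hfz : f z = 0)
    (u : (𝓞 k)ˣ) : f u = 0 := by
  have h2 : (2 : ZMod p) ≠ 0 := two_ne_zero_zmod hp2
  have hdouble {x : ZMod p} (h : x = -x) : x = 0 := by
    have : 2 * x = 0 := by linear_combination h
    exact (mul_eq_zero.mp this).resolve_left h2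
  have hzc : IsCoprime (Ideal.span {z}) m :=
    isCoprime_span_unit (hz.isUnit (NeZero.ne p)).unit
  have hu := isCoprime_span_unit (m := m) u
  have hcu := isCoprime_span_smul hm (conj p k) hu
  have hneg : IsCoprime (Ideal.span {(-1 : 𝓞 k)}) m := isCoprime_span_unit (-1)
  have hf1 : f (-1) = 0 := by
    have := hf.map_mul (-1) (-1) hneg hneg
    rw [neg_mul_neg, one_mul, hf.map_one] at this
    exact hdouble (by linear_combination -this)
  obtain ⟨r, hr⟩ := unit_eq_root_mul_conj hz hp2 u
  have hzr := isCoprime_span_pow hzc r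
  refine hdouble ?_
  rw [← hodd _ hu]
  rcases hr with hr | hr
  · conv_lhs => rw [hr]
    rw [hf.map_mul _ _ hzr hcu, hf.map_pow hzc, hfz, mul_zero, zero_add]
  · conv_lhs => rw [hr, ← neg_one_mul]
    rw [hf.map_mul _ _ (isCoprime_span_mul hneg hzr) hcu, hf.map_mul _ _ hneg hzr,
      hf.map_pow hzc, hfz, hf1, mul_zero, zero_add, zero_add]

include hz in
/-- The logarithmic derivative at `z = 1` modulo `p`. -/
lemma exists_logDeriv (hp2 : p ≠ 2) : ∃ f : 𝓞 k → ZMod p,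
    IsModChar (Ideal.span {(p : 𝓞 k)}) f ∧ (∀ (g : k ≃ₐ[ℚ] k) x, f (g • x) = cyc p k g * f x) ∧
      f z = 1 := by
  have hpow (n : ℕ) : (1 + DualNumber.eps : DualNumber (ZMod p)) ^ n =
      1 + (n : ZMod p) • DualNumber.eps := by
    induction n with
    | zero => simp
    | succ n ih =>
      rw [pow_succ, ih]
      ext <;> simp [add_comm]
  have hp0 : (p : DualNumber (ZMod p)) = 0 := by
    rw [← map_natCast (algebraMap (ZMod p) (DualNumber (ZMod p))), CharP.cast_eq_zero, map_zero]
  obtain ⟨φ, hφ⟩ := exists_ringHom_of_sum_eq_zero hz (1 + DualNumber.eps : DualNumber (ZMod p)) (by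
    rw [Finset.sum_congr rfl fun i _ ↦ hpow i, Finset.sum_add_distrib, ← Finset.sum_smul, ← Nat.cast_sum]
    have h1 : ((∑ i ∈ Finset.range p, i : ℕ) : ZMod p) = 0 := by
      have h := congrArg (Nat.cast : ℕ → ZMod p) (Finset.sum_range_id_mul_two p)
      push_cast at h
      rw [CharP.cast_eq_zero, zero_mul] at h
      rw [Nat.cast_sum]
      exact (mul_eq_zero.mp h).resolve_right (two_ne_zero_zmod hp2)
    rw [h1, zero_smul, add_zero, Finset.sum_const, Finset.card_range, nsmul_eq_mul, hp0, zero_mul])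
  have hφp (x y : 𝓞 k) (h : x - y ∈ Ideal.span {(p : 𝓞 k)}) : φ x = φ y := by
    obtain ⟨c, hc⟩ := Ideal.mem_span_singleton'.mp h
    rw [← sub_eq_zero, ← map_sub, ← hc, map_mul, map_natCast, hp0, mul_zero]
  have hφ0 (x : 𝓞 k) (hx : IsCoprime (Ideal.span {x}) (Ideal.span {(p : 𝓞 k)})) :
      (φ x).fst ≠ 0 := by
    intro h
    obtain ⟨a, b, hab⟩ := (Ideal.isCoprime_span_singleton_iff _ _).mp hx
    have h1 : φ (a * x) = φ 1 := hφp _ _ (by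
      rw [← hab, sub_add_cancel_left]
      exact Ideal.mul_mem_left _ _ (Ideal.mem_span_singleton_self _) |> neg_mem)
    have := congrArg TrivSqZeroExt.fst h1
    simp [h] at this
  refine ⟨fun x ↦ (φ x).snd / (φ x).fst, ⟨fun x y hx hy ↦ ?_, fun x y _ hxy ↦ ?_⟩,
    fun g x ↦ ?_, ?_⟩
  · have := hφ0 x hx
    have := hφ0 y hy
    simp only [map_mul, TrivSqZeroExt.snd_mul, TrivSqZeroExt.fst_mul, smul_eq_mul,
      MulOpposite.smul_eq_mul_unop, MulOpposite.unop_op]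
    field_simp
    ring
  · simp only [hφp x y hxy]
  · set t : ZMod p := ((cyc p k g : (ZMod p)ˣ) : ZMod p) with ht
    let T : DualNumber (ZMod p) →ₐ[ZMod p] DualNumber (ZMod p) :=
      DualNumber.lift ⟨(Algebra.ofId _ _, t • DualNumber.eps), by simp, fun _ ↦ Commute.all _ _⟩
    have hT : φ.comp (MulSemiringAction.toRingHom _ (𝓞 k) g) = (T : _ →+* _).comp φ := by
      apply ringHom_ext_of_root hz
      change φ (g • z) = T (φ z)
      rw [smul_root hz, map_pow, hφ, hpow, map_add, map_one, DualNumber.lift_apply_eps]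
      simp [t]
    have h1 : φ (g • x) = T (φ x) := DFunLike.congr_fun hT x
    have h2 (w : DualNumber (ZMod p)) : (T w).fst = w.fst ∧ (T w).snd = t * w.snd := by
      have : w = algebraMap _ _ w.fst + w.snd • DualNumber.eps := by
        ext <;> simp [TrivSqZeroExt.algebraMap_eq_inl]
      rw [this, map_add, map_smul, AlgHom.commutes, DualNumber.lift_apply_eps]
      constructor <;> simp [TrivSqZeroExt.algebraMap_eq_inl, mul_comm]
    beta_reduce
    rw [h1, (h2 _).1, (h2 _).2, mul_div_assoc]
  · simp [hφ]

end Characters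

section Package
set_option linter.unusedSectionVars false
variable {p : ℕ} [Fact p.Prime] {k : Type*} [Field k] [NumberField k]
  [IsCyclotomicExtension {p} ℚ k] {z : 𝓞 k} (hz : IsPrimitiveRoot z p)
  {N : ℕ} (hN : N.Prime) (hcong : (N : ZMod p) = -1) {v : Ideal (𝓞 k)}

/-- The conductor of the characters attached to a prime `v` above `N`. -/
abbrev conductor (p : ℕ) (v : Ideal (𝓞 k)) : Ideal (𝓞 k) :=
  core (k ≃ₐ[ℚ] k) v ⊓ Ideal.span {(p : 𝓞 k)}

lemma exists_cyc_eq {t : ZMod p} (ht : t ≠ 0) : ∃ g : k ≃ₐ[ℚ] k, (cyc p k g : ZMod p) = t :=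
  ⟨(cyc p k).symm (Units.mk0 t ht), by simp⟩

include p in
lemma card_galois_ne_zero : (Fintype.card (k ≃ₐ[ℚ] k) : ZMod p) ≠ 0 := by
  rw [Fintype.card_congr (cyc p k).toEquiv, ZMod.card_units_eq_totient, Nat.totient_prime Fact.out,
    Nat.cast_sub (Fact.out : p.Prime).one_le, CharP.cast_eq_zero]
  simp

include hN in
lemma natCast_mem_smul (hv : (N : 𝓞 k) ∈ v) (g : k ≃ₐ[ℚ] k) : (N : 𝓞 k) ∈ g • v := by
  rw [Ideal.mem_pointwise_smul_iff_inv_smul_mem]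
  have : g⁻¹ • (N : 𝓞 k) = N := map_natCast (MulSemiringAction.toRingHom _ (𝓞 k) g⁻¹) N
  rwa [this]

include hN hcong in
lemma isCoprime_core_span_natCast (hv : (N : 𝓞 k) ∈ v) :
    IsCoprime (core (k ≃ₐ[ℚ] k) v) (Ideal.span {(p : 𝓞 k)}) :=
  (isCoprime_core fun g ↦ (isCoprime_span_natCast hN hcong (natCast_mem_smul hN hv g)).symm).symm

lemma smul_span_natCast (g : k ≃ₐ[ℚ] k) (n : ℕ) :
    g • Ideal.span {(n : 𝓞 k)} = Ideal.span {(n : 𝓞 k)} := by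
  rw [smul_span_singleton]
  congr 2
  exact map_natCast (MulSemiringAction.toRingHom _ (𝓞 k) g) n

include hN hcong in
lemma smul_conductor (hv : (N : 𝓞 k) ∈ v) (g : k ≃ₐ[ℚ] k) :
    g • conductor p v = conductor p v := by
  rw [conductor, ← Ideal.mul_eq_inf_of_isCoprime (isCoprime_core_span_natCast hN hcong hv),
    smul_mul', smul_core, smul_span_natCast]

lemma span_natCast_ne_bot {n : ℕ} (hn : n ≠ 0) : Ideal.span {(n : 𝓞 k)} ≠ ⊥ := by
  simpa using hn

include hN in
lemma ne_bot_of_natCast_mem (hv : (N : 𝓞 k) ∈ v) : v ≠ ⊥ := by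
  rintro rfl
  exact hN.ne_zero (by exact_mod_cast (Ideal.mem_bot.mp hv))

include hN hcong in
lemma conductor_ne_bot (hv : (N : 𝓞 k) ∈ v) : conductor p v ≠ ⊥ := by
  rw [conductor, ← Ideal.mul_eq_inf_of_isCoprime (isCoprime_core_span_natCast hN hcong hv),
    ← Ideal.zero_eq_bot, mul_ne_zero_iff]
  exact ⟨core_ne_bot (ne_bot_of_natCast_mem hN hv), span_natCast_ne_bot (NeZero.ne p)⟩

lemma core_ne_top [v.IsMaximal] : core (k ≃ₐ[ℚ] k) v ≠ ⊤ := by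
  intro h
  exact Ideal.IsMaximal.ne_top ‹_› (top_le_iff.mp (h ▸ core_le))

lemma conductor_ne_top [v.IsMaximal] : conductor p v ≠ ⊤ :=
  fun h ↦ core_ne_top (v := v) (top_le_iff.mp (h ▸ inf_le_left))

include hz hN hcong in
lemma exists_rayChar_inv (hp5 : 5 ≤ p) [v.IsMaximal] (hv : (N : 𝓞 k) ∈ v) :
    ∃ ψ : Ideal (𝓞 k) → ZMod p, IsRayChar (core (k ≃ₐ[ℚ] k) v) ψ ∧
      (∀ (g : k ≃ₐ[ℚ] k) I, IsCoprime I (core (k ≃ₐ[ℚ] k) v) →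
        ψ (g • I) = ((cyc p k g)⁻¹ : (ZMod p)ˣ) * ψ I) ∧
      ∃ I, IsCoprime I (core (k ≃ₐ[ℚ] k) v) ∧ ψ I ≠ 0 := by
  have hp2 : p ≠ 2 := by omega
  have h3 : (3 : ZMod p) ≠ 0 := by
    intro h
    have : p ∣ 3 := (ZMod.natCast_eq_zero_iff 3 p).mp (by exact_mod_cast h)
    exact absurd (Nat.le_of_dvd (by norm_num) this) (by omega)
  let χ : (k ≃ₐ[ℚ] k) →* (ZMod p)ˣ := (cyc p k).toMonoidHom⁻¹
  have hχ (g) : χ g = (cyc p k g)⁻¹ := rfl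
  have hv0 := ne_bot_of_natCast_mem hN hv
  obtain ⟨F, hF, hFg, y, -, hy, hy0⟩ :=
    exists_isModChar_above hz hN hcong hv hp2 χ (by rw [hχ, cyc_conj]; simp)
  have hzc : IsCoprime (Ideal.span {z}) (core (k ≃ₐ[ℚ] k) v) :=
    isCoprime_span_unit (hz.isUnit (NeZero.ne p)).unit
  have hFz : F z = 0 := by
    obtain ⟨g, hg⟩ := exists_cyc_eq (k := k) (two_ne_zero_zmod hp2)
    have h := hFg g z
    rw [smul_root_eq hz g (t := 2) (by rw [hg]; norm_num), hF.map_pow hzc, hχ, Units.val_inv_eq_inv_val, hg] at h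
    have h2 := two_ne_zero_zmod hp2
    field_simp at h
    have : (3 : ZMod p) * F z = 0 := by push_cast at h; linear_combination h
    exact (mul_eq_zero.mp this).resolve_left h3
  exact exists_equivariant_rayChar (core_ne_bot hv0) core_ne_top smul_core χ card_galois_ne_zero hF
    (IsModChar.map_unit hz hF hp2 smul_core
      (fun x _ ↦ by rw [hFg, hχ, cyc_conj]; simp) hFz)
    (fun g x _ ↦ hFg g x) hy hy0

include hz hN hcong in
lemma exists_rayChar_cyc (hp2 : p ≠ 2) [v.IsMaximal] (hv : (N : 𝓞 k) ∈ v) :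
    ∃ χ : Ideal (𝓞 k) → ZMod p, IsRayChar (conductor p v) χ ∧
      (∀ (g : k ≃ₐ[ℚ] k) I, IsCoprime I (conductor p v) → χ (g • I) = cyc p k g * χ I) ∧
      ∃ I, IsCoprime I (conductor p v) ∧ χ I ≠ 0 := by
  obtain ⟨F, hF, hFg, y, hy1, hy, hy0⟩ := exists_isModChar_above hz hN hcong hv hp2
    (cyc p k).toMonoidHom (by simp)
  obtain ⟨f, hf, hfg, hfz⟩ := exists_logDeriv hz hp2
  have hfy : f y = 0 := hf.eq_zero_of_sub_one_mem hy1
  have hH := (hF.mono (m' := conductor p v) inf_le_left).linear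
    (hf.mono (m' := conductor p v) inf_le_right) (F z)
  have hHg (g : k ≃ₐ[ℚ] k) (x) : F (g • x) - F z * f (g • x) = cyc p k g * (F x - F z * f x) := by
    rw [hFg, hfg]
    change (cyc p k g : ZMod p) * _ - _ = _
    ring
  have hm := smul_conductor hN hcong hv
  exact exists_equivariant_rayChar (conductor_ne_bot hN hcong hv) conductor_ne_top
    hm (cyc p k).toMonoidHom card_galois_ne_zero hH
    (IsModChar.map_unit hz hH hp2 hm
      (fun x _ ↦ by rw [hHg, cyc_conj]; simp) (by simp [hfz]))
    (fun g x _ ↦ hHg g x) (y := y)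
    (by
      rw [conductor, ← Ideal.mul_eq_inf_of_isCoprime (isCoprime_core_span_natCast hN hcong hv)]
      exact hy.mul_right (isCoprime_span_of_sub_one_mem hy1)) (by simpa [hfy] using hy0)

include hz hN hcong in
/-- Two independent equivariant ray class characters attached to a prime `v` above `N`. -/
theorem exists_characters (hp5 : 5 ≤ p) [v.IsMaximal] (hv : (N : 𝓞 k) ∈ v) :
    ∃ ψ χ : Ideal (𝓞 k) → ZMod p, IsRayChar (core (k ≃ₐ[ℚ] k) v) ψ ∧
      (∀ (g : k ≃ₐ[ℚ] k) I, IsCoprime I (core (k ≃ₐ[ℚ] k) v) →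
        ψ (g • I) = ((cyc p k g)⁻¹ : (ZMod p)ˣ) * ψ I) ∧
      IsRayChar (conductor p v) χ ∧
      (∀ (g : k ≃ₐ[ℚ] k) I, IsCoprime I (conductor p v) → χ (g • I) = cyc p k g * χ I) ∧
      ∀ i j : ZMod p, (∀ I, IsCoprime I (conductor p v) → i * ψ I + j * χ I = 0) →
        i = 0 ∧ j = 0 := by
  have hp2 : p ≠ 2 := by omega
  have h2 := two_ne_zero_zmod hp2
  have h3 : (3 : ZMod p) ≠ 0 := by
    intro h
    have : p ∣ 3 := (ZMod.natCast_eq_zero_iff 3 p).mp (by exact_mod_cast h)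
    exact absurd (Nat.le_of_dvd (by norm_num) this) (by omega)
  obtain ⟨ψ, hψ, hψg, I, hI, hI0⟩ := exists_rayChar_inv hz hN hcong hp5 hv
  obtain ⟨χ, hχ, hχg, J, hJ, hJ0⟩ := exists_rayChar_cyc hz hN hcong hp2 hv
  refine ⟨ψ, χ, hψ, hψg, hχ, hχg, fun i j h ↦ ?_⟩
  obtain ⟨g, hg⟩ := exists_cyc_eq (k := k) h2
  have hjχ : j * χ J = 0 := by
    have h1 := h _ hJ
    have h4 := h _ (isCoprime_smul (smul_conductor hN hcong hv) g hJ)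
    rw [hψg g J (isCoprime_of_le inf_le_left hJ), hχg g J hJ, Units.val_inv_eq_inv_val, hg] at h4
    have h5 : (2 : ZMod p)⁻¹ * 2 = 1 := inv_mul_cancel₀ h2
    have : (3 : ZMod p) * (j * χ J) = 0 := by
      linear_combination 2 * h4 - h1 - i * ψ J * h5
    exact (mul_eq_zero.mp this).resolve_left h3
  have hj := (mul_eq_zero.mp hjχ).resolve_right hJ0
  have hv0 := ne_bot_of_natCast_mem hN hv
  obtain ⟨I', hI', hI'0⟩ := hψ.exists_ne_zero (core_ne_bot hv0) core_ne_top
    (span_natCast_ne_bot (NeZero.ne p)) (isCoprime_core_span_natCast hN hcong hv) hI hI0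
  have := h I' hI'
  rw [hj, zero_mul, add_zero] at this
  exact ⟨(mul_eq_zero.mp this).resolve_right hI'0, hj⟩

end Package

section Jacobi
set_option linter.unusedSectionVars false

lemma sum_pow_mul_one_sub_pow {F : Type*} [Field F] [Fintype F] {a b : ℕ}
    (h : a + b < Fintype.card F - 1) : ∑ x : F, x ^ a * (1 - x) ^ b = 0 := by
  have h1 (x : F) : x ^ a * (1 - x) ^ b =
      ∑ i ∈ Finset.range (b + 1), ((-1) ^ i * (b.choose i : F)) * x ^ (a + i) := by
    rw [sub_eq_neg_add, add_pow, Finset.mul_sum]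
    refine Finset.sum_congr rfl fun i _ ↦ ?_
    rw [neg_pow, one_pow]
    ring
  simp_rw [h1]
  rw [Finset.sum_comm]
  refine Finset.sum_eq_zero fun i hi ↦ ?_
  rw [← Finset.mul_sum, FiniteField.sum_pow_lt_card_sub_one F _ (by
    have := Finset.mem_range.mp hi
    omega), mul_zero]

/-- The number of carries when adding `s` repeatedly modulo `p`. -/
lemma card_filter_no_carry {p s : ℕ} (hp : 2 ≤ p) (hs : 1 ≤ s) (hsp : s < p) :
    (((Finset.Ico 1 (p - 1)).filter fun b ↦ s + b * s % p < p).card : ℤ) = p - 1 - s := by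
  have h1 (b : ℕ) : (if s + b * s % p < p then (1 : ℤ) else 0) =
      1 - (((b + 1) * s / p : ℕ) - (b * s / p : ℕ)) := by
    have hd : (b + 1) * s = s + b * s % p + p * (b * s / p) := by
      rw [add_assoc, Nat.mod_add_div]; ring
    rw [hd, Nat.add_mul_div_left _ _ (by omega)]
    have := Nat.mod_lt (b * s) (show p > 0 by omega)
    split_ifs with h
    · rw [Nat.div_eq_of_lt h]; push_cast; ring
    · rw [show (s + b * s % p) / p = 1 from Nat.div_eq_of_lt_le (by omega) (by omega)]
      push_cast; ring
  rw [Finset.card_filter, Nat.cast_sum]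
  simp only [Nat.cast_ite, Nat.cast_one, Nat.cast_zero]
  rw [Finset.sum_congr rfl fun b _ ↦ h1 b, Finset.sum_sub_distrib,
    Finset.sum_Ico_sub (fun b ↦ ((b * s / p : ℕ) : ℤ)) (by omega)]
  have h2 : (p - 1) * s / p = s - 1 := by
    refine Nat.div_eq_of_lt_le ?_ ?_
    · obtain ⟨s, rfl⟩ := Nat.exists_eq_add_of_le' hs
      obtain ⟨p, rfl⟩ := Nat.exists_eq_add_of_le' (show 1 ≤ p by omega)
      simp only [Nat.add_sub_cancel]
      nlinarith
    · obtain ⟨s, rfl⟩ := Nat.exists_eq_add_of_le' hs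
      obtain ⟨p, rfl⟩ := Nat.exists_eq_add_of_le' (show 1 ≤ p by omega)
      simp only [Nat.add_sub_cancel]
      nlinarith
  rw [h2, one_mul, Nat.div_eq_of_lt hsp]
  simp only [Finset.sum_const, Nat.card_Ico, nsmul_eq_mul, mul_one]
  push_cast [Nat.cast_sub hs, Nat.cast_sub (show 1 ≤ p by omega),
    Nat.cast_sub (show 1 ≤ p - 1 by omega)]
  ring

lemma eq_prod_of_mul_eq_prod {R ι : Type*} [CommRing R] [IsDedekindDomain R] [Fintype ι]
    {P : ι → Ideal R} (hP : Pairwise fun i j ↦ IsCoprime (P i) (P j)) {A B : Ideal R}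
    (h0 : A * B ≠ 0) (hAB : A * B = ∏ i, P i) (S : ι → Prop) [DecidablePred S]
    (hA : ∀ i, S i → A ≤ P i)
    (hB : ∀ i, ¬ S i → B ≤ P i) : A = ∏ i with S i, P i := by
  obtain ⟨A', hA'⟩ : (∏ i with S i, P i) ∣ A :=
    Finset.prod_dvd_of_coprime (fun i _ j _ hij ↦ hP hij)
      fun i hi ↦ Ideal.dvd_iff_le.mpr (hA i (Finset.mem_filter.mp hi).2)
  obtain ⟨B', hB'⟩ : (∏ i with ¬ S i, P i) ∣ B :=
    Finset.prod_dvd_of_coprime (fun i _ j _ hij ↦ hP hij)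
      fun i hi ↦ Ideal.dvd_iff_le.mpr (hB i (Finset.mem_filter.mp hi).2)
  have h1 : (∏ i, P i) * (A' * B') = (∏ i, P i) * 1 := by
    rw [mul_one, ← hAB]
    conv_rhs => rw [hA', hB']
    rw [hAB, ← Finset.prod_filter_mul_prod_filter_not Finset.univ S]
    ring
  have h2 := mul_left_cancel₀ (hAB ▸ h0) h1
  rw [hA', show A' = 1 from Ideal.one_eq_top (R := R) ▸ (Ideal.isUnit_iff.mp (IsUnit.of_mul_eq_one _ h2)), mul_one]

variable {p : ℕ} [Fact p.Prime] {k : Type*} [Field k] [NumberField k]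
  [IsCyclotomicExtension {p} ℚ k] {z : 𝓞 k} (hz : IsPrimitiveRoot z p)
  {ℓ : ℕ} [Fact ℓ.Prime] (hl : ℓ ≠ p) (π : 𝓞 k →+* ZMod ℓ)

include hz in
lemma smul_eq_pow_of_pow_eq_one {y : 𝓞 k} (hy : y ^ p = 1) (g : k ≃ₐ[ℚ] k) :
    g • y = y ^ (cyc p k g : ZMod p).val := by
  obtain ⟨i, -, rfl⟩ := hz.eq_pow_of_pow_eq_one hy
  rw [smul_pow', smul_root hz, ← pow_mul, ← pow_mul, mul_comm]

include hz hl in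
lemma isPrimitiveRoot_map : IsPrimitiveRoot (π z) p := by
  rw [IsPrimitiveRoot.iff_orderOf]
  refine orderOf_eq_prime (by rw [← map_pow, hz.pow_eq_one, map_one]) fun h ↦ hl ?_
  have h1 : (p : 𝓞 k) ∈ RingHom.ker π := natCast_mem_of_sub_one_mem hz (by
    rw [RingHom.mem_ker, map_sub, h, map_one, sub_self])
  rw [RingHom.mem_ker, map_natCast, ZMod.natCast_eq_zero_iff] at h1
  exact (Nat.prime_dvd_prime_iff_eq Fact.out Fact.out).mp h1

include hz hl in
/-- The `p`-th power residue character. -/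
lemma exists_powerResidue : ∃ e, e * p = ℓ - 1 ∧ ∃ χ : MulChar (ZMod ℓ) (𝓞 k),
    χ ^ p = 1 ∧ χ ≠ 1 ∧ ∀ x, π (χ x) = x ^ e := by
  have hπ := isPrimitiveRoot_map hz hl π
  have hdvd : p ∣ ℓ - 1 := by
    rw [hπ.eq_orderOf]
    exact ZMod.orderOf_dvd_card_sub_one (hπ.ne_zero (NeZero.ne p))
  obtain ⟨e, he⟩ := hdvd
  have hl1 : 0 < ℓ - 1 := Nat.sub_pos_of_lt (Fact.out : ℓ.Prime).one_lt
  have he0 : e ≠ 0 := by rintro rfl; omega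
  obtain ⟨u, hu⟩ := IsCyclic.exists_generator (α := (ZMod ℓ)ˣ)
  have hcard : Fintype.card (ZMod ℓ)ˣ = e * p := by
    rw [ZMod.card_units_eq_totient, Nat.totient_prime Fact.out, he, mul_comm]
  have hup : ((u : ZMod ℓ) ^ e) ^ p = 1 := by
    rw [← pow_mul, ← hcard, ← Units.val_pow_eq_pow_val, pow_card_eq_one, Units.val_one]
  obtain ⟨j, -, hj⟩ := hπ.eq_pow_of_pow_eq_one hup
  let w : (𝓞 k)ˣ := (hz.isUnit (NeZero.ne p)).unit ^ j
  have hw : (w : 𝓞 k) = z ^ j := by simp [w]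
  have hwp : w ^ p = 1 := by
    ext
    rw [Units.val_pow_eq_pow_val, hw, ← pow_mul, mul_comm, pow_mul, hz.pow_eq_one, one_pow,
      Units.val_one]
  have hwm : w ∈ rootsOfUnity (Fintype.card (ZMod ℓ)ˣ) (𝓞 k) := by
    rw [mem_rootsOfUnity, hcard, mul_comm, pow_mul, hwp, one_pow]
  let χ := MulChar.ofRootOfUnity hwm hu
  have hχ : χ u = w := MulChar.ofRootOfUnity_spec hwm hu
  have hgen (x : (ZMod ℓ)ˣ) : ∃ i : ℕ, u ^ i = x := by
    obtain ⟨i, hi⟩ := (mem_powers_iff_mem_zpowers.mpr (hu x))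
    exact ⟨i, hi⟩
  have hπχ (x) : π (χ x) = x ^ e := by
    rcases eq_or_ne x 0 with rfl | hx
    · rw [MulChar.map_zero, map_zero, zero_pow he0]
    · obtain ⟨i, hi⟩ := hgen (Units.mk0 x hx)
      have : x = (u : ZMod ℓ) ^ i := by
        rw [← Units.val_pow_eq_pow_val, hi, Units.val_mk0]
      rw [this, map_pow, hχ, hw, map_pow, map_pow, hj, ← pow_mul, ← pow_mul, mul_comm]
  refine ⟨e, by rw [he, mul_comm], χ, ?_, fun h ↦ ?_, hπχ⟩
  · ext x
    obtain ⟨i, rfl⟩ := hgen x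
    rw [MulChar.pow_apply_coe, Units.val_pow_eq_pow_val, map_pow, hχ, ← pow_mul, mul_comm, pow_mul,
      ← Units.val_pow_eq_pow_val, hwp, Units.val_one, one_pow, ← Units.val_pow_eq_pow_val,
      MulChar.one_apply_coe]
  · have h1 := hπχ u
    rw [h, MulChar.one_apply_coe, map_one] at h1
    have h2 : orderOf u ∣ e := orderOf_dvd_of_pow_eq_one (by
      ext
      rw [Units.val_pow_eq_pow_val, ← h1, Units.val_one])
    rw [orderOf_eq_card_of_forall_mem_zpowers hu, Nat.card_eq_fintype_card, hcard] at h2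
    have := Nat.le_of_dvd (Nat.pos_of_ne_zero he0) h2
    have hp := (Fact.out : p.Prime).two_le
    nlinarith [Nat.pos_of_ne_zero he0]

variable {e : ℕ} (he : e * p = ℓ - 1) {χ : MulChar (ZMod ℓ) (𝓞 k)} (hχp : χ ^ p = 1) (hχ1 : χ ≠ 1)
  (hχ : ∀ x, π (χ x) = x ^ e)

include hχp hz in
lemma smul_powerResidue (g : k ≃ₐ[ℚ] k) (n : ℕ) (x : ZMod ℓ) :
    g • (χ ^ n) x = (χ ^ (n * (cyc p k g : ZMod p).val)) x := by
  rcases eq_or_ne x 0 with rfl | hx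
  · rw [MulChar.map_zero, MulChar.map_zero, smul_zero]
  · have h1 : ((χ ^ n) x) ^ p = 1 := by
      have := MulChar.pow_apply_coe (χ ^ n) p (Units.mk0 x hx)
      rw [Units.val_mk0] at this
      rw [← this, ← pow_mul, mul_comm, pow_mul, hχp, one_pow]
      exact MulChar.one_apply (Ne.isUnit hx)
    rw [smul_eq_pow_of_pow_eq_one hz h1, pow_mul]
    have := MulChar.pow_apply_coe (χ ^ n) (cyc p k g : ZMod p).val (Units.mk0 x hx)
    rw [Units.val_mk0] at this
    exact this.symm

include hz hχp in
lemma smul_jacobiSum (g : k ≃ₐ[ℚ] k) (a b : ℕ) :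
    g • jacobiSum (χ ^ a) (χ ^ b) =
      jacobiSum (χ ^ (a * (cyc p k g : ZMod p).val)) (χ ^ (b * (cyc p k g : ZMod p).val)) := by
  simp only [jacobiSum, Finset.smul_sum, smul_mul', smul_powerResidue hz hχp]

lemma map_powerResidue_pow (n : ℕ) (hn : n ≠ 0) (hχ : ∀ x, π (χ x) = x ^ e) (x : ZMod ℓ) :
    π ((χ ^ n) x) = x ^ (e * n) := by
  rw [MulChar.pow_apply' _ hn, map_pow, hχ, pow_mul]

include he hχ in
lemma map_jacobiSum {a b : ℕ} (ha : a ≠ 0) (hb : b ≠ 0) (h : a + b < p) :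
    π (jacobiSum (χ ^ a) (χ ^ b)) = 0 := by
  simp only [jacobiSum, map_sum, map_mul, map_powerResidue_pow π a ha hχ,
    map_powerResidue_pow π b hb hχ]
  refine sum_pow_mul_one_sub_pow ?_
  rw [ZMod.card, ← he, ← mul_add]
  refine Nat.mul_lt_mul_of_pos_left h (Nat.pos_of_ne_zero ?_)
  rintro rfl
  have := (Fact.out : ℓ.Prime).two_le
  omega

end Jacobi

section Factor
set_option linter.unusedSectionVars false
variable {p : ℕ} [Fact p.Prime] {k : Type*} [Field k] [NumberField k]
  [IsCyclotomicExtension {p} ℚ k] {z : 𝓞 k} (hz : IsPrimitiveRoot z p)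
  {ℓ : ℕ} [Fact ℓ.Prime] (hl : ℓ ≠ p) (π : 𝓞 k →+* ZMod ℓ)

lemma smul_ker (g : k ≃ₐ[ℚ] k) :
    g • RingHom.ker π = RingHom.ker (π.comp (MulSemiringAction.toRingHom _ (𝓞 k) g⁻¹)) := by
  ext x
  rw [Ideal.mem_pointwise_smul_iff_inv_smul_mem, RingHom.mem_ker, RingHom.mem_ker]
  rfl

lemma mem_smul_ker (g : k ≃ₐ[ℚ] k) (x : 𝓞 k) : x ∈ g • RingHom.ker π ↔ π (g⁻¹ • x) = 0 := by
  rw [Ideal.mem_pointwise_smul_iff_inv_smul_mem, RingHom.mem_ker]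

lemma isMaximal_ker : (RingHom.ker π).IsMaximal :=
  RingHom.ker_isMaximal_of_surjective π (ZMod.ringHom_surjective π)

lemma absNorm_ker : Ideal.absNorm (RingHom.ker π) = ℓ := by
  rw [Ideal.absNorm_apply, Submodule.cardQuot_apply,
    Nat.card_congr (RingHom.quotientKerEquivOfSurjective (ZMod.ringHom_surjective π)).toEquiv,
    Nat.card_zmod]

include hz hl in
lemma smul_ker_injective {g h : k ≃ₐ[ℚ] k} (hgh : g • RingHom.ker π = h • RingHom.ker π) :
    g = h := by
  have hπ := isPrimitiveRoot_map hz hl π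
  have hnat (g : k ≃ₐ[ℚ] k) (n : ℕ) : g • (n : 𝓞 k) = n :=
    map_natCast (MulSemiringAction.toRingHom _ (𝓞 k) g) n
  have hkey (g : k ≃ₐ[ℚ] k) (n : ℕ) : z - n ∈ g • RingHom.ker π ↔
      π z ^ (cyc p k g⁻¹ : ZMod p).val = n := by
    rw [mem_smul_ker, smul_sub, hnat, smul_root hz, map_sub, map_pow, map_natCast, sub_eq_zero]
  obtain ⟨n, hn⟩ : ∃ n : ℕ, π z ^ (cyc p k g⁻¹ : ZMod p).val = n :=
    ⟨_, (ZMod.natCast_zmod_val _).symm⟩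
  have h1 := (hkey g n).mpr hn
  rw [hgh, hkey, ← hn] at h1
  have h2 := hπ.pow_inj (ZMod.val_lt _) (ZMod.val_lt _) h1
  have h3 := (cyc p k).injective (Units.ext (ZMod.val_injective p h2))
  exact (inv_injective h3).symm

include hz hl in
lemma pairwise_isCoprime_smul_ker :
    Pairwise fun g h : k ≃ₐ[ℚ] k ↦ IsCoprime (g • RingHom.ker π) (h • RingHom.ker π) := by
  intro g h hgh
  rw [Ideal.isCoprime_iff_sup_eq]
  exact (isMaximal_smul (isMaximal_ker π) g).coprime_of_ne (isMaximal_smul (isMaximal_ker π) h)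
    fun h' ↦ hgh (smul_ker_injective hz hl π h')

include hz hl in
lemma span_natCast_eq_prod_smul_ker :
    Ideal.span {(ℓ : 𝓞 k)} = ∏ g : k ≃ₐ[ℚ] k, g • RingHom.ker π := by
  have : IsGalois ℚ k := IsCyclotomicExtension.isGalois {p} ℚ k
  obtain ⟨B, hB⟩ : (∏ g : k ≃ₐ[ℚ] k, g • RingHom.ker π) ∣ Ideal.span {(ℓ : 𝓞 k)} :=
    Finset.prod_dvd_of_coprime (fun g _ h _ hgh ↦ pairwise_isCoprime_smul_ker hz hl π hgh)
      fun g _ ↦ Ideal.dvd_iff_le.mpr (by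
        rw [smul_ker, Ideal.span_singleton_le_iff_mem, RingHom.mem_ker, map_natCast,
          CharP.cast_eq_zero])
  have hn := congrArg Ideal.absNorm hB
  rw [map_mul, map_prod, Finset.prod_congr rfl fun g _ ↦
    (by rw [smul_ker, absNorm_ker] : Ideal.absNorm (g • RingHom.ker π) = ℓ),
    Finset.prod_const, Finset.card_univ, ← Nat.card_eq_fintype_card, IsGalois.card_aut_eq_finrank,
    Ideal.absNorm_span_singleton] at hn
  have h1 : (Algebra.norm ℤ (ℓ : 𝓞 k)).natAbs = ℓ ^ Module.finrank ℚ k := by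
    have := Algebra.norm_algebraMap (S := 𝓞 k) (ℓ : ℤ)
    rw [map_natCast, RingOfIntegers.rank] at this
    rw [this, Int.natAbs_pow, Int.natAbs_natCast]
  rw [h1] at hn
  have h2 : Ideal.absNorm B = 1 := by
    have := pow_pos (Fact.out : ℓ.Prime).pos (Module.finrank ℚ k)
    exact (Nat.eq_of_mul_eq_mul_left this (by rw [← hn, mul_one]))
  rw [hB, Ideal.absNorm_eq_one_iff.mp h2, Ideal.mul_top]

variable {e : ℕ} (he : e * p = ℓ - 1) {χ : MulChar (ZMod ℓ) (𝓞 k)} (hχp : χ ^ p = 1) (hχ1 : χ ≠ 1)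
  (hχ : ∀ x, π (χ x) = x ^ e)

include hχp hχ1 in
lemma orderOf_powerResidue : orderOf χ = p := orderOf_eq_prime hχp hχ1

include hz hχp hχ1 hl in
lemma jacobiSum_mul_conj {b : ℕ} (hb : 1 ≤ b) (hbp : b + 1 < p) :
    jacobiSum χ (χ ^ b) * (conj p k • jacobiSum χ (χ ^ b)) = ℓ := by
  have hinj : Function.Injective (algebraMap (𝓞 k) k) := RingOfIntegers.coe_injective
  apply hinj
  have ho := orderOf_powerResidue hχp hχ1
  have hval : ((-1 : (ZMod p)ˣ) : ZMod p).val = p - 1 := by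
    have := Nat.exists_eq_add_of_le' (Fact.out : p.Prime).one_le
    obtain ⟨p', rfl⟩ := this
    simp [ZMod.val_neg_one]
  have hinv : χ ^ (p - 1) = χ⁻¹ := by
    refine (inv_eq_of_mul_eq_one_right ?_).symm
    rw [← pow_succ', Nat.sub_add_cancel (Fact.out : p.Prime).one_le, hχp]
  have hs := smul_jacobiSum hz hχp (conj p k) 1 b
  rw [pow_one, cyc_conj, hval, one_mul, hinv, mul_comm b, pow_mul, hinv, inv_pow] at hs
  rw [hs, map_mul, ← jacobiSum_ringHomComp, ← jacobiSum_ringHomComp, map_natCast]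
  have hne (n : ℕ) (hn : 1 ≤ n) (hnp : n < p) : χ ^ n ≠ 1 := by
    intro h
    have := Nat.le_of_dvd hn (ho ▸ orderOf_dvd_of_pow_eq_one h)
    omega
  have hcomp (ψ : MulChar (ZMod ℓ) (𝓞 k)) (hψ : ψ ≠ 1) :
      ψ.ringHomComp (algebraMap (𝓞 k) k) ≠ 1 := by
    rwa [Ne, MulChar.ringHomComp_eq_one_iff hinj]
  rw [← MulChar.ringHomComp_inv, ← MulChar.ringHomComp_inv,
    jacobiSum_mul_jacobiSum_inv ?_ (hcomp _ hχ1) (hcomp _ (hne b hb (by omega))) ?_, ZMod.card]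
  · rw [ringChar.eq_zero, ZMod.ringChar_zmod_n]
    exact (NeZero.ne ℓ).symm
  · rw [← MulChar.ringHomComp_mul]
    refine hcomp _ ?_
    rw [← pow_succ']
    exact hne _ (by omega) hbp

include hz hl he hχp hχ1 hχ in
/-- Stickelberger's factorization of Jacobi sums. -/
lemma span_jacobiSum {b : ℕ} (hb : 1 ≤ b) (hbp : b + 1 < p) :
    Ideal.span {jacobiSum χ (χ ^ b)} = ∏ g : k ≃ₐ[ℚ] k with
      (cyc p k g⁻¹ : ZMod p).val + b * (cyc p k g⁻¹ : ZMod p).val % p < p, g • RingHom.ker π := by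
  have hJ := jacobiSum_mul_conj hz hl hχp hχ1 hb hbp
  have hspan : Ideal.span {jacobiSum χ (χ ^ b)} * Ideal.span {conj p k • jacobiSum χ (χ ^ b)} =
      ∏ g : k ≃ₐ[ℚ] k, g • RingHom.ker π := by
    rw [Ideal.span_singleton_mul_span_singleton, hJ, span_natCast_eq_prod_smul_ker hz hl π]
  have hmod {t : ℕ} (ht : t ≠ 0) (htp : t < p) {c : ℕ} (hc : c ≠ 0) (hcp : c < p) :
      c * t % p ≠ 0 := by
    rw [Ne, ← Nat.dvd_iff_mod_eq_zero, (Fact.out : p.Prime).dvd_mul]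
    rintro (h | h)
    · exact absurd (Nat.le_of_dvd (by omega) h) (by omega)
    · exact absurd (Nat.le_of_dvd (by omega) h) (by omega)
  have hzero (g : k ≃ₐ[ℚ] k) (h : (cyc p k g : ZMod p).val + b * (cyc p k g : ZMod p).val % p < p) :
      π (g • jacobiSum χ (χ ^ b)) = 0 := by
    have hs := smul_jacobiSum hz hχp g 1 b
    rw [pow_one, one_mul] at hs
    have hval : (cyc p k g : ZMod p).val ≠ 0 := by
      rw [Ne, ZMod.val_eq_zero]; exact Units.ne_zero _
    rw [hs, pow_eq_pow_mod (b * _) hχp]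
    exact map_jacobiSum π he hχ hval (hmod hval (ZMod.val_lt _) (by omega) (by omega)) h
  refine eq_prod_of_mul_eq_prod (pairwise_isCoprime_smul_ker hz hl π) ?_ hspan _ (fun g hg ↦ ?_)
    fun g hg ↦ ?_
  · rw [Ideal.span_singleton_mul_span_singleton, hJ]
    exact span_natCast_ne_bot (NeZero.ne ℓ)
  · rw [Ideal.span_singleton_le_iff_mem, mem_smul_ker]
    exact hzero _ hg
  · rw [Ideal.span_singleton_le_iff_mem, mem_smul_ker, ← mul_smul]
    apply hzero
    have hval : (cyc p k g⁻¹ : ZMod p).val ≠ 0 := by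
      rw [Ne, ZMod.val_eq_zero]; exact Units.ne_zero _
    have hlt := ZMod.val_lt (cyc p k g⁻¹ : ZMod p)
    have hneg : (cyc p k (g⁻¹ * conj p k) : ZMod p).val = p - (cyc p k g⁻¹ : ZMod p).val := by
      rw [map_mul, cyc_conj, mul_neg, mul_one, Units.val_neg]
      rw [ZMod.neg_val, if_neg (Units.ne_zero _)]
    rw [hneg]
    set t := (cyc p k g⁻¹ : ZMod p).val
    have h1 := hmod hval hlt (c := b) (by omega) (by omega)
    have h2 := hmod hval hlt (c := b + 1) (by omega) (by omega)
    have h3 := Nat.mod_lt (b * t) (show p > 0 by omega)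
    have h4 : t + b * t % p ≠ p := by
      intro h
      apply h2
      rw [add_mul, one_mul, add_comm, ← Nat.add_mod_mod, h, Nat.mod_self]
    have h5 : b * (p - t) % p = p - b * t % p := by
      have : b * (p - t) + b * t = p * b := by rw [← mul_add, Nat.sub_add_cancel hlt.le, mul_comm]
      have h6 := Nat.mod_add_div (b * t) p
      have h7 : b * (p - t) = (p - b * t % p) + p * (b - 1 - b * t / p) := by
        have h8 : b * t / p < b := (Nat.div_lt_iff_lt_mul (by omega)).mpr
          (Nat.mul_lt_mul_of_pos_left hlt (by omega))
        zify [show b * t / p ≤ b - 1 by omega, show 1 ≤ b by omega, h3.le, hlt.le] at this h6 ⊢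
        linear_combination this + h6
      rw [h7, Nat.add_mul_mod_self_left, Nat.mod_eq_of_lt (by omega)]
    rw [h5]
    omega

end Factor

section Evaluate
set_option linter.unusedSectionVars false
variable {p : ℕ} [Fact p.Prime] {k : Type*} [Field k] [NumberField k]
  [IsCyclotomicExtension {p} ℚ k] {z : 𝓞 k} (hz : IsPrimitiveRoot z p)
  {ℓ : ℕ} [Fact ℓ.Prime] (hl : ℓ ≠ p) (π : 𝓞 k →+* ZMod ℓ)

lemma sum_cyc (hp2 : p ≠ 2) :
    ∑ g : k ≃ₐ[ℚ] k, (cyc p k g : ZMod p) = 0 := by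
  have h2 := two_ne_zero_zmod hp2
  obtain ⟨g, hg⟩ := exists_cyc_eq (k := k) h2
  have h1 : ∑ h : k ≃ₐ[ℚ] k, (cyc p k h : ZMod p) = ∑ h : k ≃ₐ[ℚ] k, 2 * (cyc p k h : ZMod p) := by
    rw [← Equiv.sum_comp (Equiv.mulLeft g)]
    simp [hg]
  rw [← Finset.mul_sum] at h1
  linear_combination -h1

lemma sum_card_filter (hp2 : p ≠ 2) :
    ∑ b ∈ Finset.Ico 1 (p - 1), ∑ g : k ≃ₐ[ℚ] k with
      (cyc p k g⁻¹ : ZMod p).val + b * (cyc p k g⁻¹ : ZMod p).val % p < p, (cyc p k g : ZMod p) =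
      1 := by
  simp_rw [Finset.sum_filter]
  rw [Finset.sum_comm]
  have h1 (g : k ≃ₐ[ℚ] k) : (∑ b ∈ Finset.Ico 1 (p - 1), if
      (cyc p k g⁻¹ : ZMod p).val + b * (cyc p k g⁻¹ : ZMod p).val % p < p then
        (cyc p k g : ZMod p) else 0) = - (cyc p k g : ZMod p) - 1 := by
    have hpos : 1 ≤ (cyc p k g⁻¹ : ZMod p).val := by
      rw [Nat.one_le_iff_ne_zero, Ne, ZMod.val_eq_zero]
      exact Units.ne_zero _
    have := congrArg (Int.cast : ℤ → ZMod p) (card_filter_no_carry (Fact.out : p.Prime).two_le hpos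
      (ZMod.val_lt _))
    rw [← Finset.sum_filter, Finset.sum_const, nsmul_eq_mul]
    push_cast at this
    rw [this, CharP.cast_eq_zero, ZMod.natCast_zmod_val, map_inv, Units.val_inv_eq_inv_val]
    have := Units.ne_zero (cyc p k g)
    field_simp
    ring
  rw [Finset.sum_congr rfl fun g _ ↦ h1 g, Finset.sum_sub_distrib, Finset.sum_neg_distrib,
    sum_cyc hp2, Finset.sum_const, Finset.card_univ, Fintype.card_congr (cyc p k).toEquiv,
    ZMod.card_units_eq_totient, Nat.totient_prime Fact.out, nsmul_eq_mul,
    Nat.cast_sub (Fact.out : p.Prime).one_le, CharP.cast_eq_zero]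
  simp

variable {e : ℕ} (he : e * p = ℓ - 1) {χ : MulChar (ZMod ℓ) (𝓞 k)} (hχp : χ ^ p = 1) (hχ1 : χ ≠ 1)
  (hχ : ∀ x, π (χ x) = x ^ e) {m : Ideal (𝓞 k)} {a : Ideal (𝓞 k) → ZMod p}

/-- The `p`-th power of the Gauss sum of `χ`. -/
def gaussPow (p : ℕ) (χ : MulChar (ZMod ℓ) (𝓞 k)) : 𝓞 k :=
  χ (-1) * (ℓ : 𝓞 k) * ∏ b ∈ Finset.Ico 1 (p - 1), jacobiSum χ (χ ^ b)

include hz hl he hχp hχ1 hχ in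
/-- An equivariant ray class character takes the same value on a degree one prime and on the
`p`-th power of its Gauss sum. -/
lemma rayChar_gaussPow (hp2 : p ≠ 2) (ha : IsRayChar m a) (hm : ∀ g : k ≃ₐ[ℚ] k, g • m = m)
    (hag : ∀ (g : k ≃ₐ[ℚ] k) I, IsCoprime I m → a (g • I) = cyc p k g * a I)
    (hq : IsCoprime (RingHom.ker π) m) :
    IsCoprime (Ideal.span {gaussPow p χ}) m ∧
      a (Ideal.span {gaussPow p χ}) = a (RingHom.ker π) := by
  have hgq (g : k ≃ₐ[ℚ] k) : IsCoprime (g • RingHom.ker π) m := isCoprime_smul hm g hq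
  have hS (S : Finset (k ≃ₐ[ℚ] k)) : IsCoprime (∏ g ∈ S, g • RingHom.ker π) m :=
    IsCoprime.prod_left fun g _ ↦ hgq g
  have haS (S : Finset (k ≃ₐ[ℚ] k)) : a (∏ g ∈ S, g • RingHom.ker π) =
      (∑ g ∈ S, (cyc p k g : ZMod p)) * a (RingHom.ker π) := by
    rw [ha.map_prod _ _ fun g _ ↦ hgq g, Finset.sum_mul]
    exact Finset.sum_congr rfl fun g _ ↦ hag g _ hq
  have hunit : IsUnit (χ (-1)) := isUnit_one.neg.map χ
  have hspan : Ideal.span {gaussPow p χ} = (∏ g : k ≃ₐ[ℚ] k, g • RingHom.ker π) *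
      ∏ b ∈ Finset.Ico 1 (p - 1), ∏ g : k ≃ₐ[ℚ] k with (cyc p k g⁻¹ : ZMod p).val +
        b * (cyc p k g⁻¹ : ZMod p).val % p < p, g • RingHom.ker π := by
    rw [gaussPow, mul_assoc, Ideal.span_singleton_mul_left_unit hunit,
      ← Ideal.span_singleton_mul_span_singleton, span_natCast_eq_prod_smul_ker hz hl π,
      ← Ideal.prod_span_singleton]
    congr 1
    refine Finset.prod_congr rfl fun b hb ↦ ?_
    rw [Finset.mem_Ico] at hb
    exact span_jacobiSum hz hl π he hχp hχ1 hχ hb.1 (by omega)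
  rw [hspan]
  refine ⟨(hS _).mul_left (IsCoprime.prod_left fun b _ ↦ hS _), ?_⟩
  rw [ha.map_mul _ _ (hS _) (IsCoprime.prod_left fun b _ ↦ hS _), haS,
    ha.map_prod _ _ fun b _ ↦ hS _, Finset.sum_congr rfl fun b _ ↦ haS _, ← Finset.sum_mul,
    sum_card_filter hp2, sum_cyc hp2, zero_mul, zero_add, one_mul]

include hχp hχ1 in
lemma gaussSum_pow_eq {R : Type*} [CommRing R] [IsDomain R] (φ : 𝓞 k →+* R)
    (h : χ.ringHomComp φ ≠ 1) {ψ : AddChar (ZMod ℓ) R} (hψ : ψ.IsPrimitive) :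
    gaussSum (χ.ringHomComp φ) ψ ^ p = φ (gaussPow p χ) := by
  have ho : orderOf (χ.ringHomComp φ) = p :=
    orderOf_eq_prime (by rw [MulChar.ringHomComp_pow, hχp, MulChar.ringHomComp_one]) h
  have := gaussSum_pow_eq_prod_jacobiSum (ho ▸ (Fact.out : p.Prime).two_le :
    2 ≤ orderOf (χ.ringHomComp φ)) hψ
  rw [ho] at this
  rw [this, gaussPow, map_mul, map_mul, map_prod, ZMod.card, map_natCast, MulChar.ringHomComp_apply]
  congr 1
  refine Finset.prod_congr rfl fun b _ ↦ ?_
  rw [MulChar.ringHomComp_pow, jacobiSum_ringHomComp]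

end Evaluate

section Congruence
set_option linter.unusedSectionVars false

lemma mem_range_of_pow_card_eq {κ F : Type*} [Field κ] [Fintype κ] [Field F] [Algebra κ F] {x : F}
    (hx : x ^ Fintype.card κ = x) : ∃ y : κ, algebraMap κ F y = x := by
  obtain ⟨f, hf⟩ : ∃ f : Polynomial F, f = Polynomial.X ^ Fintype.card κ - Polynomial.X := ⟨_, rfl⟩
  have hf0 : f ≠ 0 := hf ▸ FiniteField.X_pow_card_sub_X_ne_zero F Fintype.one_lt_card
  have hmem (y : F) : y ∈ f.roots.toFinset ↔ y ^ Fintype.card κ = y := by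
    rw [Multiset.mem_toFinset, Polynomial.mem_roots hf0, hf]
    simp [sub_eq_zero]
  have hsub : Finset.univ.image (algebraMap κ F) ⊆ f.roots.toFinset := by
    intro y hy
    obtain ⟨y, -, rfl⟩ := Finset.mem_image.mp hy
    rw [hmem, ← map_pow, FiniteField.pow_card]
  have heq := Finset.eq_of_subset_of_card_le hsub (by
    rw [Finset.card_image_of_injective _ (algebraMap κ F).injective, Finset.card_univ]
    refine (Multiset.toFinset_card_le _).trans ((Polynomial.card_roots' f).trans ?_)
    rw [hf, FiniteField.X_pow_card_sub_X_natDegree_eq F Fintype.one_lt_card])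
  have := (hmem x).mpr hx
  rw [← heq] at this
  obtain ⟨y, -, hy⟩ := Finset.mem_image.mp this
  exact ⟨y, hy⟩

variable {p : ℕ} [Fact p.Prime] {k : Type*} [Field k] [NumberField k]

lemma exists_sub_mem {v : Ideal (𝓞 k)} [v.IsMaximal] {E : Ideal (𝓞 k)}
    (hE : IsCoprime (core (k ≃ₐ[ℚ] k) v) E) (y : Ideal (𝓞 k) → 𝓞 k) (e : 𝓞 k) :
    ∃ w, (∀ g : k ≃ₐ[ℚ] k, w - y (g • v) ∈ g • v) ∧ w - e ∈ E := by
  obtain ⟨S, hS⟩ : ∃ S : Finset (Ideal (𝓞 k)), S = Finset.univ.image fun g : k ≃ₐ[ℚ] k ↦ g • v :=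
    ⟨_, rfl⟩
  have hmax (P) (hP : P ∈ S) : P.IsMaximal := by
    rw [hS] at hP
    obtain ⟨g, -, rfl⟩ := Finset.mem_image.mp hP
    exact isMaximal_smul ‹_› g
  obtain ⟨w, hw⟩ := Ideal.exists_forall_sub_mem_ideal (I := fun P : S ↦ (P : Ideal (𝓞 k)))
    (fun P Q hPQ ↦ Ideal.isCoprime_iff_sup_eq.mpr
      ((hmax P P.2).coprime_of_ne (hmax Q Q.2) fun h ↦ hPQ (Subtype.ext h))) (fun P ↦ y P)
  obtain ⟨i, hi, j, hj, hij⟩ := Ideal.isCoprime_iff_exists.mp hE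
  refine ⟨w * j + e * i, fun g ↦ ?_, ?_⟩
  · have h1 := hw ⟨g • v, hS ▸ Finset.mem_image_of_mem _ (Finset.mem_univ g)⟩
    have h2 := mem_core.mp hi g
    have : w * j + e * i - y (g • v) = (w - y (g • v)) + (e - w) * i := by
      linear_combination w * hij
    rw [this]
    exact (g • v).add_mem h1 ((g • v).mul_mem_left _ h2)
  · have : w * j + e * i - e = (w - e) * j := by linear_combination e * hij
    rw [this]
    exact E.mul_mem_left _ hj

variable [IsCyclotomicExtension {p} ℚ k] {z : 𝓞 k} (hz : IsPrimitiveRoot z p)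
  {N : ℕ} (hN : N.Prime) (hcong : (N : ZMod p) = -1) {v : Ideal (𝓞 k)}

include hz hN hcong in
lemma isPrimitiveRoot_mk [v.IsMaximal] (hv : (N : 𝓞 k) ∈ v) :
    IsPrimitiveRoot (Ideal.Quotient.mk v z) p := by
  rw [IsPrimitiveRoot.iff_orderOf]
  refine orderOf_eq_prime (by rw [← map_pow, hz.pow_eq_one, map_one]) fun h ↦ ?_
  have h1 : (p : 𝓞 k) ∈ v := natCast_mem_of_sub_one_mem hz (by
    rw [← Ideal.Quotient.eq_zero_iff_mem, map_sub, h, map_one, sub_self])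
  have h2 := isCoprime_span_natCast hN hcong hv
  rw [Ideal.isCoprime_iff_sup_eq, sup_eq_left.mpr ((Ideal.span_singleton_le_iff_mem _).mpr h1)] at h2
  exact Ideal.IsMaximal.ne_top ‹_› h2

include hz hN hcong in
lemma pow_sq_eq [v.IsMaximal] (hv : (N : 𝓞 k) ∈ v) (x : 𝓞 k ⧸ v) : x ^ (N ^ 2) = x := by
  obtain ⟨x, rfl⟩ := Ideal.Quotient.mk_surjective x
  have h (x) : Ideal.Quotient.mk v (conj p k • x) = Ideal.Quotient.mk v x ^ N := by
    rw [← map_pow, Ideal.Quotient.mk_eq_mk_iff_sub_mem]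
    exact conj_smul_sub_pow_mem hz hN hcong hv x
  rw [pow_two, pow_mul, ← h, ← h, conj_smul_conj_smul]

include hz hN hcong in
lemma card_quotient (hp2 : p ≠ 2) [v.IsMaximal] (hv : (N : 𝓞 k) ∈ v) [Fintype (𝓞 k ⧸ v)] :
    Fintype.card (𝓞 k ⧸ v) = N ^ 2 := by
  let := Ideal.Quotient.field v
  have := charP_quotient hN hv
  obtain ⟨f, -, hf⟩ := FiniteField.card (𝓞 k ⧸ v) N
  have hroot := isPrimitiveRoot_mk hz hN hcong hv
  have hf1 : (f : ℕ) ≠ 1 := by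
    intro h
    rw [h, pow_one] at hf
    have h1 := FiniteField.pow_card (Ideal.Quotient.mk v z)
    have hdvd : p ∣ N + 1 := by
      rw [← ZMod.natCast_eq_zero_iff, Nat.cast_add, hcong]
      simp
    have h2 : Ideal.Quotient.mk v z ^ (N + 1) = 1 := hroot.pow_eq_one_iff_dvd _ |>.mpr hdvd
    rw [pow_succ, ← hf, h1, ← pow_two, hroot.pow_eq_one_iff_dvd] at h2
    exact hp2 ((Nat.prime_dvd_prime_iff_eq Fact.out Nat.prime_two).mp h2)
  have hf2 : 2 ≤ (f : ℕ) := by have := f.pos; omega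
  refine le_antisymm ?_ (hf ▸ Nat.pow_le_pow_right hN.pos hf2)
  have hN2 : 1 < N ^ 2 := Nat.one_lt_pow two_ne_zero hN.one_lt
  have hdeg := FiniteField.X_pow_card_sub_X_natDegree_eq (𝓞 k ⧸ v) hN2
  rw [← hdeg, ← Finset.card_univ]
  refine Polynomial.card_le_degree_of_subset_roots fun x _ ↦ ?_
  rw [Polynomial.mem_roots (FiniteField.X_pow_card_sub_X_ne_zero _ hN2)]
  simp [pow_sq_eq hz hN hcong hv x]

variable {ℓ : ℕ} [Fact ℓ.Prime] {χ : MulChar (ZMod ℓ) (𝓞 k)} (hχp : χ ^ p = 1) (hχ1 : χ ≠ 1)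

include hz hχp in
lemma exists_apply_eq_pow {x : ZMod ℓ} (hx : x ≠ 0) : ∃ i < p, χ x = z ^ i := by
  have h1 : (χ x) ^ p = 1 := by
    have := MulChar.pow_apply_coe χ p (Units.mk0 x hx)
    rw [Units.val_mk0] at this
    rw [← this, hχp]
    exact MulChar.one_apply (Ne.isUnit hx)
  obtain ⟨i, hi, h⟩ := hz.eq_pow_of_pow_eq_one h1
  exact ⟨i, hi, h.symm⟩

include hz hχp hχ1 in
lemma ringHomComp_ne_one {R : Type*} [CommRing R] (φ : 𝓞 k →+* R)
    (hφ : IsPrimitiveRoot (φ z) p) : χ.ringHomComp φ ≠ 1 := by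
  intro h
  refine hχ1 (MulChar.ext fun u ↦ ?_)
  obtain ⟨i, hi, hu⟩ := exists_apply_eq_pow hz hχp u.ne_zero
  have h1 := congrArg (fun c ↦ c (u : ZMod ℓ)) h
  simp only [MulChar.ringHomComp_apply, MulChar.one_apply_coe, hu, map_pow] at h1
  have h2 := (hφ.pow_eq_one_iff_dvd i).mp h1
  rw [hu, (hz.pow_eq_one_iff_dvd i).mpr h2, MulChar.one_apply_coe]

include hz hN hcong hχp hχ1 in
lemma exists_gaussPow_sub_pow_mem (hp2 : p ≠ 2) [v.IsMaximal] (hv : (N : 𝓞 k) ∈ v) (hNl : N ≠ ℓ)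
    (hχN : χ N = 1) : ∃ y, gaussPow p χ - y ^ p ∈ v := by
  let := Ideal.Quotient.field v
  have hfin : Finite (𝓞 k ⧸ v) := Ideal.finiteQuotientOfFreeOfNeBot v (ne_bot_of_natCast_mem hN hv)
  let := Fintype.ofFinite (𝓞 k ⧸ v)
  have := charP_quotient hN hv
  let F := AlgebraicClosure (𝓞 k ⧸ v)
  have : CharP F N := charP_of_injective_algebraMap (algebraMap (𝓞 k ⧸ v) F).injective N
  have : Fact N.Prime := ⟨hN⟩
  have hlN : ((ℓ : ℕ) : F) ≠ 0 := by
    rw [Ne, CharP.cast_eq_zero_iff F N]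
    exact fun h ↦ hNl ((Nat.prime_dvd_prime_iff_eq hN Fact.out).mp h)
  have : NeZero ((ℓ : ℕ) : F) := ⟨hlN⟩
  obtain ⟨ζ, hζ⟩ := HasEnoughRootsOfUnity.exists_primitiveRoot F ℓ
  let ψ : AddChar (ZMod ℓ) F := AddChar.zmodChar ℓ hζ.pow_eq_one
  have hψ : ψ.IsPrimitive := AddChar.zmodChar_primitive_of_primitive_root ℓ hζ
  let φ : 𝓞 k →+* F := (algebraMap (𝓞 k ⧸ v) F).comp (Ideal.Quotient.mk v)
  have hφ : IsPrimitiveRoot (φ z) p :=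
    (isPrimitiveRoot_mk hz hN hcong hv).map_of_injective (algebraMap (𝓞 k ⧸ v) F).injective
  have hg := gaussSum_pow_eq hχp hχ1 φ (ringHomComp_ne_one hz hχp hχ1 φ hφ) hψ
  obtain ⟨g, hgdef⟩ : ∃ g, g = gaussSum (χ.ringHomComp φ) ψ := ⟨_, rfl⟩
  rw [← hgdef] at hg
  have hNu : IsUnit (N : ZMod ℓ) := by
    rw [isUnit_iff_ne_zero, Ne, ZMod.natCast_eq_zero_iff]
    exact fun h ↦ hNl ((Nat.prime_dvd_prime_iff_eq Fact.out hN).mp h).symm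
  have hN2 : (χ.ringHomComp φ) ^ (N ^ 2) = χ.ringHomComp φ := by
    have h1 : N ^ 2 % p = 1 % p := by
      rw [← Nat.ModEq, ← ZMod.natCast_eq_natCast_iff]
      push_cast
      rw [hcong]; norm_num
    rw [MulChar.ringHomComp_pow, pow_eq_pow_mod (N ^ 2) hχp, h1, ← pow_eq_pow_mod 1 hχp, pow_one]
  have hfrob : g ^ (N ^ 2) = g := by
    rw [hgdef, pow_two, pow_mul, gaussSum_frob, gaussSum_frob, ← pow_mul, ← pow_mul, ← pow_two, hN2,
      AddChar.pow_mulShift, ← gaussSum_mulShift (χ.ringHomComp φ) ψ (hNu.pow 2).unit]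
    rw [IsUnit.unit_spec, map_pow, MulChar.ringHomComp_apply, hχN, map_one, one_pow, one_mul,
      Nat.cast_pow]
  rw [← card_quotient hz hN hcong hp2 hv] at hfrob
  obtain ⟨y, hy⟩ := mem_range_of_pow_card_eq hfrob
  obtain ⟨y, rfl⟩ := Ideal.Quotient.mk_surjective y
  refine ⟨y, ?_⟩
  rw [← Ideal.Quotient.mk_eq_mk_iff_sub_mem]
  apply (algebraMap (𝓞 k ⧸ v) F).injective
  rw [map_pow, map_pow, hy, hg]
  rfl

include hz hχp hχ1 in
lemma gaussPow_add_one_mem (hp2 : p ≠ 2) : gaussPow p χ + 1 ∈ Ideal.span {(p : 𝓞 k)} := by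
  have hpodd : Odd p := (Fact.out : p.Prime).odd_of_ne_two hp2
  let L := CyclotomicField ℓ k
  have : NeZero ((ℓ : ℕ) : k) := ⟨Nat.cast_ne_zero.mpr (NeZero.ne ℓ)⟩
  have : NumberField L := IsCyclotomicExtension.numberField {ℓ} k L
  obtain ⟨ζ, hζ⟩ : ∃ ζ : 𝓞 L, IsPrimitiveRoot ζ ℓ :=
    ⟨_, (IsCyclotomicExtension.zeta_spec ℓ k L).toInteger_isPrimitiveRoot⟩
  let ψ : AddChar (ZMod ℓ) (𝓞 L) := AddChar.zmodChar ℓ hζ.pow_eq_one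
  have hψ : ψ.IsPrimitive := AddChar.zmodChar_primitive_of_primitive_root ℓ hζ
  have hψ1 : ψ ≠ 1 := by
    have := hψ one_ne_zero
    rwa [AddChar.mulShift_one] at this
  obtain ⟨φ, hφ⟩ : ∃ φ : 𝓞 k →+* 𝓞 L, φ = algebraMap (𝓞 k) (𝓞 L) := ⟨_, rfl⟩
  have hφi : Function.Injective φ := by
    rw [hφ]
    exact FaithfulSMul.algebraMap_injective (𝓞 k) (𝓞 L)
  have hg := gaussSum_pow_eq hχp hχ1 φ
    (ringHomComp_ne_one hz hχp hχ1 φ (hz.map_of_injective hφi)) hψ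
  obtain ⟨w, hw⟩ : ∃ w, gaussSum (χ.ringHomComp φ) ψ = w * (φ z - 1) + (-1) := by
    have h1 (x : ZMod ℓ) (hx : x ∈ Finset.univ.erase (0 : ZMod ℓ)) :
        ∃ c, χ.ringHomComp φ x * ψ x = c * (φ z - 1) + ψ x := by
      obtain ⟨i, -, hi⟩ := exists_apply_eq_pow hz hχp (Finset.mem_erase.mp hx).1
      obtain ⟨c, hc⟩ := sub_one_dvd_pow_sub_one (φ z) i
      exact ⟨c * ψ x, by
        rw [MulChar.ringHomComp_apply, hi, map_pow]
        linear_combination ψ x * hc⟩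
    choose! c hc using h1
    refine ⟨∑ x ∈ Finset.univ.erase 0, c x, ?_⟩
    have h2 := AddChar.sum_eq_zero_of_ne_one hψ1
    rw [← Finset.add_sum_erase _ _ (Finset.mem_univ (0 : ZMod ℓ)), AddChar.map_zero_eq_one] at h2
    rw [gaussSum, ← Finset.add_sum_erase _ _ (Finset.mem_univ (0 : ZMod ℓ)), MulChar.map_zero,
      zero_mul, zero_add, Finset.sum_congr rfl hc, Finset.sum_add_distrib, Finset.sum_mul]
    linear_combination h2
  obtain ⟨r, hr⟩ := exists_add_pow_prime_eq (Fact.out : p.Prime) (w * (φ z - 1)) (-1)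
  obtain ⟨s, hs⟩ := exists_add_pow_prime_eq (Fact.out : p.Prime) (φ z) (-1)
  have hzp : φ z ^ p = 1 := by rw [← map_pow, hz.pow_eq_one, map_one]
  rw [← sub_eq_add_neg, hpodd.neg_one_pow, hzp] at hs
  rw [hw, hr, mul_pow, hs, hpodd.neg_one_pow] at hg
  have hmem : φ (gaussPow p χ + 1) ∈ Ideal.span {(p : 𝓞 L)} :=
    Ideal.mem_span_singleton'.mpr ⟨-(w ^ p * φ z * s) - w * (φ z - 1) * r, by
      rw [map_add, map_one, ← hg]; ring⟩
  rw [← Ideal.comap_map_eq_self_of_faithfullyFlat (B := 𝓞 L) (Ideal.span {(p : 𝓞 k)}),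
    Ideal.mem_comap, Ideal.map_span, Set.image_singleton, map_natCast, ← hφ]
  exact hmem

include hz hN hcong in
/-- If `N` is a `p`-th power modulo `ℓ`, then an equivariant ray character modulo the conductor
vanishes on the primes above `ℓ`. -/
theorem rayChar_ker_eq_zero (hp2 : p ≠ 2) [v.IsMaximal] (hv : (N : 𝓞 k) ∈ v) (hl : ℓ ≠ p)
    (hNl : N ≠ ℓ) (π : 𝓞 k →+* ZMod ℓ) (hpow : ∃ y : ZMod ℓ, y ^ p = N)
    {a : Ideal (𝓞 k) → ZMod p} (ha : IsRayChar (conductor p v) a)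
    (hag : ∀ (g : k ≃ₐ[ℚ] k) I, IsCoprime I (conductor p v) → a (g • I) = cyc p k g * a I)
    (hq : IsCoprime (RingHom.ker π) (conductor p v)) : a (RingHom.ker π) = 0 := by
  obtain ⟨e, he, χ, hχp, hχ1, hχ⟩ := exists_powerResidue hz hl π
  have hχN : χ N = 1 := by
    obtain ⟨y, hy⟩ := hpow
    have hy0 : y ≠ 0 := by
      rintro rfl
      rw [zero_pow (NeZero.ne p), eq_comm, ZMod.natCast_eq_zero_iff] at hy
      exact hNl ((Nat.prime_dvd_prime_iff_eq Fact.out hN).mp hy).symm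
    rw [← hy, map_pow]
    obtain ⟨i, -, hi⟩ := exists_apply_eq_pow hz hχp hy0
    rw [hi, ← pow_mul, mul_comm, pow_mul, hz.pow_eq_one, one_pow]
  obtain ⟨hcop, hval⟩ := rayChar_gaussPow hz hl π he hχp hχ1 hχ hp2 ha
    (smul_conductor hN hcong hv) hag hq
  have hloc (g : k ≃ₐ[ℚ] k) : ∃ y, gaussPow p χ - y ^ p ∈ g • v := by
    have := isMaximal_smul (v := v) ‹_› g
    exact exists_gaussPow_sub_pow_mem hz hN hcong hχp hχ1 hp2 (natCast_mem_smul hN hv g) hNl hχN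
  have hloc' (P : Ideal (𝓞 k)) (hP : ∃ g : k ≃ₐ[ℚ] k, P = g • v) :
      ∃ y, gaussPow p χ - y ^ p ∈ P := by
    obtain ⟨g, rfl⟩ := hP
    exact hloc g
  choose! y hy using hloc'
  obtain ⟨w, hw1, hw2⟩ := exists_sub_mem (isCoprime_core_span_natCast hN hcong hv) y (-1)
  have hpow_sub {J : Ideal (𝓞 k)} {x t : 𝓞 k} (h : x - t ∈ J) : x ^ p - t ^ p ∈ J :=
    J.mem_of_dvd (sub_dvd_pow_sub_pow x t p) h
  have hmem : gaussPow p χ - w ^ p ∈ conductor p v := by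
    refine ⟨mem_core.mpr fun g ↦ ?_, ?_⟩
    · rw [← sub_sub_sub_cancel_right _ _ (y (g • v) ^ p)]
      exact Ideal.sub_mem _ (hy _ ⟨g, rfl⟩) (hpow_sub (hw1 g))
    · have h1 := hpow_sub hw2
      rw [((Fact.out : p.Prime).odd_of_ne_two hp2).neg_one_pow] at h1
      have h2 := Ideal.sub_mem _ (gaussPow_add_one_mem hz hχp hχ1 hp2) h1
      have h3 : gaussPow p χ + 1 - (w ^ p - -1) = gaussPow p χ - w ^ p := by ring
      rwa [h3] at h2
  have hcw := isCoprime_span_of_sub_mem hmem hcop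
  have hcw1 : IsCoprime (Ideal.span {w}) (conductor p v) := by
    rw [← Ideal.span_singleton_pow] at hcw
    exact (IsCoprime.pow_left_iff (Fact.out : p.Prime).pos).mp hcw
  rw [← hval, ha.map_span _ _ hcop hmem, ← Ideal.span_singleton_pow, ha.map_pow hcw1]
  simp

end Congruence

section Extension
set_option linter.unusedSectionVars false
variable {k L : Type*} [Field k] [NumberField k] [Field L] [NumberField L] [Algebra k L]

section Restrict
variable [Normal ℚ k]

/-- The restriction of an automorphism of `L` to the normal subfield `k`. -/
abbrev res (k : Type*) [Field k] [NumberField k] [Algebra k L] [Normal ℚ k] (g : L ≃ₐ[ℚ] L) :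
    k ≃ₐ[ℚ] k := g.restrictNormal k

lemma smul_algebraMap_eq (g : L ≃ₐ[ℚ] L) (x : 𝓞 k) :
    g • algebraMap (𝓞 k) (𝓞 L) x = algebraMap (𝓞 k) (𝓞 L) (res k g • x) :=
  RingOfIntegers.ext (AlgEquiv.restrictNormal_commutes g k x).symm

lemma res_mul (g h : L ≃ₐ[ℚ] L) : res k (g * h) = res k g * res k h :=
  map_mul (AlgEquiv.restrictNormalHom k) g h

lemma res_inv (g : L ≃ₐ[ℚ] L) : res k g⁻¹ = (res k g)⁻¹ :=
  map_inv (AlgEquiv.restrictNormalHom k) g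

lemma res_restrictScalars (s : L ≃ₐ[k] L) : res k (s.restrictScalars ℚ) = 1 := by
  ext x
  apply (algebraMap k L).injective
  rw [AlgEquiv.restrictNormal_commutes]
  exact s.commutes x

lemma intNorm_smul (g : L ≃ₐ[ℚ] L) (x : 𝓞 L) :
    Algebra.intNorm (𝓞 k) (𝓞 L) (g • x) = res k g • Algebra.intNorm (𝓞 k) (𝓞 L) x := by
  apply RingOfIntegers.ext
  have h1 := Algebra.algebraMap_intNorm (A := 𝓞 k) (B := 𝓞 L) (K := k) (L := L) (g • x)
  have h2 := Algebra.algebraMap_intNorm (A := 𝓞 k) (B := 𝓞 L) (K := k) (L := L) x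
  have h3 := Algebra.norm_eq_of_equiv_equiv (res k g).toRingEquiv g.toRingEquiv (by
    ext y
    exact AlgEquiv.restrictNormal_commutes g k y) (x : L)
  refine h1.trans ?_
  have h4 : Algebra.norm k (algebraMap (𝓞 L) L (g • x)) = res k g (Algebra.norm k (x : L)) := by
    rw [h3]
    exact ((res k g).toRingEquiv.apply_symm_apply _).symm
  rw [h4, ← h2]
  rfl

lemma smul_relNorm_le (g : L ≃ₐ[ℚ] L) (I : Ideal (𝓞 L)) :
    res k g • Ideal.relNorm (𝓞 k) I ≤ Ideal.relNorm (𝓞 k) (g • I) := by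
  have h : Ideal.relNorm (𝓞 k) I ≤ (res k g)⁻¹ • Ideal.relNorm (𝓞 k) (g • I) := by
    rw [Ideal.relNorm_apply, Ideal.span_le]
    rintro _ ⟨x, hx, rfl⟩
    rw [SetLike.mem_coe, Ideal.mem_inv_pointwise_smul_iff, ← intNorm_smul]
    exact Ideal.intNorm_mem_spanNorm _ (Ideal.smul_mem_pointwise_smul g x I hx)
  exact Ideal.pointwise_smul_subset_iff.mpr h

theorem relNorm_gal_smul (g : L ≃ₐ[ℚ] L) (I : Ideal (𝓞 L)) :
    Ideal.relNorm (𝓞 k) (g • I) = res k g • Ideal.relNorm (𝓞 k) I := by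
  refine le_antisymm ?_ (smul_relNorm_le g I)
  have h := smul_relNorm_le (k := k) g⁻¹ (g • I)
  rw [inv_smul_smul, res_inv] at h
  exact Ideal.subset_pointwise_smul_iff.mpr h

end Restrict

section Primes
variable [IsGalois k L]

/-- The fundamental identity for a Galois extension. -/
lemma ncard_mul_ramificationIdx_mul_inertiaDeg (P : Ideal (𝓞 L)) [P.IsPrime] :
    ((P.under (𝓞 k)).primesOver (𝓞 L)).ncard *
      (P.ramificationIdx (𝓞 k) * P.inertiaDeg (𝓞 k)) = Module.finrank k L := by
  have := Ideal.ncard_primesOver_mul_ramificationIdxIn_mul_inertiaDegIn (P.under (𝓞 k)) (𝓞 L)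
    (L ≃ₐ[k] L)
  rwa [Ideal.ramificationIdxIn_eq_ramificationIdx _ P (L ≃ₐ[k] L),
    Ideal.inertiaDegIn_eq_inertiaDeg _ P (L ≃ₐ[k] L), IsGalois.card_aut_eq_finrank] at this

lemma exists_sub_algebraMap_mem {P : Ideal (𝓞 L)} [P.IsMaximal]
    (h : P.inertiaDeg (𝓞 k) = 1) (x : 𝓞 L) : ∃ y : 𝓞 k, x - algebraMap (𝓞 k) (𝓞 L) y ∈ P := by
  have : (P.under (𝓞 k)).IsMaximal := Ideal.isMaximal_comap_of_isIntegral_of_isMaximal P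
  rw [Ideal.inertiaDeg_eq_of_isMaximal (P.under (𝓞 k)) P] at h
  let := Ideal.Quotient.field (P.under (𝓞 k))
  let := Ideal.Quotient.field P
  obtain ⟨y, hy⟩ := (finrank_eq_one_iff_of_nonzero' (1 : 𝓞 L ⧸ P) one_ne_zero).mp h
    (Ideal.Quotient.mk P x)
  obtain ⟨y, rfl⟩ := Ideal.Quotient.mk_surjective y
  refine ⟨y, ?_⟩
  rw [← Ideal.Quotient.mk_eq_mk_iff_sub_mem, ← hy, Algebra.smul_def, mul_one]
  rfl

lemma inertiaDeg_eq_one_or {p : ℕ} (hp : p.Prime) (hdeg : Module.finrank k L = p)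
    (P : Ideal (𝓞 L)) [P.IsPrime] : P.inertiaDeg (𝓞 k) = 1 ∨ P.inertiaDeg (𝓞 k) = p := by
  have h := ncard_mul_ramificationIdx_mul_inertiaDeg (k := k) P
  rw [hdeg, ← mul_assoc] at h
  exact (Nat.dvd_prime hp).mp ⟨_, by rw [mul_comm, h]⟩

end Primes

lemma under_smul [Normal ℚ k] (g : L ≃ₐ[ℚ] L) (P : Ideal (𝓞 L)) :
    (g • P).under (𝓞 k) = res k g • P.under (𝓞 k) := by
  ext x
  rw [Ideal.mem_pointwise_smul_iff_inv_smul_mem, Ideal.mem_comap, Ideal.mem_comap,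
    Ideal.mem_pointwise_smul_iff_inv_smul_mem, smul_algebraMap_eq, res_inv]

section Kummer
variable {p : ℕ} [Fact p.Prime] [IsCyclotomicExtension {p} ℚ k] [Normal ℚ k] [IsGalois k L] {N : ℕ}
  (hN : N.Prime) (hcong : (N : ZMod p) = -1) (hdeg : Module.finrank k L = p) {n : 𝓞 L}
  (hn : n ^ p = N)

include hN hcong hdeg hn in
lemma ramificationIdx_eq (P : Ideal (𝓞 L)) [P.IsMaximal] (hP : (N : 𝓞 L) ∈ P) :
    P.ramificationIdx (𝓞 k) = p := by
  have : Fact N.Prime := ⟨hN⟩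
  have hlies : P.LiesOver (Ideal.span {(N : ℤ)}) := liesOver_of_natCast_mem hN hP
  have : (P.under (𝓞 k)).LiesOver (Ideal.span {(N : ℤ)}) := Ideal.under_liesOver_of_liesOver _ P _
  have h1 : (P.under (𝓞 k)).ramificationIdx ℤ = 1 :=
    IsCyclotomicExtension.Rat.ramificationIdx_eq_of_not_dvd (m := p) N k (P.under (𝓞 k))
      ((Nat.Prime.coprime_iff_not_dvd hN).mp (coprime_of_cong hN hcong))
  have h2 := Ideal.ramificationIdx_tower (R := ℤ) (P.under (𝓞 k)) P
  have hN0 : (N : 𝓞 L) ≠ 0 := Nat.cast_ne_zero.mpr hN.ne_zero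
  have hmap : (Ideal.span {(N : ℤ)}).map (algebraMap ℤ (𝓞 L)) = Ideal.span {n} ^ p := by
    rw [Ideal.map_span, Set.image_singleton, Ideal.span_singleton_pow, hn]
    simp
  have hne : (Ideal.span {(N : ℤ)}).map (algebraMap ℤ (𝓞 L)) ≠ ⊥ := by
    rw [hmap, Ideal.span_singleton_pow, hn, Ne, Ideal.span_singleton_eq_bot]
    exact hN0
  rw [h1, one_mul, Ideal.IsDedekindDomain.ramificationIdx_eq_normalizedFactors_count _ P hne, hmap,
    UniqueFactorizationMonoid.normalizedFactors_pow, Multiset.count_nsmul] at h2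
  have h3 := ncard_mul_ramificationIdx_mul_inertiaDeg (k := k) P
  rw [hdeg, mul_left_comm] at h3
  have hpos : P.ramificationIdx (𝓞 k) ≠ 0 := (P.ramificationIdx_pos (𝓞 k)).ne'
  refine Nat.dvd_antisymm ⟨_, h3.symm⟩ ⟨_, h2.symm⟩

include hN hcong hdeg hn in
lemma inertiaDeg_and_ncard_eq_one (P : Ideal (𝓞 L)) [P.IsMaximal] (hP : (N : 𝓞 L) ∈ P) :
    P.inertiaDeg (𝓞 k) = 1 ∧ ((P.under (𝓞 k)).primesOver (𝓞 L)).ncard = 1 := by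
  have h := ncard_mul_ramificationIdx_mul_inertiaDeg (k := k) P
  rw [hdeg, ramificationIdx_eq hN hcong hdeg hn P hP, mul_left_comm] at h
  have h1 : _ * _ = 1 :=
    Nat.eq_of_mul_eq_mul_left (Fact.out : p.Prime).pos (h.trans (mul_one p).symm)
  exact ⟨Nat.eq_one_of_mul_eq_one_left h1, Nat.eq_one_of_mul_eq_one_right h1⟩

include hN hcong hdeg hn in
lemma smul_eq_of_res_smul_eq (P : Ideal (𝓞 L)) [P.IsMaximal] (hP : (N : 𝓞 L) ∈ P)
    (g : L ≃ₐ[ℚ] L) (hg : res k g • P.under (𝓞 k) = P.under (𝓞 k)) : g • P = P := by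
  obtain ⟨Q, hQ⟩ := Set.ncard_eq_one.mp (inertiaDeg_and_ncard_eq_one hN hcong hdeg hn P hP).2
  have h1 : P ∈ (P.under (𝓞 k)).primesOver (𝓞 L) := ⟨inferInstance, inferInstance⟩
  have h2 : g • P ∈ (P.under (𝓞 k)).primesOver (𝓞 L) := by
    refine ⟨(isMaximal_smul ‹_› g).isPrime, ⟨?_⟩⟩
    rw [under_smul, hg]
  rw [hQ] at h1 h2
  exact (Set.mem_singleton_iff.mp h2).trans (Set.mem_singleton_iff.mp h1).symm

end Kummer

end Extension

section NormCharacter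
set_option linter.unusedSectionVars false
variable {k L : Type*} [Field k] [NumberField k] [Field L] [NumberField L] [Algebra k L]

lemma algebraMap_intNorm_eq_prod [IsGalois k L] (x : 𝓞 L) :
    algebraMap (𝓞 k) (𝓞 L) (Algebra.intNorm (𝓞 k) (𝓞 L) x) = ∏ s : L ≃ₐ[k] L, s • x := by
  apply RingOfIntegers.ext
  have h1 := Algebra.algebraMap_intNorm (A := 𝓞 k) (B := 𝓞 L) (K := k) (L := L) x
  have h2 : ((∏ s : L ≃ₐ[k] L, s • x : 𝓞 L) : L) = ∏ s : L ≃ₐ[k] L, s (x : L) :=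
    map_prod (algebraMap (𝓞 L) L) _ _
  refine Eq.trans ?_ h2.symm
  rw [← Algebra.norm_eq_prod_automorphisms k]
  exact congrArg (algebraMap k L) h1

lemma pow_sub_pow_mem {R : Type*} [CommRing R] {I : Ideal R} {x y : R} (h : x - y ∈ I) (n : ℕ) :
    x ^ n - y ^ n ∈ I :=
  I.mem_of_dvd (sub_dvd_pow_sub_pow x y n) h

/-- If every automorphism fixes `P`, then the norm of `x` is congruent modulo the prime below `P`
to the `[L : k]`-th power of any element of `k` congruent to `x` modulo `P`. -/
lemma intNorm_sub_pow_mem [IsGalois k L] {P : Ideal (𝓞 L)} (hP : ∀ s : L ≃ₐ[k] L, s • P = P)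
    {x : 𝓞 L} {d : 𝓞 k} (hx : x - algebraMap (𝓞 k) (𝓞 L) d ∈ P) :
    Algebra.intNorm (𝓞 k) (𝓞 L) x - d ^ Module.finrank k L ∈ P.under (𝓞 k) := by
  rw [Ideal.mem_comap, map_sub, map_pow, algebraMap_intNorm_eq_prod, ← IsGalois.card_aut_eq_finrank,
    Nat.card_eq_fintype_card, ← Finset.card_univ, ← Finset.prod_const,
    ← Ideal.Quotient.mk_eq_mk_iff_sub_mem, map_prod, map_prod]
  refine Finset.prod_congr rfl fun s _ => ?_
  rw [Ideal.Quotient.mk_eq_mk_iff_sub_mem]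
  have h : s • (x - algebraMap (𝓞 k) (𝓞 L) d) ∈ s • P := Ideal.smul_mem_pointwise_smul s _ P hx
  rw [hP, smul_sub] at h
  convert h using 2
  exact RingOfIntegers.ext (s.commutes _).symm

section Kummer
variable {p : ℕ} [Fact p.Prime] [IsCyclotomicExtension {p} ℚ k] [Normal ℚ k] [IsGalois k L] {N : ℕ}
  (hN : N.Prime) (hcong : (N : ZMod p) = -1) (hdeg : Module.finrank k L = p) {n : 𝓞 L}
  (hn : n ^ p = N) {v : Ideal (𝓞 k)} [v.IsMaximal] (hv : (N : 𝓞 k) ∈ v)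

include hN hcong hdeg hn in
lemma smul_eq_of_natCast_mem (P : Ideal (𝓞 L)) [P.IsMaximal] (hP : (N : 𝓞 L) ∈ P)
    (s : L ≃ₐ[k] L) : s • P = P := by
  refine smul_eq_of_res_smul_eq (k := k) hN hcong hdeg hn P hP (s.restrictScalars ℚ) ?_
  rw [res_restrictScalars, one_smul]

include hN hcong hdeg hn hv in
/-- Above each conjugate of `v` there is a prime containing `N`, fixed by all automorphisms over
`k` and of inertia degree one. -/
lemma exists_prime_over (g : k ≃ₐ[ℚ] k) : ∃ P : Ideal (𝓞 L), P.IsMaximal ∧ (N : 𝓞 L) ∈ P ∧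
    P.under (𝓞 k) = g • v ∧ (∀ s : L ≃ₐ[k] L, s • P = P) ∧ P.inertiaDeg (𝓞 k) = 1 := by
  have := isMaximal_smul ‹v.IsMaximal› g
  obtain ⟨P, hP, hPv⟩ := Ideal.exists_maximal_ideal_liesOver_of_isIntegral (S := 𝓞 L) (g • v)
  have h1 : P.under (𝓞 k) = g • v := hPv.over.symm
  have h2 : (N : 𝓞 L) ∈ P := by
    have h3 : (N : 𝓞 k) ∈ P.under (𝓞 k) := h1 ▸ natCast_mem_smul hN hv g
    rw [Ideal.mem_comap, map_natCast] at h3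
    exact h3
  exact ⟨P, hP, h2, h1, smul_eq_of_natCast_mem hN hcong hdeg hn P h2,
    (inertiaDeg_and_ncard_eq_one hN hcong hdeg hn P h2).1⟩

include hN hcong hdeg hn hv in
lemma isCoprime_relNorm {I : Ideal (𝓞 L)} (hI : IsCoprime I (Ideal.span {(N : 𝓞 L)})) :
    IsCoprime (Ideal.relNorm (𝓞 k) I) (core (k ≃ₐ[ℚ] k) v) := by
  refine isCoprime_core fun g => ?_
  obtain ⟨P, hP, hNP, hPv, hPs, -⟩ := exists_prime_over hN hcong hdeg hn hv g
  obtain ⟨x, hx, y, hy, hxy⟩ := Ideal.isCoprime_iff_exists.mp hI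
  have h1 : x - algebraMap (𝓞 k) (𝓞 L) 1 ∈ P := by
    rw [map_one, ← hxy, sub_add_cancel_left]
    exact P.neg_mem ((Ideal.span_singleton_le_iff_mem _).mpr hNP hy)
  have h2 := intNorm_sub_pow_mem hPs h1
  rw [one_pow, hPv] at h2
  refine Ideal.isCoprime_iff_exists.mpr ⟨_, Ideal.intNorm_mem_spanNorm _ hx, _,
    (g • v).neg_mem h2, by ring⟩

variable {z : 𝓞 k} (hz : IsPrimitiveRoot z p) (hp2 : p ≠ 2) {ψ : Ideal (𝓞 k) → ZMod p}
  (hψ : IsRayChar (core (k ≃ₐ[ℚ] k) v) ψ)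
  (hψg : ∀ (g : k ≃ₐ[ℚ] k) I, IsCoprime I (core (k ≃ₐ[ℚ] k) v) →
    ψ (g • I) = ((cyc p k g)⁻¹ : (ZMod p)ˣ) * ψ I)

include hN hcong hdeg hn hv hψ in
/-- The norm of an element prime to `N` is a `p`-th power modulo the conjugates of `v`. -/
theorem rayChar_relNorm_span {e : 𝓞 L} (he : IsCoprime (Ideal.span {e}) (Ideal.span {(N : 𝓞 L)})) :
    ψ (Ideal.relNorm (𝓞 k) (Ideal.span {e})) = 0 := by
  have h1 : ∀ P : Ideal (𝓞 k), ∃ d : 𝓞 k, ∀ g : k ≃ₐ[ℚ] k, P = g • v →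
      Algebra.intNorm (𝓞 k) (𝓞 L) e - d ^ p ∈ g • v := by
    intro P
    by_cases hP : ∃ g : k ≃ₐ[ℚ] k, P = g • v
    · obtain ⟨g, rfl⟩ := hP
      obtain ⟨Q, hQ, hNQ, hQv, hQs, hf⟩ := exists_prime_over hN hcong hdeg hn hv g
      obtain ⟨d, hd⟩ := exists_sub_algebraMap_mem hf e
      have h2 := intNorm_sub_pow_mem hQs hd
      rw [hQv, hdeg] at h2
      exact ⟨d, fun g' hg' => hg' ▸ h2⟩
    · exact ⟨0, fun g hg => absurd ⟨g, hg⟩ hP⟩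
  choose y hy using h1
  obtain ⟨w, hw, -⟩ := exists_sub_mem (v := v) (E := ⊤) (Ideal.one_eq_top (R := 𝓞 k) ▸ isCoprime_one_right) y 0
  have h2 : Algebra.intNorm (𝓞 k) (𝓞 L) e - w ^ p ∈ core (k ≃ₐ[ℚ] k) v := by
    rw [mem_core]
    intro g
    have := (g • v).sub_mem (hy (g • v) g rfl) (pow_sub_pow_mem (hw g) p)
    convert this using 1
    ring
  have h3 := isCoprime_relNorm hN hcong hdeg hn hv he
  rw [Ideal.relNorm_singleton] at h3 ⊢
  have h4 := isCoprime_span_of_sub_mem h2 h3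
  rw [hψ.map_span _ _ h3 h2, ← Ideal.span_singleton_pow, hψ.map_pow]
  · simp
  · rw [← Ideal.span_singleton_pow] at h4
    exact (IsCoprime.pow_left_iff (Fact.out : p.Prime).pos).mp h4

include hN hcong hdeg hn hv hz hp2 hψ hψg in
/-- The character vanishes on primes stable under `L ≃ₐ[k] L`. -/
theorem rayChar_relNorm_of_smul_eq {s : L ≃ₐ[k] L}
    (hsn : s • n = algebraMap (𝓞 k) (𝓞 L) z * n) {P : Ideal (𝓞 L)} [P.IsMaximal] (hP : s • P = P)
    (hNP : IsCoprime P (Ideal.span {(N : 𝓞 L)})) : ψ (Ideal.relNorm (𝓞 k) P) = 0 := by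
  have hc := isCoprime_relNorm hN hcong hdeg hn hv hNP
  have hmax : (P.under (𝓞 k)).IsMaximal := Ideal.isMaximal_comap_of_isIntegral_of_isMaximal P
  rw [Ideal.relNorm_eq_pow_of_isMaximal P (P.under (𝓞 k))] at hc ⊢
  rcases inertiaDeg_eq_one_or (Fact.out : p.Prime) hdeg P with hf | hf
  · rw [hf, pow_one] at hc ⊢
    have hnP : n ∉ P := fun h => by
      have h1 : (N : 𝓞 L) ∈ P := by
        rw [← hn]
        exact P.pow_mem_of_mem h p (Fact.out : p.Prime).pos
      have h2 := Ideal.isCoprime_iff_sup_eq.mp hNP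
      rw [sup_eq_left.mpr ((Ideal.span_singleton_le_iff_mem _).mpr h1)] at h2
      exact ‹P.IsMaximal›.ne_top h2
    obtain ⟨d, hd⟩ := exists_sub_algebraMap_mem (k := k) hf n
    have h1 : s • (n - algebraMap (𝓞 k) (𝓞 L) d) ∈ s • P := Ideal.smul_mem_pointwise_smul s _ P hd
    have h2 : s • algebraMap (𝓞 k) (𝓞 L) d = algebraMap (𝓞 k) (𝓞 L) d :=
      RingOfIntegers.ext (s.commutes _)
    rw [hP, smul_sub, hsn, h2] at h1
    have h3 : algebraMap (𝓞 k) (𝓞 L) (z - 1) * n ∈ P := by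
      convert P.sub_mem h1 hd using 1
      rw [map_sub, map_one]
      ring
    have h4 : z - 1 ∈ P.under (𝓞 k) :=
      (‹P.IsMaximal›.isPrime.mem_or_mem h3).resolve_right hnP
    have h5 : conj p k • P.under (𝓞 k) = P.under (𝓞 k) := by
      have h6 : ∀ x : 𝓞 k, conj p k • x - x ∈ P.under (𝓞 k) := by
        have h7 : (Ideal.Quotient.mk (P.under (𝓞 k))).comp
            (MulSemiringAction.toRingHom _ (𝓞 k) (conj p k)) =
            Ideal.Quotient.mk (P.under (𝓞 k)) := by
          refine ringHom_ext_of_root hz ?_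
          have h8 : Ideal.Quotient.mk (P.under (𝓞 k)) z = 1 := by
            rw [← map_one (Ideal.Quotient.mk _), Ideal.Quotient.mk_eq_mk_iff_sub_mem]
            exact h4
          have h9 : conj p k • z = z ^ (cyc p k (conj p k) : ZMod p).val := smul_root hz _
          rw [RingHom.comp_apply, MulSemiringAction.toRingHom_apply, h9, map_pow, h8, one_pow]
        intro x
        rw [← Ideal.Quotient.mk_eq_mk_iff_sub_mem]
        exact RingHom.congr_fun h7 x
      have h10 : conj p k • P.under (𝓞 k) ≤ P.under (𝓞 k) := by
        intro x hx
        rw [Ideal.mem_pointwise_smul_iff_inv_smul_mem] at hx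
        have := (P.under (𝓞 k)).add_mem (h6 ((conj p k)⁻¹ • x)) hx
        rwa [sub_add_cancel, smul_inv_smul] at this
      exact (isMaximal_smul hmax (conj p k)).eq_of_le hmax.ne_top h10
    have h6 := hψg (conj p k) _ hc
    rw [h5, cyc_conj, inv_neg, inv_one, Units.val_neg, Units.val_one, neg_one_mul] at h6
    have h7 : (2 : ZMod p) * ψ (P.under (𝓞 k)) = 0 := by linear_combination h6
    exact (mul_eq_zero.mp h7).resolve_left (two_ne_zero_zmod hp2)
  · rw [hf] at hc ⊢
    rw [hψ.map_pow ((IsCoprime.pow_left_iff (Fact.out : p.Prime).pos).mp hc)]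
    simp

end Kummer

end NormCharacter

section Stable
set_option linter.unusedSectionVars false
variable {L : Type*} [Field L] [NumberField L] {G : Type*} [Group G] [Fintype G]
  [MulSemiringAction G (𝓞 L)] {p : ℕ} [Fact p.Prime] {s : G} (hs : s ^ p = 1)

lemma smul_ideal_prod (g : G) {ι : Type*} (t : Finset ι) (f : ι → Ideal (𝓞 L)) :
    g • ∏ i ∈ t, f i = ∏ i ∈ t, g • f i := Finset.smul_prod'

lemma isCoprime_of_le_left {I J A : Ideal (𝓞 L)} (h : I ≤ J) (hI : IsCoprime I A) :
    IsCoprime J A :=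
  Ideal.isCoprime_iff_sup_eq.mpr
    (top_le_iff.mp ((Ideal.isCoprime_iff_sup_eq.mp hI).ge.trans (sup_le_sup_right h A)))

lemma isCoprime_of_isMaximal_ne {P Q : Ideal (𝓞 L)} (hP : P.IsMaximal) (hQ : Q.IsMaximal)
    (h : P ≠ Q) : IsCoprime P Q :=
  Ideal.isCoprime_iff_sup_eq.mpr (hP.coprime_of_ne hQ h)

include hs in
lemma pow_smul_injOn {P : Ideal (𝓞 L)} (hP : s • P ≠ P) :
    Set.InjOn (fun i : ℕ => s ^ i • P) (Set.Iio p) := by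
  have h1 : Function.minimalPeriod (s • ·) P ∣ p := by
    refine Function.IsPeriodicPt.minimalPeriod_dvd ?_
    change (s • ·)^[p] P = P
    rw [smul_iterate, hs]
    exact one_smul G P
  have h2 : Function.minimalPeriod (s • ·) P = p := by
    refine ((Nat.dvd_prime Fact.out).mp h1).resolve_left fun h => hP ?_
    exact Function.minimalPeriod_eq_one_iff_isFixedPt.mp h
  have h3 := Function.iterate_injOn_Iio_minimalPeriod (f := (s • · : Ideal (𝓞 L) → _)) (x := P)
  rw [h2] at h3
  intro i hi j hj hij
  refine h3 hi hj ?_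
  simpa only [smul_iterate] using hij

/-- The product of the conjugates of `P` under the powers of `s`. -/
def orbitProd (p : ℕ) (s : G) (P : Ideal (𝓞 L)) : Ideal (𝓞 L) := ∏ i ∈ Finset.range p, s ^ i • P

include hs in
lemma smul_orbitProd {P : Ideal (𝓞 L)} (hP : P ≠ ⊥) : s • orbitProd p s P = orbitProd p s P := by
  have h1 := Finset.prod_range_succ (fun i => s ^ i • P) p
  have h2 := Finset.prod_range_succ' (fun i => s ^ i • P) p
  rw [h1, hs, pow_zero, one_smul] at h2
  have h3 := mul_right_cancel₀ hP h2
  rw [orbitProd, smul_ideal_prod]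
  refine Eq.trans (Finset.prod_congr rfl fun i _ => ?_) h3.symm
  rw [smul_smul, pow_succ']

include hs in
lemma orbitProd_dvd {P X : Ideal (𝓞 L)} (hP : P.IsMaximal) (hsP : s • P ≠ P) (hX : s • X = X)
    (h : X ≤ P) : orbitProd p s P ∣ X := by
  refine Finset.prod_dvd_of_coprime ?_ ?_
  · intro i hi j hj hij
    refine isCoprime_of_isMaximal_ne (isMaximal_smul hP _) (isMaximal_smul hP _) fun he => hij ?_
    exact pow_smul_injOn hs hsP (Finset.mem_range.mp hi) (Finset.mem_range.mp hj) he
  · intro i hi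
    clear hi
    have h1 : s ^ i • X = X := by
      induction i with
      | zero => rw [pow_zero, one_smul]
      | succ i ih => rw [pow_succ, mul_smul, hX, ih]
    rw [Ideal.dvd_iff_le, ← h1]
    exact smul_mono_right (s ^ i) h

variable {A : Ideal (𝓞 L)} {f : Ideal (𝓞 L) → ZMod p}
  (hA : ∀ {I}, IsCoprime I A → IsCoprime (s • I) A)
  (hmul : ∀ I J, IsCoprime I A → IsCoprime J A → f (I * J) = f I + f J)
  (hsmul : ∀ I, IsCoprime I A → f (s • I) = f I)
  (hstab : ∀ P : Ideal (𝓞 L), P.IsMaximal → IsCoprime P A → s • P = P → f P = 0)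

include hmul in
lemma eq_zero_one : f 1 = 0 := by
  have := hmul 1 1 isCoprime_one_left isCoprime_one_left
  rwa [one_mul, left_eq_add] at this

include hmul in
lemma eq_sum_of_prod {ι : Type*} (t : Finset ι) (F : ι → Ideal (𝓞 L))
    (hF : ∀ i ∈ t, IsCoprime (F i) A) : f (∏ i ∈ t, F i) = ∑ i ∈ t, f (F i) := by
  induction t using Finset.cons_induction with
  | empty => exact eq_zero_one hmul
  | cons i t hi ih =>
    rw [Finset.prod_cons, Finset.sum_cons, hmul _ _ (hF i (Finset.mem_cons_self _ _))
      (IsCoprime.prod_left fun j hj => hF j (Finset.mem_cons_of_mem hj)),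
      ih fun j hj => hF j (Finset.mem_cons_of_mem hj)]

include hA hmul hsmul in
lemma eq_zero_orbitProd {P : Ideal (𝓞 L)} (hP : IsCoprime P A) :
    IsCoprime (orbitProd p s P) A ∧ f (orbitProd p s P) = 0 := by
  have h1 : ∀ i : ℕ, IsCoprime (s ^ i • P) A ∧ f (s ^ i • P) = f P := by
    intro i
    induction i with
    | zero => rw [pow_zero, one_smul]; exact ⟨hP, rfl⟩
    | succ i ih =>
      rw [pow_succ', mul_smul]
      exact ⟨hA ih.1, (hsmul _ ih.1).trans ih.2⟩
  refine ⟨IsCoprime.prod_left fun i _ => (h1 i).1, ?_⟩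
  rw [orbitProd, eq_sum_of_prod hmul _ _ fun i _ => (h1 i).1,
    Finset.sum_congr rfl fun i _ => (h1 i).2]
  simp

include hs hA hmul hsmul hstab in
/-- An additive `s`-invariant function to `ZMod p` which vanishes at the `s`-stable primes vanishes
at every `s`-stable ideal. -/
theorem eq_zero_of_smul_eq (X : Ideal (𝓞 L)) (hX : X ≠ ⊥) (hXA : IsCoprime X A)
    (hsX : s • X = X) : f X = 0 := by
  induction X using WellFoundedGT.induction with
  | ind X ih =>
  by_cases hX1 : X = ⊤
  · rw [hX1, ← Ideal.one_eq_top]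
    exact eq_zero_one hmul
  obtain ⟨P, hP, hXP⟩ := Ideal.exists_le_maximal X hX1
  have hP0 : P ≠ ⊥ := ne_bot_of_le_ne_bot hX hXP
  have hPA : IsCoprime P A := isCoprime_of_le_left hXP hXA
  obtain ⟨T, hT1, hTX, hsT, hTA, hfT⟩ : ∃ T : Ideal (𝓞 L), T ≠ ⊤ ∧ T ∣ X ∧ s • T = T ∧
      IsCoprime T A ∧ f T = 0 := by
    by_cases hsP : s • P = P
    · exact ⟨P, hP.ne_top, Ideal.dvd_iff_le.mpr hXP, hsP, hPA, hstab P hP hPA hsP⟩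
    · have h := eq_zero_orbitProd hA hmul hsmul hPA
      refine ⟨orbitProd p s P, fun h1 => hP.ne_top ?_, orbitProd_dvd hs hP hsP hsX hXP,
        smul_orbitProd hs hP0, h.1, h.2⟩
      have h2 : s ^ 0 • P ∣ orbitProd p s P :=
        Finset.dvd_prod_of_mem _ (Finset.mem_range.mpr (Fact.out : p.Prime).pos)
      rw [pow_zero, one_smul, h1, Ideal.dvd_iff_le] at h2
      exact top_le_iff.mp h2
  obtain ⟨Y, rfl⟩ := hTX
  have hT0 : T ≠ 0 := left_ne_zero_of_mul hX
  have hY0 : Y ≠ 0 := right_ne_zero_of_mul hX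
  have hYA : IsCoprime Y A := hXA.of_mul_left_right
  have hsY : s • Y = Y := by
    rw [smul_mul', hsT] at hsX
    exact mul_left_cancel₀ hT0 hsX
  rw [hmul _ _ hTA hYA, hfT, zero_add]
  refine ih Y (lt_of_le_of_ne' Ideal.mul_le_right fun h => hT1 ?_) hY0 hYA hsY
  rw [← Ideal.one_eq_top]
  exact mul_right_cancel₀ hY0 (h.symm.trans (one_mul Y).symm)

end Stable

section GaloisModule
set_option linter.unusedSectionVars false
variable {k L : Type*} [Field k] [NumberField k] [Field L] [NumberField L] [Algebra k L]
  {p : ℕ} [Fact p.Prime] [IsCyclotomicExtension {p} ℚ k] [Normal ℚ k] {N : ℕ}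

variable (k) in
/-- A `ZMod p`-valued additive function on the ideals of `L` prime to `N` which is trivial on
principal ideals and on `s`-stable ideals, and on which automorphisms act through the inverse
cyclotomic character. -/
structure IsNormChar (N : ℕ) (s : L ≃ₐ[ℚ] L) (f : Ideal (𝓞 L) → ZMod p) : Prop where
  map_mul : ∀ I J, IsCoprime I (Ideal.span {(N : 𝓞 L)}) → IsCoprime J (Ideal.span {(N : 𝓞 L)}) →
    f (I * J) = f I + f J
  map_smul : ∀ (g : L ≃ₐ[ℚ] L) I, IsCoprime I (Ideal.span {(N : 𝓞 L)}) →
    f (g • I) = ((cyc p k (res k g))⁻¹ : (ZMod p)ˣ) * f I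
  map_span : ∀ e, IsCoprime (Ideal.span {e}) (Ideal.span {(N : 𝓞 L)}) → f (Ideal.span {e}) = 0
  map_of_smul_eq : ∀ X, X ≠ ⊥ → IsCoprime X (Ideal.span {(N : 𝓞 L)}) → s • X = X → f X = 0

lemma isCoprime_smul_natCast (g : L ≃ₐ[ℚ] L) {I : Ideal (𝓞 L)}
    (hI : IsCoprime I (Ideal.span {(N : 𝓞 L)})) :
    IsCoprime (g • I) (Ideal.span {(N : 𝓞 L)}) :=
  isCoprime_smul (fun g => smul_span_natCast g N) g hI

lemma isNormChar_relNorm [IsGalois k L] (hN : N.Prime) (hcong : (N : ZMod p) = -1)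
    (hdeg : Module.finrank k L = p) {n : 𝓞 L} (hn : n ^ p = N)
    {v : Ideal (𝓞 k)} [v.IsMaximal] (hv : (N : 𝓞 k) ∈ v)
    {z : 𝓞 k} (hz : IsPrimitiveRoot z p) (hp2 : p ≠ 2) {ψ : Ideal (𝓞 k) → ZMod p}
    (hψ : IsRayChar (core (k ≃ₐ[ℚ] k) v) ψ)
    (hψg : ∀ (g : k ≃ₐ[ℚ] k) I, IsCoprime I (core (k ≃ₐ[ℚ] k) v) →
      ψ (g • I) = ((cyc p k g)⁻¹ : (ZMod p)ˣ) * ψ I)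
    {s : L ≃ₐ[k] L} (hs : s ^ p = 1) (hsn : s • n = algebraMap (𝓞 k) (𝓞 L) z * n) :
    IsNormChar k N (s.restrictScalars ℚ) fun I => ψ (Ideal.relNorm (𝓞 k) I) := by
  have hmul : ∀ I J : Ideal (𝓞 L), IsCoprime I (Ideal.span {(N : 𝓞 L)}) →
      IsCoprime J (Ideal.span {(N : 𝓞 L)}) → ψ (Ideal.relNorm (𝓞 k) (I * J)) =
        ψ (Ideal.relNorm (𝓞 k) I) + ψ (Ideal.relNorm (𝓞 k) J) := fun I J hI hJ => by
    rw [_root_.map_mul]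
    exact hψ.map_mul _ _ (isCoprime_relNorm hN hcong hdeg hn hv hI)
      (isCoprime_relNorm hN hcong hdeg hn hv hJ)
  have hsm : ∀ (g : L ≃ₐ[ℚ] L) I, IsCoprime I (Ideal.span {(N : 𝓞 L)}) →
      ψ (Ideal.relNorm (𝓞 k) (g • I)) =
        ((cyc p k (res k g))⁻¹ : (ZMod p)ˣ) * ψ (Ideal.relNorm (𝓞 k) I) := fun g I hI => by
    rw [relNorm_gal_smul]
    exact hψg _ _ (isCoprime_relNorm hN hcong hdeg hn hv hI)
  refine ⟨hmul, hsm, fun e he => rayChar_relNorm_span hN hcong hdeg hn hv hψ he,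
    fun X hX hXN hsX => ?_⟩
  have hsQ : (s.restrictScalars ℚ) ^ p = 1 := by
    ext x
    have h1 : ∀ i : ℕ, ((s.restrictScalars ℚ) ^ i) x = (s ^ i) x := by
      intro i
      induction i with
      | zero => rfl
      | succ i ih => rw [pow_succ', pow_succ', AlgEquiv.mul_apply, AlgEquiv.mul_apply, ih]; rfl
    rw [h1, hs]
    rfl
  refine eq_zero_of_smul_eq (f := fun I => ψ (Ideal.relNorm (𝓞 k) I)) hsQ
    (fun h => isCoprime_smul_natCast _ h) hmul (fun I hI => ?_) (fun P hP hPN hsP => ?_) X hX hXN hsX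
  · rw [hsm _ _ hI, res_restrictScalars, map_one]
    simp
  · exact rayChar_relNorm_of_smul_eq hN hcong hdeg hn hv hz hp2 hψ hψg hsn hsP hPN

/-- Comparing two ideals exchanged by `c` whose quotient is `s`-invariant. -/
lemma exists_stable_mul_eq {s c : L ≃ₐ[ℚ] L}
    (hc : ∀ P : Ideal (𝓞 L), P.IsMaximal → (N : 𝓞 L) ∈ P → c • P = P)
    {J₁ J₂ : Ideal (𝓞 L)} (hJ₁ : J₁ ≠ ⊥) (h₁ : c • J₁ = J₂) (h₂ : c • J₂ = J₁)
    (hJ : J₁ * s • J₂ = s • J₁ * J₂) :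
    ∃ X : Ideal (𝓞 L), X ≠ ⊥ ∧ IsCoprime X (Ideal.span {(N : 𝓞 L)}) ∧ s • X = X ∧
      s • c • X = c • X ∧ J₁ * c • X = J₂ * X := by
  obtain ⟨D, hD⟩ : ∃ D, D = J₁ ⊔ J₂ := ⟨_, rfl⟩
  have hD1 : D ∣ J₁ := Ideal.dvd_iff_le.mpr (hD ▸ le_sup_left)
  have hcD : c • D = D := by
    rw [hD, Ideal.pointwise_smul_def, Ideal.map_sup, ← Ideal.pointwise_smul_def,
      ← Ideal.pointwise_smul_def, h₁, h₂, sup_comm]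
  obtain ⟨X, hX⟩ := hD1
  have hX2 : J₂ = D * c • X := by rw [← h₁, hX, smul_mul', hcD]
  have hD0 : D ≠ 0 := left_ne_zero_of_mul (hX ▸ hJ₁)
  have hX0 : X ≠ 0 := right_ne_zero_of_mul (hX ▸ hJ₁)
  have hsup : X ⊔ c • X = ⊤ := by
    refine mul_left_cancel₀ hD0 ?_
    rw [Ideal.mul_sup, ← hX, ← hX2, ← hD, Ideal.mul_top]
  have hcop : IsCoprime X (c • X) := Ideal.isCoprime_iff_sup_eq.mpr hsup
  have hsD0 : s • D ≠ 0 := fun h => hD0 ((smul_eq_zero_iff_eq s).mp h)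
  have hcX0 : c • X ≠ 0 := fun h => hX0 ((smul_eq_zero_iff_eq c).mp h)
  have hJ' : X * s • c • X = s • X * c • X := by
    rw [hX, hX2, smul_mul', smul_mul'] at hJ
    refine mul_left_cancel₀ (mul_ne_zero hD0 hsD0) ?_
    calc D * s • D * (X * s • c • X) = D * X * (s • D * s • c • X) := by ring
      _ = s • D * s • X * (D * c • X) := hJ
      _ = _ := by ring
  have hscop : IsCoprime (s • X) (s • c • X) := by
    have := hcop.map (MulSemiringAction.toRingHom _ (Ideal (𝓞 L)) s)
    exact this
  have h3 : s • X = X := by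
    refine dvd_antisymm ?_ ?_
    · exact hscop.dvd_of_dvd_mul_right (Dvd.intro _ hJ'.symm)
    · exact hcop.dvd_of_dvd_mul_right (Dvd.intro _ hJ')
  rw [h3] at hJ'
  refine ⟨X, hX0, ?_, h3, mul_left_cancel₀ hX0 hJ', ?_⟩
  · rw [Ideal.isCoprime_iff_sup_eq]
    by_contra hne
    obtain ⟨P, hP, hle⟩ := Ideal.exists_le_maximal _ hne
    have hNP : (N : 𝓞 L) ∈ P :=
      (Ideal.span_singleton_le_iff_mem _).mp (le_sup_right.trans hle)
    have h4 : c • X ≤ P := by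
      rw [← hc P hP hNP]
      exact smul_mono_right c (le_sup_left.trans hle)
    exact hP.ne_top (top_le_iff.mp (hsup ▸ sup_le (le_sup_left.trans hle) h4))
  · rw [hX2, hX]
    ring

lemma IsNormChar.map_pow {s : L ≃ₐ[ℚ] L} {f : Ideal (𝓞 L) → ZMod p} (hf : IsNormChar k N s f)
    {I : Ideal (𝓞 L)} (hI : IsCoprime I (Ideal.span {(N : 𝓞 L)})) (h : ℕ) :
    f (I ^ h) = h * f I := by
  induction h with
  | zero => rw [pow_zero, eq_zero_one hf.map_mul]; simp
  | succ h ih =>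
    rw [pow_succ, hf.map_mul _ _ hI.pow_left hI, ih]
    push_cast
    ring

/-- The key vanishing statement: if `s • I / I` has a power of the form `(s δ / δ)`, with exponent
prime to `p`, then the character vanishes at `I`. -/
theorem IsNormChar.eq_zero_of_span_mul_eq {s c : L ≃ₐ[ℚ] L} {f : Ideal (𝓞 L) → ZMod p}
    (hf : IsNormChar k N s f) (hp2 : p ≠ 2)
    (hc : ∀ P : Ideal (𝓞 L), P.IsMaximal → (N : 𝓞 L) ∈ P → c • P = P)
    (hcc : c * c = 1) (hscs : s * c * s = c) (hcres : res k c = conj p k)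
    {I : Ideal (𝓞 L)} (hI0 : I ≠ ⊥) (hI : IsCoprime I (Ideal.span {(N : 𝓞 L)})) {h : ℕ}
    (hh : ¬ p ∣ h) {δ : 𝓞 L} (hδ : δ ≠ 0)
    (hrel : Ideal.span {s • δ} * I ^ h = Ideal.span {δ} * (s • I) ^ h) : f I = 0 := by
  have hcc' : ∀ J : Ideal (𝓞 L), c • c • J = J := fun J => by rw [smul_smul, hcc, one_smul]
  have hccd : c • c • δ = δ := by rw [smul_smul, hcc, one_smul]
  have hcd0 : c • δ ≠ 0 := fun h => hδ ((smul_eq_zero_iff_eq c).mp h)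
  have hrel2 : Ideal.span {c • δ} * (s • c • I) ^ h = Ideal.span {s • c • δ} * (c • I) ^ h := by
    have h1 := congrArg (fun J : Ideal (𝓞 L) => (s * c) • J) hrel
    simp only [smul_mul', smul_pow', smul_span_singleton] at h1
    rw [smul_smul, hscs, smul_smul, hscs, ← smul_smul, ← smul_smul] at h1
    exact h1
  have h₁ : c • (Ideal.span {δ} * (c • I) ^ h) = Ideal.span {c • δ} * I ^ h := by
    rw [smul_mul', smul_pow', smul_span_singleton, hcc']
  have h₂ : c • (Ideal.span {c • δ} * I ^ h) = Ideal.span {δ} * (c • I) ^ h := by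
    rw [smul_mul', smul_pow', smul_span_singleton, hccd]
  have hspan0 : Ideal.span {δ} ≠ ⊥ := by rwa [Ne, Ideal.span_singleton_eq_bot]
  have hspanc0 : Ideal.span {c • δ} ≠ 0 := by
    rwa [Ne, Ideal.zero_eq_bot, Ideal.span_singleton_eq_bot]
  have hcI0 : c • I ≠ 0 := fun h => hI0 ((smul_eq_zero_iff_eq c).mp h)
  obtain ⟨X, hX0, hXN, hsX, hscX, hJX⟩ := exists_stable_mul_eq (N := N) (s := s) hc
    (mul_ne_zero hspan0 (pow_ne_zero h hcI0)) h₁ h₂ (by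
      rw [smul_mul', smul_mul', smul_pow', smul_pow', smul_span_singleton, smul_span_singleton]
      calc _ = (Ideal.span {δ} * (s • I) ^ h) * (Ideal.span {s • c • δ} * (c • I) ^ h) := by ring
        _ = (Ideal.span {s • δ} * I ^ h) * (Ideal.span {c • δ} * (s • c • I) ^ h) := by
          rw [hrel, hrel2]
        _ = _ := by ring)
  have hcIN := isCoprime_smul_natCast c hI
  have hcXN := isCoprime_smul_natCast c hXN
  have hcX0 : c • X ≠ ⊥ := fun h => hX0 ((smul_eq_zero_iff_eq c).mp h)
  obtain ⟨Y, hY⟩ : ∃ Y, Y = (c • I) ^ h * c • X := ⟨_, rfl⟩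
  obtain ⟨W, hW⟩ : ∃ W, W = I ^ h * X := ⟨_, rfl⟩
  have hYN : IsCoprime Y (Ideal.span {(N : 𝓞 L)}) := hY ▸ hcIN.pow_left.mul_left hcXN
  have hWN : IsCoprime W (Ideal.span {(N : 𝓞 L)}) := hW ▸ hI.pow_left.mul_left hXN
  have hYW : Ideal.span {δ} * Y = Ideal.span {c • δ} * W := by
    rw [hY, hW, ← mul_assoc, ← mul_assoc, hJX]
  obtain ⟨e₂, he₂, u, hu, he⟩ := Ideal.isCoprime_iff_exists.mp hYN
  have he₂N : IsCoprime (Ideal.span {e₂}) (Ideal.span {(N : 𝓞 L)}) :=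
    isCoprime_span_of_sub_one_mem (by
      rw [← he, sub_add_cancel_left]
      exact neg_mem hu)
  have hmem : δ * e₂ ∈ Ideal.span {c • δ} := by
    have h3 : δ * e₂ ∈ Ideal.span {c • δ} * W :=
      hYW ▸ Ideal.mul_mem_mul (Ideal.mem_span_singleton_self δ) he₂
    exact Ideal.mul_le_left h3
  obtain ⟨e₁, he₁⟩ := Ideal.mem_span_singleton.mp hmem
  obtain ⟨Z, hZ⟩ := Ideal.dvd_span_singleton.mpr he₂
  have he₁Z : Ideal.span {e₁} = W * Z := by
    refine mul_left_cancel₀ hspanc0 ?_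
    rw [Ideal.span_singleton_mul_span_singleton, ← he₁, ← Ideal.span_singleton_mul_span_singleton,
      hZ, ← mul_assoc, hYW, mul_assoc]
  have hZN : IsCoprime Z (Ideal.span {(N : 𝓞 L)}) := (hZ ▸ he₂N).of_mul_left_right
  have h4 := hf.map_span e₁ (he₁Z ▸ hWN.mul_left hZN)
  have h5 := hf.map_span e₂ he₂N
  have h6 := hf.map_of_smul_eq X hX0 hXN hsX
  have h7 := hf.map_of_smul_eq (c • X) hcX0 hcXN hscX
  have h8 := hf.map_smul c I hI
  rw [hcres, cyc_conj, inv_neg, inv_one, Units.val_neg, Units.val_one, neg_one_mul] at h8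
  rw [he₁Z, hf.map_mul _ _ hWN hZN, hW, hf.map_mul _ _ hI.pow_left hXN, hf.map_pow hI, h6] at h4
  rw [hZ, hf.map_mul _ _ hYN hZN, hY, hf.map_mul _ _ hcIN.pow_left hcXN, hf.map_pow hcIN, h7,
    h8] at h5
  have h9 : (2 : ZMod p) * h * f I = 0 := by linear_combination h4 - h5
  refine (mul_eq_zero.mp h9).resolve_left (mul_ne_zero (two_ne_zero_zmod hp2) fun h0 => hh ?_)
  exact (ZMod.natCast_eq_zero_iff h p).mp h0

end GaloisModule

section HilbertNinety
set_option linter.unusedSectionVars false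

/-- Hilbert's Theorem 90 for a cyclic group of automorphisms. -/
lemma exists_mul_apply_eq {L : Type*} [Field L] {G : Type*} [Group G] [MulSemiringAction G L]
    [FaithfulSMul G L] {s : G} {x : L} (hx : ∏ i ∈ Finset.range (orderOf s), s ^ i • x = 1)
    (hs : 0 < orderOf s) : ∃ b : L, b ≠ 0 ∧ x * s • b = b := by
  obtain ⟨a, ha⟩ : ∃ a : ℕ → L, ∀ i, a i = ∏ j ∈ Finset.range i, s ^ j • x := ⟨_, fun _ => rfl⟩
  have ha0 : a 0 = 1 := by rw [ha, Finset.prod_range_zero]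
  have hap : a (orderOf s) = 1 := by rw [ha, hx]
  have hstep : ∀ i, x * s • a i = a (i + 1) := fun i => by
    rw [ha, ha, Finset.prod_range_succ', pow_zero, one_smul, mul_comm, Finset.smul_prod']
    congr 1
    exact Finset.prod_congr rfl fun j _ => by rw [smul_smul, pow_succ']
  have hinj : Function.Injective fun i : Fin (orderOf s) =>
      (MulSemiringAction.toRingHom G L (s ^ (i : ℕ)) : L →* L) := by
    intro i j hij
    have h1 : s ^ (i : ℕ) = s ^ (j : ℕ) :=
      eq_of_smul_eq_smul fun y : L => DFunLike.congr_fun hij y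
    exact Fin.ext (pow_injOn_Iio_orderOf i.2 j.2 h1)
  have hli := Fintype.linearIndependent_iff.mp
    ((linearIndependent_monoidHom L L).comp _ hinj) (fun i => a i)
  have hy : ∃ y : L, ∑ i ∈ Finset.range (orderOf s), a i * s ^ i • y ≠ 0 := by
    by_contra! h
    have h2 := hli (by
      ext y
      rw [Finset.sum_apply, Pi.zero_apply, ← h y,
        ← Fin.sum_univ_eq_sum_range (fun i => a i * s ^ i • y)]
      rfl) ⟨0, hs⟩
    exact one_ne_zero (ha0.symm.trans h2)
  obtain ⟨y, hy⟩ := hy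
  refine ⟨_, hy, ?_⟩
  have h1 := Finset.sum_range_succ (fun i => a i * s ^ i • y) (orderOf s)
  rw [Finset.sum_range_succ', hap, ha0, pow_orderOf_eq_one, pow_zero, add_left_inj] at h1
  rw [Finset.smul_sum, Finset.mul_sum, ← h1]
  refine Finset.sum_congr rfl fun i _ => ?_
  rw [smul_mul', ← mul_assoc, hstep, smul_smul, pow_succ']

end HilbertNinety

section Vanishing
set_option linter.unusedSectionVars false
variable {K k L : Type*} [Field K] [NumberField K] [Field k] [NumberField k] [Field L]
  [NumberField L] [Algebra K L] [Algebra k L]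

lemma exists_pow_classNumber_eq_span (I : Ideal (𝓞 L)) :
    ∃ a : 𝓞 L, I ^ classNumber L = Ideal.span {a} := by
  by_cases hI : I = ⊥
  · refine ⟨0, ?_⟩
    rw [hI, ← Ideal.zero_eq_bot, zero_pow (classNumber_ne_zero L), Ideal.zero_eq_bot,
      Ideal.span_singleton_eq_bot.mpr rfl]
  · obtain ⟨a, ha⟩ : (I ^ classNumber L).IsPrincipal := by
      have hI' : I ∈ nonZeroDivisors (Ideal (𝓞 L)) := mem_nonZeroDivisors_of_ne_zero hI
      rw [← ClassGroup.mk0_eq_one_iff (pow_mem hI' _), ← SubmonoidClass.mk_pow I hI', map_pow]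
      exact pow_card_eq_one
    exact ⟨a, ha⟩

lemma eq_of_pow_eq_pow {I J : Ideal (𝓞 L)} {n : ℕ} (hn : n ≠ 0) (h : I ^ n = J ^ n) : I = J :=
  dvd_antisymm ((UniqueFactorizationMonoid.pow_dvd_pow_iff_dvd hn).mp h.dvd) ((UniqueFactorizationMonoid.pow_dvd_pow_iff_dvd hn).mp h.symm.dvd)

lemma map_relNorm_eq_prod [IsGalois K L] (I : Ideal (𝓞 L)) :
    (Ideal.relNorm (𝓞 K) I).map (algebraMap (𝓞 K) (𝓞 L)) = ∏ t : L ≃ₐ[K] L, t • I := by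
  have hn : classNumber L ≠ 0 := classNumber_ne_zero L
  obtain ⟨x, hx⟩ := exists_pow_classNumber_eq_span I
  refine eq_of_pow_eq_pow hn ?_
  rw [← Ideal.map_pow, ← map_pow, hx, Ideal.relNorm_singleton, Ideal.map_span,
    Set.image_singleton, algebraMap_intNorm_eq_prod, ← Finset.prod_pow,
    ← Ideal.prod_span_singleton]
  refine Finset.prod_congr rfl fun t _ => ?_
  rw [← smul_pow', hx, smul_span_singleton]

lemma prod_aut_eq_prod_range {p : ℕ} [IsGalois k L] (hdeg : Module.finrank k L = p)
    {s : L ≃ₐ[k] L} (hs : orderOf s = p) {M : Type*} [CommMonoid M] (F : (L ≃ₐ[k] L) → M) :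
    ∏ t : L ≃ₐ[k] L, F t = ∏ i ∈ Finset.range p, F (s ^ i) := by
  have hinj : Set.InjOn (fun i : ℕ => s ^ i) (Finset.range p) := by
    rw [Finset.coe_range, ← hs]
    exact pow_injOn_Iio_orderOf
  have h1 : (Finset.range p).image (fun i : ℕ => s ^ i) = Finset.univ := by
    rw [← Finset.card_eq_iff_eq_univ, Finset.card_image_of_injOn hinj, Finset.card_range,
      ← Nat.card_eq_fintype_card, IsGalois.card_aut_eq_finrank, hdeg]
  rw [← h1, Finset.prod_image hinj]

section Descent
variable [IsGalois ℚ k]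

lemma pow_eq_one_of_smul_eq {u : 𝓞 k} (hu : IsUnit u) (h : ∀ g : k ≃ₐ[ℚ] k, g • u = u) :
    u ^ (2 * Fintype.card (k ≃ₐ[ℚ] k)) = 1 := by
  have h1 : algebraMap ℚ k (Algebra.norm ℚ (u : k)) = (u : k) ^ Fintype.card (k ≃ₐ[ℚ] k) := by
    rw [Algebra.norm_eq_prod_automorphisms, ← Finset.card_univ, ← Finset.prod_const]
    exact Finset.prod_congr rfl fun g _ => congrArg (algebraMap (𝓞 k) k) (h g)
  have h2 : |Algebra.norm ℚ (u : k)| = 1 := isUnit_iff_norm.mp hu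
  have h3 : (Algebra.norm ℚ (u : k)) ^ 2 = 1 := by rw [← sq_abs, h2, one_pow]
  apply RingOfIntegers.ext
  change algebraMap (𝓞 k) k _ = algebraMap (𝓞 k) k 1
  rw [mul_comm, pow_mul, map_pow, map_pow]
  change ((u : k) ^ _) ^ 2 = _
  rw [← h1, ← map_pow, h3, map_one, map_one]

/-- The norms to `k` of two elements of `K` generating ideals with the same norm agree up to a root
of unity. -/
lemma intNorm_pow_eq (hsurj : ∀ g : k ≃ₐ[ℚ] k, ∃ t : L ≃ₐ[K] L, res k (t.restrictScalars ℚ) = g)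
    {a b : 𝓞 K} (ha : a ≠ 0)
    (hab : Ideal.relNorm (𝓞 k) (Ideal.span {algebraMap (𝓞 K) (𝓞 L) a}) =
      Ideal.relNorm (𝓞 k) (Ideal.span {algebraMap (𝓞 K) (𝓞 L) b})) :
    Algebra.intNorm (𝓞 k) (𝓞 L) (algebraMap (𝓞 K) (𝓞 L) a) ^ (2 * Fintype.card (k ≃ₐ[ℚ] k)) =
      Algebra.intNorm (𝓞 k) (𝓞 L) (algebraMap (𝓞 K) (𝓞 L) b) ^
        (2 * Fintype.card (k ≃ₐ[ℚ] k)) := by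
  rw [Ideal.relNorm_singleton, Ideal.relNorm_singleton, Ideal.span_singleton_eq_span_singleton]
    at hab
  obtain ⟨u, hu⟩ := hab
  have hfix : ∀ (x : 𝓞 K) (g : k ≃ₐ[ℚ] k),
      g • Algebra.intNorm (𝓞 k) (𝓞 L) (algebraMap (𝓞 K) (𝓞 L) x) =
        Algebra.intNorm (𝓞 k) (𝓞 L) (algebraMap (𝓞 K) (𝓞 L) x) := fun x g => by
    obtain ⟨t, rfl⟩ := hsurj g
    rw [← intNorm_smul]
    congr 1
    exact RingOfIntegers.ext (t.commutes _)
  have ha0 : Algebra.intNorm (𝓞 k) (𝓞 L) (algebraMap (𝓞 K) (𝓞 L) a) ≠ 0 := by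
    rw [Ne, Algebra.intNorm_eq_zero, FaithfulSMul.algebraMap_eq_zero_iff]
    exact ha
  have hu1 : ∀ g : k ≃ₐ[ℚ] k, g • (u : 𝓞 k) = u := fun g => by
    have h1 := congrArg (g • ·) hu
    simp only [smul_mul', hfix] at h1
    exact mul_left_cancel₀ ha0 (h1.trans hu.symm)
  rw [← hu, mul_pow, pow_eq_one_of_smul_eq u.isUnit hu1, mul_one]

end Descent

section Main
variable {p : ℕ} [Fact p.Prime] [IsCyclotomicExtension {p} ℚ k] [IsGalois ℚ k] [IsGalois K L]
  [IsGalois k L]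

/-- If `t • S = S ^ e t • t`, the product over `t` of the partial orbits of length `e t` relates the
norm of `Q` to the norm of `S • Q`. -/
lemma smul_partialOrbit_mul {ι : Type*} (T : Finset ι) {S : L ≃ₐ[ℚ] L} (g : ι → L ≃ₐ[ℚ] L)
    (e : ι → ℕ) (hcomm : ∀ t, g t * S = S ^ e t * g t) (Q : Ideal (𝓞 L)) :
    S • (∏ t ∈ T, ∏ i ∈ Finset.range (e t), S ^ i • g t • Q) * ∏ t ∈ T, g t • Q =
      (∏ t ∈ T, ∏ i ∈ Finset.range (e t), S ^ i • g t • Q) * ∏ t ∈ T, g t • S • Q := by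
  rw [smul_ideal_prod, ← Finset.prod_mul_distrib, ← Finset.prod_mul_distrib]
  refine Finset.prod_congr rfl fun t _ => ?_
  have h1 := Finset.prod_range_succ (fun i => S ^ i • g t • Q) (e t)
  rw [Finset.prod_range_succ', pow_zero, one_smul] at h1
  rw [smul_ideal_prod, smul_smul (g t) S, hcomm, ← smul_smul, ← h1]
  congr 1
  exact Finset.prod_congr rfl fun i _ => by rw [smul_smul, pow_succ']

lemma prod_pow_smul_eq {s : L ≃ₐ[k] L} (hs : orderOf s = p) (hdeg : Module.finrank k L = p)
    (x : 𝓞 L) : ((∏ i ∈ Finset.range p, s ^ i • (x : L)) : L) =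
      ((algebraMap (𝓞 k) (𝓞 L) (Algebra.intNorm (𝓞 k) (𝓞 L) x) : 𝓞 L) : L) := by
  rw [algebraMap_intNorm_eq_prod, prod_aut_eq_prod_range hdeg hs]
  have h := map_prod (algebraMap (𝓞 L) L) (fun i => s ^ i • x) (Finset.range p)
  exact (Finset.prod_congr rfl fun i _ => rfl).trans h.symm

/-- Integral form of Hilbert's Theorem 90. -/
lemma exists_smul_mul_eq {s : L ≃ₐ[k] L} (hs : orderOf s = p) (hdeg : Module.finrank k L = p)
    {x y : 𝓞 L} (hx : x ≠ 0) (hxy : Algebra.intNorm (𝓞 k) (𝓞 L) x = Algebra.intNorm (𝓞 k) (𝓞 L) y) :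
    ∃ d : 𝓞 L, d ≠ 0 ∧ s • d * x = d * y := by
  have hy : y ≠ 0 := fun h => hx (by rwa [h, Algebra.intNorm_zero, Algebra.intNorm_eq_zero] at hxy)
  have hx' : (x : L) ≠ 0 := RingOfIntegers.coe_ne_zero_iff.mpr hx
  have hy' : (y : L) ≠ 0 := RingOfIntegers.coe_ne_zero_iff.mpr hy
  obtain ⟨b, hb, hxb⟩ := exists_mul_apply_eq (s := s) (x := (x : L) / y) (by
    rw [hs]
    simp only [smul_div₀', Finset.prod_div_distrib]
    rw [prod_pow_smul_eq hs hdeg, prod_pow_smul_eq hs hdeg, hxy]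
    refine div_self ?_
    rw [← hxy, RingOfIntegers.coe_ne_zero_iff, Ne, FaithfulSMul.algebraMap_eq_zero_iff,
      Algebra.intNorm_eq_zero]
    exact hx) (hs ▸ (Fact.out : p.Prime).pos)
  obtain ⟨m, hm, hmb⟩ :=
    ((IsFractionRing.isAlgebraic_iff ℤ ℚ L).mpr (Algebra.IsAlgebraic.isAlgebraic b)).exists_integral_multiple
  refine ⟨⟨m • b, hmb⟩, fun h => ?_, ?_⟩
  · have h1 : m • b = 0 := congrArg (algebraMap (𝓞 L) L) h
    exact (smul_ne_zero hm hb) h1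
  · apply RingOfIntegers.ext
    change s (m • b) * (x : L) = m • b * (y : L)
    have h1 : (x : L) / y * s b = b := hxb
    rw [div_mul_eq_mul_div, div_eq_iff hy'] at h1
    rw [map_zsmul, smul_mul_assoc, smul_mul_assoc, mul_comm, h1]

end Main

end Vanishing

section Vanishing
set_option linter.unusedSectionVars false
variable {K k L : Type*} [Field K] [NumberField K] [Field k] [NumberField k] [Field L]
  [NumberField L] [Algebra K L] [Algebra k L]
  {p : ℕ} [Fact p.Prime] [IsCyclotomicExtension {p} ℚ k] [IsGalois ℚ k] [IsGalois K L]
  [IsGalois k L] {N : ℕ}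

lemma val_neg_one_zmod : (-1 : ZMod p).val = p - 1 := by
  have h1 : Fact (1 < p) := ⟨(Fact.out : p.Prime).one_lt⟩
  rw [ZMod.neg_val, if_neg one_ne_zero, ZMod.val_one]

lemma smul_algebraMap_right (t : L ≃ₐ[K] L) (x : 𝓞 K) :
    t.restrictScalars ℚ • algebraMap (𝓞 K) (𝓞 L) x = algebraMap (𝓞 K) (𝓞 L) x :=
  RingOfIntegers.ext (t.commutes _)

lemma map_relNorm_pow_eq_span (Q : Ideal (𝓞 L)) (hQ : Q ≠ ⊥) : ∃ a : 𝓞 K, a ≠ 0 ∧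
    (∏ t : L ≃ₐ[K] L, t.restrictScalars ℚ • Q) ^ classNumber K =
      Ideal.span {algebraMap (𝓞 K) (𝓞 L) a} := by
  obtain ⟨a, ha⟩ := exists_pow_classNumber_eq_span (Ideal.relNorm (𝓞 K) Q)
  refine ⟨a, ?_, ?_⟩
  · rintro rfl
    rw [Ideal.span_singleton_eq_bot.mpr rfl, ← Ideal.zero_eq_bot] at ha
    exact hQ (Ideal.relNorm_eq_bot_iff.mp (eq_zero_of_pow_eq_zero ha))
  · have h1 : (∏ t : L ≃ₐ[K] L, t.restrictScalars ℚ • Q) =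
        (Ideal.relNorm (𝓞 K) Q).map (algebraMap (𝓞 K) (𝓞 L)) := (map_relNorm_eq_prod Q).symm
    rw [h1, ← Ideal.map_pow, ha, Ideal.map_span, Set.image_singleton]

lemma relNorm_prod_smul {ι : Type*} (T : Finset ι) (g : ι → L ≃ₐ[ℚ] L) (Q : Ideal (𝓞 L)) :
    Ideal.relNorm (𝓞 k) (∏ t ∈ T, g t • Q) = ∏ t ∈ T, res k (g t) • Ideal.relNorm (𝓞 k) Q := by
  rw [map_prod]
  exact Finset.prod_congr rfl fun t _ => relNorm_gal_smul _ _

/-- If `p` does not divide the class number of `K`, the character is trivial. -/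
theorem IsNormChar.eq_zero {s : L ≃ₐ[k] L} {f : Ideal (𝓞 L) → ZMod p}
    (hf : IsNormChar k N (s.restrictScalars ℚ) f) (hp2 : p ≠ 2)
    (hs : orderOf s = p) (hdeg : Module.finrank k L = p)
    (hbij : Function.Bijective fun t : L ≃ₐ[K] L => res k (t.restrictScalars ℚ))
    (hcomm : ∀ t : L ≃ₐ[K] L, t.restrictScalars ℚ * s.restrictScalars ℚ =
      s.restrictScalars ℚ ^ (cyc p k (res k (t.restrictScalars ℚ)) : ZMod p).val *
        t.restrictScalars ℚ)
    (hfix : ∀ g : L ≃ₐ[ℚ] L, res k g = conj p k →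
      ∀ P : Ideal (𝓞 L), P.IsMaximal → (N : 𝓞 L) ∈ P → g • P = P)
    (hcl : ¬ p ∣ classNumber K) {Q : Ideal (𝓞 L)} (hQ0 : Q ≠ ⊥)
    (hQ : IsCoprime Q (Ideal.span {(N : 𝓞 L)})) : f Q = 0 := by
  obtain ⟨S, hS⟩ : ∃ S : L ≃ₐ[ℚ] L, S = s.restrictScalars ℚ := ⟨_, rfl⟩
  rw [← hS] at hf
  simp only [← hS] at hcomm
  have hSres : res k S = 1 := hS ▸ res_restrictScalars s
  have hSp : S ^ p = 1 := by
    have h1 : S = AlgEquiv.restrictScalarsHom ℚ s := hS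
    rw [h1, ← _root_.map_pow, ← hs, pow_orderOf_eq_one, map_one]
  obtain ⟨g, hg⟩ : ∃ g : (L ≃ₐ[K] L) → L ≃ₐ[ℚ] L, ∀ t, g t = t.restrictScalars ℚ :=
    ⟨_, fun _ => rfl⟩
  obtain ⟨e, he⟩ : ∃ e : (L ≃ₐ[K] L) → ℕ, ∀ t, e t = (cyc p k (res k (g t)) : ZMod p).val :=
    ⟨_, fun _ => rfl⟩
  simp only [← hg] at hbij hcomm
  simp only [← he] at hcomm
  -- the complex conjugation over `K`
  obtain ⟨c, hc⟩ := hbij.2 (conj p k)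
  have hcc : g c * g c = 1 := by
    have h1 : c * c = 1 := hbij.1 (by
      change res k (g (c * c)) = res k (g 1)
      have h2 : g (c * c) = g c * g c := by rw [hg, hg]; rfl
      have h3 : g 1 = 1 := by rw [hg]; rfl
      rw [h2, h3, res_mul]
      change res k (g c) = conj p k at hc
      rw [hc, conj_mul_conj]
      exact (map_one (AlgEquiv.restrictNormalHom k)).symm)
    rw [hg]
    change (c * c).restrictScalars ℚ = 1
    rw [h1]
    rfl
  have hscs : S * g c * S = g c := by
    have h1 := hcomm c
    have h2 : e c = p - 1 := by
      rw [he]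
      change res k (g c) = conj p k at hc
      rw [hc, cyc_conj, Units.val_neg, Units.val_one, val_neg_one_zmod]
    rw [mul_assoc, h1, h2, ← mul_assoc, ← pow_succ', Nat.sub_add_cancel (Fact.out : p.Prime).pos,
      hSp, one_mul]
  -- generators of the norms to `K`
  obtain ⟨a, ha0, ha⟩ := map_relNorm_pow_eq_span (K := K) Q hQ0
  have hSQ0 : S • Q ≠ ⊥ := fun h => hQ0 ((smul_eq_zero_iff_eq S).mp h)
  obtain ⟨b, hb0, hb⟩ := map_relNorm_pow_eq_span (K := K) (S • Q) hSQ0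
  simp only [← hg] at ha hb
  have hab : Ideal.relNorm (𝓞 k) (Ideal.span {algebraMap (𝓞 K) (𝓞 L) a}) =
      Ideal.relNorm (𝓞 k) (Ideal.span {algebraMap (𝓞 K) (𝓞 L) b}) := by
    rw [← ha, ← hb, _root_.map_pow, _root_.map_pow, relNorm_prod_smul, relNorm_prod_smul, relNorm_gal_smul,
      hSres, one_smul]
  obtain ⟨E, hE⟩ : ∃ E, E = 2 * Fintype.card (k ≃ₐ[ℚ] k) := ⟨_, rfl⟩
  have hnorm := intNorm_pow_eq (K := K) (fun σ => by
    obtain ⟨t, ht⟩ := hbij.2 σ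
    exact ⟨t, by rw [← hg]; exact ht⟩) ha0 hab
  rw [← hE, ← _root_.map_pow, ← _root_.map_pow, ← _root_.map_pow, ← _root_.map_pow] at hnorm
  have hMa : (∏ t, g t • Q) ^ (classNumber K * E) =
      Ideal.span {algebraMap (𝓞 K) (𝓞 L) (a ^ E)} := by
    rw [pow_mul, ha, Ideal.span_singleton_pow, _root_.map_pow]
  have hMb : (∏ t, g t • S • Q) ^ (classNumber K * E) =
      Ideal.span {algebraMap (𝓞 K) (𝓞 L) (b ^ E)} := by
    rw [pow_mul, hb, Ideal.span_singleton_pow, _root_.map_pow]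
  have haE : algebraMap (𝓞 K) (𝓞 L) (a ^ E) ≠ 0 := by
    rw [Ne, FaithfulSMul.algebraMap_eq_zero_iff]
    exact pow_ne_zero E ha0
  obtain ⟨δ, hδ0, hδ⟩ := exists_smul_mul_eq hs hdeg haE hnorm
  obtain ⟨I, hI⟩ : ∃ I, I = ∏ t, ∏ i ∈ Finset.range (e t), S ^ i • g t • Q := ⟨_, rfl⟩
  have hpart := smul_partialOrbit_mul Finset.univ g e hcomm Q
  rw [← hI] at hpart
  have hrel : Ideal.span {S • δ} * I ^ (classNumber K * E) =
      Ideal.span {δ} * (S • I) ^ (classNumber K * E) := by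
    have hne : (∏ t, g t • Q) ^ (classNumber K * E) ≠ 0 := by
      rwa [hMa, Ne, Ideal.zero_eq_bot, Ideal.span_singleton_eq_bot]
    refine mul_right_cancel₀ hne ?_
    have hδ' : Ideal.span {S • δ} * (∏ t, g t • Q) ^ (classNumber K * E) =
        Ideal.span {δ} * (∏ t, g t • S • Q) ^ (classNumber K * E) := by
      rw [hMa, hMb, Ideal.span_singleton_mul_span_singleton,
        Ideal.span_singleton_mul_span_singleton, ← hδ, hS]
      rfl
    rw [mul_right_comm, hδ', mul_assoc, mul_assoc, ← mul_pow, ← mul_pow, hpart, mul_comm I]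
  have hIQ : ∀ t, ∀ i : ℕ, IsCoprime (S ^ i • g t • Q) (Ideal.span {(N : 𝓞 L)}) :=
    fun t i => isCoprime_smul_natCast _ (isCoprime_smul_natCast _ hQ)
  have hI0 : I ≠ ⊥ := by
    rw [hI, ← Ideal.zero_eq_bot]
    refine Finset.prod_ne_zero_iff.mpr fun t _ => Finset.prod_ne_zero_iff.mpr fun i _ => ?_
    rw [Ne, smul_eq_zero_iff_eq, smul_eq_zero_iff_eq]
    exact hQ0
  have hIN : IsCoprime I (Ideal.span {(N : 𝓞 L)}) :=
    hI ▸ IsCoprime.prod_left fun t _ => IsCoprime.prod_left fun i _ => hIQ t i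
  have hE0 : (E : ZMod p) ≠ 0 := by
    rw [hE, Nat.cast_mul]
    exact mul_ne_zero (by exact_mod_cast two_ne_zero_zmod hp2) card_galois_ne_zero
  have hdvd : ¬ p ∣ classNumber K * E := fun h =>
    ((Fact.out : p.Prime).dvd_mul.mp h).elim hcl fun h => hE0 ((ZMod.natCast_eq_zero_iff _ _).mpr h)
  have hfI := hf.eq_zero_of_span_mul_eq hp2 (hfix _ hc) hcc hscs hc hI0 hIN hdvd hδ0 hrel
  have hfS : ∀ t, ∀ i : ℕ, f (S ^ i • g t • Q) = ((cyc p k (res k (g t)))⁻¹ : (ZMod p)ˣ) * f Q := by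
    intro t i
    rw [hf.map_smul _ _ (isCoprime_smul_natCast _ hQ), hf.map_smul _ _ hQ]
    have h1 : res k (S ^ i) = 1 := by
      have h2 : res k (S ^ i) = res k S ^ i := _root_.map_pow (AlgEquiv.restrictNormalHom k) S i
      rw [h2, hSres, one_pow]
    rw [h1, map_one, inv_one, Units.val_one, one_mul]
  rw [hI, eq_sum_of_prod hf.map_mul _ _ fun t _ => IsCoprime.prod_left fun i _ => hIQ t i] at hfI
  have hsum : ∀ t, f (∏ i ∈ Finset.range (e t), S ^ i • g t • Q) = f Q := fun t => by
    rw [eq_sum_of_prod hf.map_mul _ _ fun i _ => hIQ t i, Finset.sum_congr rfl fun i _ => hfS t i,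
      Finset.sum_const, Finset.card_range, nsmul_eq_mul, he, ZMod.natCast_zmod_val, ← mul_assoc,
      ← Units.val_mul, mul_inv_cancel, Units.val_one, one_mul]
  rw [Finset.sum_congr rfl fun t _ => hsum t, Finset.sum_const, nsmul_eq_mul, Finset.card_univ] at hfI
  have hcard : Fintype.card (L ≃ₐ[K] L) = Fintype.card (k ≃ₐ[ℚ] k) := Fintype.card_of_bijective hbij
  rw [hcard] at hfI
  exact (mul_eq_zero.mp hfI).resolve_left card_galois_ne_zero

end Vanishing

section Divisibility
set_option linter.unusedSectionVars false

lemma isCoprime_of_not_le {R : Type*} [CommRing R] {I J : Ideal R} (hI : I.IsMaximal)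
    (h : ¬ J ≤ I) : IsCoprime I J := by
  rw [Ideal.isCoprime_iff_sup_eq]
  by_contra hne
  exact h (hI.eq_of_le hne le_sup_left ▸ le_sup_right)

lemma exists_ringHom_zmod_of_card {R : Type*} [CommRing R] {ℓ : ℕ} [Fact ℓ.Prime]
    (Q : Ideal R) (hQ : Nat.card (R ⧸ Q) = ℓ) : ∃ ρ : R →+* ZMod ℓ, RingHom.ker ρ = Q := by
  have : Finite (R ⧸ Q) := Nat.finite_of_card_ne_zero (hQ ▸ (Fact.out : ℓ.Prime).ne_zero)
  have : Fintype (R ⧸ Q) := Fintype.ofFinite _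
  let e := ZMod.ringEquivOfPrime (R ⧸ Q) (Fact.out : ℓ.Prime) (Nat.card_eq_fintype_card.symm.trans hQ)
  refine ⟨(e.symm : R ⧸ Q →+* ZMod ℓ).comp (Ideal.Quotient.mk Q), ?_⟩
  ext x
  rw [RingHom.mem_ker, RingHom.comp_apply, ← Ideal.Quotient.eq_zero_iff_mem]
  exact e.symm.map_eq_zero_iff

variable {K k L : Type*} [Field K] [NumberField K] [Field k] [NumberField k] [Field L]
  [NumberField L] [Algebra K L] [Algebra k L]
  {p : ℕ} [Fact p.Prime] [IsCyclotomicExtension {p} ℚ k] [IsGalois ℚ k] [IsGalois K L]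
  [IsGalois k L] {N : ℕ}

lemma relNorm_eq_under (Q : HeightOneSpectrum (𝓞 L)) (hQ : (Ideal.absNorm Q.asIdeal).Prime) :
    Ideal.relNorm (𝓞 k) Q.asIdeal = Q.asIdeal.under (𝓞 k) := by
  have h0 : Q.asIdeal.IsMaximal := Q.isMaximal
  have h1 : (Q.asIdeal.under (𝓞 k)).IsMaximal := Ideal.isMaximal_comap_of_isIntegral_of_isMaximal _
  have h2 := Ideal.relNorm_eq_pow_of_isMaximal Q.asIdeal (Q.asIdeal.under (𝓞 k))
  have h3 := congrArg Ideal.absNorm h2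
  rw [Ideal.absNorm_relNorm, _root_.map_pow] at h3
  rw [h3] at hQ
  rw [h2, Nat.Prime.eq_one_of_pow hQ, pow_one]

theorem dvd_classNumber_of_aut (hN : N.Prime) (hcong : (N : ZMod p) = -1) (hp5 : 5 ≤ p)
    {z : 𝓞 k} (hz : IsPrimitiveRoot z p) {n : 𝓞 L} (hn : n ^ p = N) {s : L ≃ₐ[k] L}
    (hs : orderOf s = p) (hsn : s • n = algebraMap (𝓞 k) (𝓞 L) z * n)
    (hdeg : Module.finrank k L = p)
    (hbij : Function.Bijective fun t : L ≃ₐ[K] L => res k (t.restrictScalars ℚ))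
    (hcomm : ∀ t : L ≃ₐ[K] L, t.restrictScalars ℚ * s.restrictScalars ℚ =
      s.restrictScalars ℚ ^ (cyc p k (res k (t.restrictScalars ℚ)) : ZMod p).val *
        t.restrictScalars ℚ) :
    p ∣ classNumber K := by
  by_contra hcl
  have hp2 : p ≠ 2 := by lia
  have htop : Ideal.span {(N : 𝓞 k)} ≠ ⊤ := by
    intro h
    have h1 := congrArg Ideal.absNorm h
    rw [Ideal.absNorm_top, Ideal.absNorm_span_natCast] at h1
    exact hN.one_lt.ne' ((Nat.pow_eq_one.mp h1).resolve_right Module.finrank_pos.ne')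
  obtain ⟨v, hvmax, hv⟩ := Ideal.exists_le_maximal _ htop
  rw [Ideal.span_singleton_le_iff_mem] at hv
  obtain ⟨ψ, χ, hψ, hψg, hχ, hχg, hind⟩ := exists_characters hz hN hcong hp5 hv
  have hfix : ∀ g : L ≃ₐ[ℚ] L, res k g = conj p k →
      ∀ P : Ideal (𝓞 L), P.IsMaximal → (N : 𝓞 L) ∈ P → g • P = P := by
    intro g hg P hP hNP
    refine smul_eq_of_res_smul_eq hN hcong hdeg hn P hNP g ?_
    rw [hg]
    have := hP.isPrime
    exact conj_smul_eq hz hN hcong (Ideal.mem_comap.mpr (by rwa [map_natCast]))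
  have hf := isNormChar_relNorm hN hcong hdeg hn hv hz hp2 hψ hψg
    (hs ▸ pow_orderOf_eq_one s) hsn
  refine false_of_independent_rayChar (L := L) (conductor_ne_bot hN hcong hv) conductor_ne_top
    (hψ.mono inf_le_left) hχ hind hdeg.le ?_
  have hpN : Ideal.span {((p * N : ℕ) : 𝓞 L)} ≠ 0 := by
    rw [Ne, Ideal.zero_eq_bot, Ideal.span_singleton_eq_bot, Nat.cast_eq_zero]
    exact mul_ne_zero (Fact.out : p.Prime).ne_zero hN.ne_zero
  refine (Ideal.finite_factors hpN).subset ?_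
  rintro Q ⟨hQ, hQv⟩
  by_contra hQpN
  have hmem : ((p * N : ℕ) : 𝓞 L) ∉ Q.asIdeal := fun h =>
    hQpN (Ideal.dvd_iff_le.mpr ((Ideal.span_singleton_le_iff_mem _).mpr h))
  have hpQ : (p : 𝓞 L) ∉ Q.asIdeal := fun h =>
    hmem (by rw [Nat.cast_mul]; exact Ideal.mul_mem_right _ _ h)
  have hNQ : (N : 𝓞 L) ∉ Q.asIdeal := fun h =>
    hmem (by rw [Nat.cast_mul]; exact Ideal.mul_mem_left _ _ h)
  obtain ⟨ℓ, hℓ⟩ : ∃ ℓ, ℓ = Ideal.absNorm Q.asIdeal := ⟨_, rfl⟩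
  have hℓQ : (ℓ : 𝓞 L) ∈ Q.asIdeal := hℓ ▸ Ideal.absNorm_mem _
  have : Fact ℓ.Prime := ⟨hℓ ▸ hQ⟩
  obtain ⟨ρ, hρ⟩ := exists_ringHom_zmod_of_card Q.asIdeal
    ((Submodule.cardQuot_apply _).symm.trans hℓ.symm)
  obtain ⟨π, hπ⟩ : ∃ π : 𝓞 k →+* ZMod ℓ, π = ρ.comp (algebraMap (𝓞 k) (𝓞 L)) := ⟨_, rfl⟩
  have hker : RingHom.ker π = Q.asIdeal.under (𝓞 k) := by
    rw [hπ, ← RingHom.comap_ker, hρ]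
  have hq : IsCoprime (Q.asIdeal.under (𝓞 k)) (conductor p v) := by
    have h0 : Q.asIdeal.IsMaximal := Q.isMaximal
    refine isCoprime_of_not_le (Ideal.isMaximal_comap_of_isIntegral_of_isMaximal _) fun h => hmem ?_
    have h1 : ((p * N : ℕ) : 𝓞 k) ∈ conductor p v := by
      rw [Nat.cast_mul]
      refine ⟨?_, Ideal.mul_mem_right _ _ (Ideal.mem_span_singleton_self _)⟩
      refine Ideal.mul_mem_left _ _ ?_
      exact Ideal.mem_iInf.mpr fun g => natCast_mem_smul hN hv g
    simpa [Ideal.mem_comap] using h h1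
  refine hQv ⟨hq, ?_, ?_⟩
  · change ψ (Q.asIdeal.under (𝓞 k)) = 0
    rw [← relNorm_eq_under Q hQ]
    exact hf.eq_zero hp2 hs hdeg hbij hcomm hfix hcl Q.ne_bot (isCoprime_of_not_le Q.isMaximal
      (by rwa [Ideal.span_singleton_le_iff_mem]))
  · change χ (Q.asIdeal.under (𝓞 k)) = 0
    rw [← hker]
    refine rayChar_ker_eq_zero hz hN hcong hp2 hv ?_ ?_ π ⟨ρ n, ?_⟩ hχ hχg (hker ▸ hq)
    · rintro rfl; exact hpQ hℓQ
    · rintro rfl; exact hNQ hℓQ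
    · rw [← _root_.map_pow, hn, map_natCast]

end Divisibility

section Kummer
set_option linter.unusedSectionVars false

lemma pow_ne_prime {N p : ℕ} (hN : N.Prime) (hp : p.Prime) (b : ℚ) : b ^ p ≠ N := by
  intro h
  have : Fact N.Prime := ⟨hN⟩
  have h1 := congrArg (padicValRat N) h
  rw [padicValRat.pow, padicValRat.self hN.one_lt] at h1
  exact hp.one_lt.ne' (Int.natCast_dvd_natCast.mp (Dvd.intro _ h1) |> Nat.dvd_one.mp)

lemma finrank_eq_of_root {K : Type*} [Field K] [NumberField K] {N p : ℕ} (hN : N.Prime)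
    (hp : p.Prime) {α : K} (hroot : α ^ p = N) (hgen : Algebra.adjoin ℚ {α} = ⊤) :
    Module.finrank ℚ K = p := by
  have hirr := X_pow_sub_C_irreducible_of_prime hp (pow_ne_prime hN hp)
  have hmin := minpoly.eq_of_irreducible_of_monic hirr (x := α)
    (by simp [hroot]) (Polynomial.monic_X_pow_sub_C _ hp.ne_zero)
  have h1 : IntermediateField.adjoin ℚ {α} = ⊤ := by
    rw [eq_top_iff]
    intro x _
    exact IntermediateField.algebra_adjoin_le_adjoin ℚ {α} (hgen ▸ Algebra.mem_top)
  rw [← IntermediateField.finrank_top', ← h1,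
    IntermediateField.adjoin.finrank (Algebra.IsIntegral.isIntegral α), ← hmin,
    Polynomial.natDegree_X_pow_sub_C]

variable {K k L : Type*} [Field K] [NumberField K] [Field k] [NumberField k] [Field L]
  [NumberField L] [Algebra K L] [Algebra k L]
  {p : ℕ} [Fact p.Prime] [IsCyclotomicExtension {p} ℚ k] [IsGalois ℚ k]
  [IsCyclotomicExtension {p} K L] {N : ℕ} {z : 𝓞 k} (hz : IsPrimitiveRoot z p)

include hz in
lemma isPrimitiveRoot_algebraMap : IsPrimitiveRoot (algebraMap k L z) p :=
  (isPrimitiveRoot_coe hz).map_of_injective (algebraMap k L).injective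

include hz in
lemma adjoin_root_eq_top {α : K} (hgen : Algebra.adjoin ℚ {α} = ⊤) :
    Algebra.adjoin k {algebraMap K L α} = ⊤ := by
  rw [eq_top_iff]
  rintro x -
  have hx : x ∈ Algebra.adjoin K {algebraMap k L z} := by
    rw [IsCyclotomicExtension.adjoin_primitive_root_eq_top (isPrimitiveRoot_algebraMap hz)]
    trivial
  have hK (y : K) : algebraMap K L y ∈ Algebra.adjoin k {algebraMap K L α} := by
    have hy : y ∈ Algebra.adjoin ℚ {α} := hgen ▸ Algebra.mem_top
    induction hy using Algebra.adjoin_induction with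
    | mem y hy =>
      rw [Set.mem_singleton_iff.mp hy]
      exact Algebra.self_mem_adjoin_singleton _ _
    | algebraMap r =>
      rw [eq_ratCast, map_ratCast, ← map_ratCast (algebraMap k L)]
      exact Subalgebra.algebraMap_mem _ _
    | add x y _ _ hx hy => rw [map_add]; exact add_mem hx hy
    | mul x y _ _ hx hy => rw [map_mul]; exact mul_mem hx hy
  induction hx using Algebra.adjoin_induction with
  | mem y hy =>
    rw [Set.mem_singleton_iff.mp hy]
    exact Subalgebra.algebraMap_mem _ _
  | algebraMap r => exact hK r
  | add x y _ _ hx hy => exact add_mem hx hy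
  | mul x y _ _ hx hy => exact mul_mem hx hy

include hz in
lemma aut_ext {α : K} (hgen : Algebra.adjoin ℚ {α} = ⊤) {g h : L ≃ₐ[ℚ] L}
    (hα : g (algebraMap K L α) = h (algebraMap K L α)) (hres : res k g = res k h) : g = h := by
  ext x
  have hx : x ∈ Algebra.adjoin k {algebraMap K L α} := by
    rw [adjoin_root_eq_top hz hgen]
    trivial
  induction hx using Algebra.adjoin_induction with
  | mem y hy => rw [Set.mem_singleton_iff.mp hy, hα]
  | algebraMap r =>
    rw [← AlgEquiv.restrictNormal_commutes, ← AlgEquiv.restrictNormal_commutes]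
    exact congrArg (fun σ : k ≃ₐ[ℚ] k => algebraMap k L (σ r)) hres
  | add x y _ _ hx hy => rw [map_add, map_add, hx, hy]
  | mul x y _ _ hx hy => rw [map_mul, map_mul, hx, hy]

include hz in
lemma res_injective {α : K} (hgen : Algebra.adjoin ℚ {α} = ⊤) :
    Function.Injective fun t : L ≃ₐ[K] L => res k (t.restrictScalars ℚ) := by
  intro t u h
  refine AlgEquiv.restrictScalars_injective ℚ (aut_ext (k := k) hz hgen ?_ h)
  exact (t.commutes α).trans (u.commutes α).symm

include hz in
lemma finrank_eq [IsGalois K L] (hK : Module.finrank ℚ K = p) {α : K}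
    (hgen : Algebra.adjoin ℚ {α} = ⊤) :
    Module.finrank k L = p ∧ Module.finrank K L = Module.finrank ℚ k := by
  have hp : p.Prime := Fact.out
  have hk : Module.finrank ℚ k = p - 1 := by
    rw [IsCyclotomicExtension.finrank k (Polynomial.cyclotomic.irreducible_rat hp.pos),
      Nat.totient_prime hp]
  have h1 : Module.finrank K L ≤ p - 1 := by
    rw [← IsGalois.card_aut_eq_finrank, ← hk, ← IsGalois.card_aut_eq_finrank]
    exact Nat.card_le_card_of_injective _ (res_injective (k := k) hz hgen)
  have h2 := (Module.finrank_mul_finrank ℚ K L).trans (Module.finrank_mul_finrank ℚ k L).symm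
  rw [hK, hk] at h2
  have hcop : (p - 1).Coprime p := by
    have := Nat.coprime_self_add_right (m := p - 1) (n := 1)
    rw [Nat.sub_add_cancel hp.pos] at this
    exact this.mpr (Nat.coprime_one_right _)
  have h3 : Module.finrank K L = p - 1 := le_antisymm h1
    (Nat.le_of_dvd Module.finrank_pos (hcop.dvd_of_dvd_mul_left (Dvd.intro _ h2.symm)))
  refine ⟨?_, h3.trans hk.symm⟩
  rw [h3, mul_comm p] at h2
  exact (Nat.eq_of_mul_eq_mul_left (Nat.sub_pos_of_lt hp.one_lt) h2).symm

include hz in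
lemma isGalois_of_root (hdeg : Module.finrank k L = p) {α : K} (hroot : α ^ p = N)
    (hgen : Algebra.adjoin ℚ {α} = ⊤) : IsGalois k L := by
  have hprim : (primitiveRoots (Module.finrank k L) k).Nonempty :=
    ⟨z, (mem_primitiveRoots (hdeg ▸ (Fact.out : p.Prime).pos)).mpr (hdeg ▸ isPrimitiveRoot_coe hz)⟩
  have hpow : algebraMap K L α ^ Module.finrank k L = algebraMap k L N := by
    rw [hdeg, ← map_pow, hroot, map_natCast, map_natCast]
  have htop : IntermediateField.adjoin k {algebraMap K L α} = ⊤ := by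
    rw [eq_top_iff]
    intro x _
    exact IntermediateField.algebra_adjoin_le_adjoin k _
      (by rw [adjoin_root_eq_top hz hgen]; trivial)
  have := isSplittingField_X_pow_sub_C_of_root_adjoin_eq_top hprim hpow htop
  exact isGalois_of_isSplittingField_X_pow_sub_C hprim
    (irreducible_X_pow_sub_C_of_root_adjoin_eq_top hpow htop) L

include hz in
lemma exists_kummer_generator [IsGalois k L] (hdeg : Module.finrank k L = p) (hN : N ≠ 0)
    {a : 𝓞 K} (ha : a ^ p = N) (hgen : Algebra.adjoin ℚ {(a : K)} = ⊤) :
    ∃ (s : L ≃ₐ[k] L) (y : 𝓞 k), orderOf s = p ∧ IsPrimitiveRoot y p ∧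
      s • algebraMap (𝓞 K) (𝓞 L) a = algebraMap (𝓞 k) (𝓞 L) y * algebraMap (𝓞 K) (𝓞 L) a := by
  have hp : p.Prime := Fact.out
  have hcard : Nat.card (L ≃ₐ[k] L) = p := by rw [IsGalois.card_aut_eq_finrank, hdeg]
  obtain ⟨n, hn⟩ : ∃ n, n = algebraMap (𝓞 K) (𝓞 L) a := ⟨_, rfl⟩
  have hnp : n ^ p = N := by rw [hn, ← map_pow, ha, map_natCast]
  have hn0 : n ≠ 0 := by
    rintro rfl
    rw [zero_pow hp.ne_zero] at hnp
    exact hN (Nat.cast_eq_zero.mp hnp.symm)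
  have : Nontrivial (L ≃ₐ[k] L) := Finite.one_lt_card_iff_nontrivial.mp (hcard ▸ hp.one_lt)
  obtain ⟨s, hs⟩ := exists_ne (1 : L ≃ₐ[k] L)
  have hord : orderOf s = p := by
    have h1 : s ^ p = 1 := hcard ▸ pow_card_eq_one'
    exact orderOf_eq_prime h1 hs
  have hz' : IsPrimitiveRoot (algebraMap (𝓞 k) (𝓞 L) z) p :=
    hz.map_of_injective (FaithfulSMul.algebraMap_injective _ _)
  have hzL : IsPrimitiveRoot (algebraMap k L z) p := isPrimitiveRoot_algebraMap hz
  have hnL : (n : L) ≠ 0 := fun h => hn0 (RingOfIntegers.coe_eq_zero_iff.mp h)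
  have hsn : s (n : L) ^ p = (n : L) ^ p := by
    have h1 : (n : L) ^ p = (N : L) := by
      have := congrArg (algebraMap (𝓞 L) L) hnp
      rwa [_root_.map_pow, map_natCast] at this
    rw [← _root_.map_pow, h1, map_natCast]
  obtain ⟨i, hip, hi⟩ := hzL.eq_pow_of_pow_eq_one (ξ := s (n : L) / n) (by
    rw [div_pow, hsn, div_self (pow_ne_zero p hnL)])
  have hsn' : s (n : L) = algebraMap k L z ^ i * n := by rw [hi, div_mul_cancel₀ _ hnL]
  have hi0 : i ≠ 0 := by
    rintro rfl
    rw [pow_zero, one_mul] at hsn'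
    refine hs (AlgEquiv.restrictScalars_injective ℚ (aut_ext (k := k) hz hgen ?_ ?_))
    · rw [hn] at hsn'
      exact hsn'
    · rw [res_restrictScalars, res_restrictScalars]
  refine ⟨s, z ^ i, hord, hz.pow_of_coprime i
    (hp.coprime_iff_not_dvd.mpr
      (Nat.not_dvd_of_pos_of_lt (Nat.pos_of_ne_zero hi0) hip)).symm, ?_⟩
  rw [← hn]
  apply RingOfIntegers.ext
  rw [_root_.map_pow]
  exact hsn'

theorem dvd_classNumber [IsGalois K L] (hN : N.Prime) (hcong : (N : ZMod p) = -1)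
    (hp5 : 5 ≤ p) {α : K} (hroot : α ^ p = N) (hgen : Algebra.adjoin ℚ {α} = ⊤)
    (hk : IsCyclotomicExtension {p} ℚ k) : p ∣ classNumber K := by
  have hp : p.Prime := Fact.out
  have hz := (IsCyclotomicExtension.zeta_spec p ℚ k).toInteger_isPrimitiveRoot
  obtain ⟨hdeg, hKL⟩ := finrank_eq (k := k) (L := L) hz (finrank_eq_of_root hN hp hroot hgen) hgen
  have : IsGalois k L := isGalois_of_root hz hdeg hroot hgen
  obtain ⟨a, rfl⟩ : ∃ a : 𝓞 K, (a : K) = α :=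
    ⟨⟨α, IsIntegral.of_pow hp.pos (hroot ▸ isIntegral_natCast N)⟩, rfl⟩
  have ha : a ^ p = N := RingOfIntegers.ext (by simpa using hroot)
  obtain ⟨s, y, hs, hy, hsn⟩ := exists_kummer_generator (L := L) hz hdeg hN.ne_zero ha hgen
  have hn : algebraMap (𝓞 K) (𝓞 L) a ^ p = N := by rw [← map_pow, ha, map_natCast]
  refine dvd_classNumber_of_aut hN hcong hp5 hy hn hs hsn hdeg ?_ ?_
  · refine (Nat.bijective_iff_injective_and_card _).mpr ⟨res_injective (k := k) hz hgen, ?_⟩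
    rw [IsGalois.card_aut_eq_finrank, IsGalois.card_aut_eq_finrank, hKL]
  · intro t
    obtain ⟨e, he⟩ : ∃ e, e = (cyc p k (res k (t.restrictScalars ℚ)) : ZMod p).val := ⟨_, rfl⟩
    rw [← he]
    have hres (j : ℕ) : res k (s.restrictScalars ℚ ^ j) = 1 := by
      have h2 : res k (s.restrictScalars ℚ ^ j) = res k (s.restrictScalars ℚ) ^ j :=
        _root_.map_pow (AlgEquiv.restrictNormalHom k) _ j
      rw [h2, res_restrictScalars, one_pow]
    have ht : t.restrictScalars ℚ • algebraMap (𝓞 K) (𝓞 L) a = algebraMap (𝓞 K) (𝓞 L) a :=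
      smul_algebraMap_right t a
    have hsj (j : ℕ) : s.restrictScalars ℚ ^ j • algebraMap (𝓞 K) (𝓞 L) a =
        algebraMap (𝓞 k) (𝓞 L) y ^ j * algebraMap (𝓞 K) (𝓞 L) a := by
      induction j with
      | zero => rw [pow_zero, pow_zero, one_smul, one_mul]
      | succ j ih =>
        rw [pow_succ, mul_smul]
        have h1 : s.restrictScalars ℚ • algebraMap (𝓞 K) (𝓞 L) a =
          algebraMap (𝓞 k) (𝓞 L) y * algebraMap (𝓞 K) (𝓞 L) a := hsn
        rw [h1, smul_mul', ih, smul_algebraMap_eq, hres, one_smul, pow_succ]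
        ring
    refine aut_ext (k := k) hz hgen ?_ ?_
    · have h1 : (t.restrictScalars ℚ * s.restrictScalars ℚ) • algebraMap (𝓞 K) (𝓞 L) a =
          (s.restrictScalars ℚ ^ e * t.restrictScalars ℚ) • algebraMap (𝓞 K) (𝓞 L) a := by
        have h2 := hsj 1
        rw [pow_one, pow_one] at h2
        rw [mul_smul, mul_smul, ht, hsj, h2, smul_mul', ht, smul_algebraMap_eq, smul_root hy,
          ← he, _root_.map_pow]
      exact congrArg (algebraMap (𝓞 L) L) h1
    · rw [res_mul, res_mul, res_restrictScalars, hres, mul_one, one_mul]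

theorem dvd_classNumber_of_isCyclotomicExtension (L : Type*) [Field L] [NumberField L] [Algebra K L]
    [IsCyclotomicExtension {p} K L] (hN : N.Prime) (hcong : (N : ZMod p) = -1)
    (hp5 : 5 ≤ p) {α : K} (hroot : α ^ p = N) (hgen : Algebra.adjoin ℚ {α} = ⊤) :
    p ∣ classNumber K := by
  have hζ := IsCyclotomicExtension.zeta_spec p K L
  obtain ⟨E, hE⟩ : ∃ E, E = IntermediateField.adjoin ℚ {IsCyclotomicExtension.zeta p K L} :=
    ⟨_, rfl⟩
  have hk : @IsCyclotomicExtension {p} ℚ E _ _ DivisionRing.toRatAlgebra := by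
    have h := hE ▸ hζ.intermediateField_adjoin_isCyclotomicExtension ℚ
    have halg : (DivisionRing.toRatAlgebra : Algebra ℚ E) = E.algebra' := Subsingleton.elim _ _
    rw [halg]
    exact h
  have := IsCyclotomicExtension.isGalois {p} K L
  have := @IsCyclotomicExtension.isGalois {p} ℚ E _ _ DivisionRing.toRatAlgebra hk
  exact dvd_classNumber (k := E) (L := L) hN hcong hp5 hroot hgen hk

end Kummer

end ConeWeight

end

/-- If `N` and `p` are primes with `p ≥ 5` and `N ≡ -1 (mod p)`, then `p` divides the
class number of `ℚ(N^{1/p})`, the number field obtained by adjoining to `ℚ` a root of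
`x^p - N`. -/
theorem class_number_dvd_of_neg_one_mod_p
    (N p : ℕ) (hN : N.Prime) (hp : p.Prime) (hp5 : 5 ≤ p)
    (hcong : (N : ZMod p) = -1)
    (K : Type*) [Field K] [NumberField K] (α : K)
    (hroot : α ^ p = (N : K)) (hgen : Algebra.adjoin ℚ {α} = ⊤) :
    p ∣ NumberField.classNumber K := by
  have : Fact p.Prime := ⟨hp⟩
  exact ConeWeight.dvd_classNumber_of_isCyclotomicExtension (CyclotomicField p K) hN hcong hp5
    hroot hgen
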